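/- Limit of the MMSE: Let D = {λ > 0 : 𝓕(λ,·,·) has a unique maximizer (q₁*(λ), q₂*(λ)) over Γ(λ)}. Then (0,∞) ∖ D is countable, and for every λ ∈ D: MMSE_n(λ) → E[U²]·E[V²] − q₁*(λ)·q₂*(λ) as n → ∞, and E⟨(u·U)(v·V)⟩ → q₁*(λ)·q₂*(λ) as n → ∞, where (u,v) is a sample from the posterior Gibbs measure. -/

import Mathlib

open MeasureTheory ProbabilityTheory Filter Real
open scoped Topology

noncomputable section

/-- Standard Gaussian measure on `ℝ`. -/
def stdG : Measure ℝ := gaussianReal 0 1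

/-- The weight `exp(√γ·x·z + γ·x·x₀ − γ·x²/2)` appearing in the scalar Gaussian channel. -/
def scalarWeight (γ x₀ z x : ℝ) : ℝ :=
  Real.exp (Real.sqrt γ * x * z + γ * x * x₀ - γ * x ^ 2 / 2)

/-- Free energy `ψ_P(γ)` of the scalar Gaussian channel with prior `P`. -/
def psiF (P : Measure ℝ) [IsProbabilityMeasure P] (γ : ℝ) : ℝ :=
  ∫ p : ℝ × ℝ, Real.log (∫ x, scalarWeight γ p.1 p.2 x ∂P) ∂(P.prod stdG)

/-- Posterior mean `⟨x⟩_γ` in the scalar Gaussian channel (`x₀` is the signal, `z` the noise). -/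
def postMean (P : Measure ℝ) (γ x₀ z : ℝ) : ℝ :=
  (∫ x, x * scalarWeight γ x₀ z x ∂P) / (∫ x, scalarWeight γ x₀ z x ∂P)

/-- Overlap `F_P(γ) = E[X₀·⟨x⟩_γ]` of the scalar Gaussian channel. -/
def Fov (P : Measure ℝ) [IsProbabilityMeasure P] (γ : ℝ) : ℝ :=
  ∫ p : ℝ × ℝ, p.1 * postMean P γ p.1 p.2 ∂(P.prod stdG)

/-- The set `Γ(λ)` of fixed points of the state evolution equations. -/
def Gam (PU PV : Measure ℝ) [IsProbabilityMeasure PU] [IsProbabilityMeasure PV]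
    (lam : ℝ) : Set (ℝ × ℝ) :=
  {q | 0 ≤ q.1 ∧ 0 ≤ q.2 ∧ q.2 = Fov PU (lam * q.1) ∧ q.1 = Fov PV (lam * q.2)}

/-- The replica-symmetric potential `𝓕(λ,q₁,q₂)`. -/
def rsF (PU PV : Measure ℝ) [IsProbabilityMeasure PU] [IsProbabilityMeasure PV]
    (lam q₁ q₂ : ℝ) : ℝ :=
  psiF PU (lam * q₁) + psiF PV (lam * q₂) - lam / 2 * q₁ * q₂

/-- Prior distribution of the pair of vectors `(u,v)`. -/
def prior (PU PV : Measure ℝ) [IsProbabilityMeasure PU] [IsProbabilityMeasure PV]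
    (n : ℕ) : Measure ((Fin n → ℝ) × (Fin n → ℝ)) :=
  (Measure.pi fun _ => PU).prod (Measure.pi fun _ => PV)

/-- Law of the Gaussian noise matrix `Z`. -/
def noiseM (n : ℕ) : Measure (Fin n → Fin n → ℝ) :=
  Measure.pi fun _ => Measure.pi fun _ => stdG

/-- Joint law of `((U,V),Z)`. -/
def sampleM (PU PV : Measure ℝ) [IsProbabilityMeasure PU] [IsProbabilityMeasure PV]
    (n : ℕ) : Measure (((Fin n → ℝ) × (Fin n → ℝ)) × (Fin n → Fin n → ℝ)) :=
  (prior PU PV n).prod (noiseM n)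

/-- Hamiltonian `H_n(u,v)` of the planted bipartite model. -/
def Ham (lam : ℝ) (n : ℕ) (U V : Fin n → ℝ) (Z : Fin n → Fin n → ℝ)
    (u v : Fin n → ℝ) : ℝ :=
  ∑ i : Fin n, ∑ j : Fin n,
    (Real.sqrt (lam / n) * u i * v j * Z i j
      + lam / n * (u i * U i * v j * V j)
      - lam / (2 * n) * (u i ^ 2 * v j ^ 2))

/-- Partition function `Z_n = ∫ e^{H_n(u,v)} dP₀ⁿ(u,v)`. -/
def partFun (PU PV : Measure ℝ) [IsProbabilityMeasure PU] [IsProbabilityMeasure PV]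
    (lam : ℝ) (n : ℕ)
    (ω : ((Fin n → ℝ) × (Fin n → ℝ)) × (Fin n → Fin n → ℝ)) : ℝ :=
  ∫ uv, Real.exp (Ham lam n ω.1.1 ω.1.2 ω.2 uv.1 uv.2) ∂(prior PU PV n)

/-- Free energy `F_n(λ) = (1/n)·E[log Z_n]`. -/
def freeEnergy (PU PV : Measure ℝ) [IsProbabilityMeasure PU] [IsProbabilityMeasure PV]
    (n : ℕ) (lam : ℝ) : ℝ :=
  (1 / (n : ℝ)) * ∫ ω, Real.log (partFun PU PV lam n ω) ∂(sampleM PU PV n)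

/-- Gibbs (posterior) expectation `⟨f(u,v)⟩` given the realization `ω = ((U,V),Z)`. -/
def gibbs (PU PV : Measure ℝ) [IsProbabilityMeasure PU] [IsProbabilityMeasure PV]
    (lam : ℝ) (n : ℕ)
    (ω : ((Fin n → ℝ) × (Fin n → ℝ)) × (Fin n → Fin n → ℝ))
    (f : (Fin n → ℝ) × (Fin n → ℝ) → ℝ) : ℝ :=
  (∫ uv, f uv * Real.exp (Ham lam n ω.1.1 ω.1.2 ω.2 uv.1 uv.2) ∂(prior PU PV n))
    / partFun PU PV lam n ω

/-- Rescaled scalar product `x·y = (1/n)·Σᵢ xᵢyᵢ`. -/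
def ovDot (n : ℕ) (x y : Fin n → ℝ) : ℝ := (1 / (n : ℝ)) * ∑ i, x i * y i

/-- Matrix minimum mean square error `MMSE_n(λ)`, with `E[U_iV_j | Y] = ⟨u_i v_j⟩` written
as the Gibbs (posterior) mean. -/
def MMSEn (PU PV : Measure ℝ) [IsProbabilityMeasure PU] [IsProbabilityMeasure PV]
    (n : ℕ) (lam : ℝ) : ℝ :=
  (1 / (n : ℝ) ^ 2) * ∑ i : Fin n, ∑ j : Fin n,
    ∫ ω, (ω.1.1 i * ω.1.2 j - gibbs PU PV lam n ω fun uv => uv.1 i * uv.2 j) ^ 2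
      ∂(sampleM PU PV n)

/-- The quantity `E⟨(u·U)(v·V)⟩`. -/
def overlapExp (PU PV : Measure ℝ) [IsProbabilityMeasure PU] [IsProbabilityMeasure PV]
    (n : ℕ) (lam : ℝ) : ℝ :=
  ∫ ω, gibbs PU PV lam n ω (fun uv => ovDot n uv.1 ω.1.1 * ovDot n uv.2 ω.1.2)
    ∂(sampleM PU PV n)

/-- `q` maximizes `𝓕(λ,·,·)` over `Γ(λ)`. -/
def isMaximizer (PU PV : Measure ℝ) [IsProbabilityMeasure PU] [IsProbabilityMeasure PV]
    (lam : ℝ) (q : ℝ × ℝ) : Prop :=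
  q ∈ Gam PU PV lam ∧ ∀ q' ∈ Gam PU PV lam, rsF PU PV lam q'.1 q'.2 ≤ rsF PU PV lam q.1 q.2

/-- The set `D` of `λ > 0` where `𝓕(λ,·,·)` has a unique maximizer over `Γ(λ)`. -/
def Dset (PU PV : Measure ℝ) [IsProbabilityMeasure PU] [IsProbabilityMeasure PV] :
    Set ℝ :=
  {lam | 0 < lam ∧ ∃! q : ℝ × ℝ, isMaximizer PU PV lam q}

section Part1

instance stdG_prob : IsProbabilityMeasure stdG := by unfold stdG; infer_instance

/-- Standard Gaussian measure on `A → ℝ`. -/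
def gA (A : Type*) [Fintype A] : Measure (A → ℝ) := Measure.pi fun _ => stdG

instance gA_prob (A : Type*) [Fintype A] : IsProbabilityMeasure (gA A) := by
  unfold gA; infer_instance

section resample
variable {ι : Type*} [Fintype ι] [DecidableEq ι]

theorem pi_resample (μ : ι → Measure ℝ) [∀ i, IsProbabilityMeasure (μ i)] (i : ι) :
    MeasurePreserving (fun p : (ι → ℝ) × ℝ => Function.update p.1 i p.2)
      ((Measure.pi μ).prod (μ i)) (Measure.pi μ) := by
  have hm : Measurable (fun p : (ι → ℝ) × ℝ => Function.update p.1 i p.2) := by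
    refine measurable_pi_iff.2 fun j => ?_
    by_cases h : j = i
    · subst h; simpa using measurable_snd
    · simp only [Function.update_of_ne h]
      exact (measurable_pi_apply j).comp measurable_fst
  refine ⟨hm, ?_⟩
  refine (Measure.pi_eq fun s hs => ?_).symm
  rw [Measure.map_apply hm (MeasurableSet.univ_pi hs)]
  have : (fun p : (ι → ℝ) × ℝ => Function.update p.1 i p.2) ⁻¹' (Set.univ.pi s)
      = (Set.univ.pi (Function.update s i Set.univ)) ×ˢ (s i) := by
    ext p
    simp only [Set.mem_preimage, Set.mem_pi, Set.mem_univ, true_implies, Set.mem_prod]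
    constructor
    · intro h
      refine ⟨fun j => ?_, by simpa using h i⟩
      by_cases hj : j = i
      · subst hj; simp
      · simpa [Function.update_of_ne hj] using h j
    · rintro ⟨h1, h2⟩ j
      by_cases hj : j = i
      · subst hj; simpa using h2
      · simpa [Function.update_of_ne hj] using h1 j
  rw [this, Measure.prod_prod, Measure.pi_pi]
  rw [← Finset.mul_prod_erase Finset.univ _ (Finset.mem_univ i),
    ← Finset.mul_prod_erase Finset.univ (fun j => μ j (s j)) (Finset.mem_univ i)]
  have : ∏ x ∈ Finset.univ.erase i, (μ x) (Function.update s i Set.univ x)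
     = ∏ x ∈ Finset.univ.erase i, (μ x) (s x) :=
    Finset.prod_congr rfl fun j hj => by rw [Function.update_of_ne (Finset.ne_of_mem_erase hj)]
  rw [this]; simp [mul_comm]

theorem integral_resample (μ : ι → Measure ℝ) [∀ i, IsProbabilityMeasure (μ i)] (i : ι)
    {f : (ι → ℝ) → ℝ} (hf : Integrable f (Measure.pi μ)) :
    Integrable (fun x => ∫ y, f (Function.update x i y) ∂(μ i)) (Measure.pi μ) ∧
    ∫ x, f x ∂(Measure.pi μ) = ∫ x, ∫ y, f (Function.update x i y) ∂(μ i) ∂(Measure.pi μ) := by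
  have h := pi_resample μ i
  have hintg : Integrable (fun p : (ι → ℝ) × ℝ => f (Function.update p.1 i p.2))
      ((Measure.pi μ).prod (μ i)) := h.integrable_comp_of_integrable hf
  refine ⟨hintg.integral_prod_left, ?_⟩
  have h2 : ∫ x, f x ∂(Measure.pi μ)
      = ∫ p, f (Function.update p.1 i p.2) ∂((Measure.pi μ).prod (μ i)) := by
    conv_lhs => rw [← h.map_eq]
    rw [integral_map h.measurable.aemeasurable]
    rw [h.map_eq]; exact hf.aestronglyMeasurable
  rw [h2, integral_prod _ hintg]

end resample

/-! ### one dimensional Gaussian facts -/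

theorem integrable_exp_abs (c : ℝ) : Integrable (fun y => Real.exp (c * |y|)) stdG := by
  have h1 : Integrable (fun y => Real.exp (c * y)) stdG := integrable_exp_mul_gaussianReal c
  have h2 : Integrable (fun y => Real.exp (-c * y)) stdG := integrable_exp_mul_gaussianReal (-c)
  refine (h1.add h2).mono' (by fun_prop) (Eventually.of_forall fun y => ?_)
  rw [Real.norm_eq_abs, abs_of_pos (Real.exp_pos _)]
  simp only [Pi.add_apply]
  rcases abs_cases y with ⟨h, _⟩ | ⟨h, _⟩ <;> rw [h]
  · linarith [Real.exp_pos (-c * y)]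
  · have : c * -y = -c * y := by ring
    rw [this]; linarith [Real.exp_pos (c * y)]

theorem stdG_integral (g : ℝ → ℝ) :
    ∫ y, g y ∂stdG = ∫ y, gaussianPDFReal 0 1 y * g y := by
  unfold stdG
  rw [integral_gaussianReal_eq_integral_smul (by norm_num)]
  simp

theorem stdG_integrable_iff (g : ℝ → ℝ) :
    Integrable g stdG ↔ Integrable (fun y => gaussianPDFReal 0 1 y * g y) := by
  unfold stdG
  rw [gaussianReal_of_var_ne_zero _ (by norm_num),
    integrable_withDensity_iff_integrable_smul' (measurable_gaussianPDF 0 1)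
      (Eventually.of_forall fun _ => gaussianPDF_lt_top)]
  simp

theorem hasDerivAt_pdf (y : ℝ) :
    HasDerivAt (gaussianPDFReal 0 1) (-(y * gaussianPDFReal 0 1 y)) y := by
  rw [gaussianPDFReal_def]
  have : HasDerivAt (fun y : ℝ => -(y - 0) ^ 2 / (2 * ((1 : NNReal) : ℝ))) (-y) y := by
    have := ((((hasDerivAt_id y).sub_const 0).pow 2).neg).div_const (2 * ((1 : NNReal) : ℝ))
    convert! this using 1
    simp; ring
  convert! (this.exp.const_mul ((√(2 * π * ((1 : NNReal) : ℝ)))⁻¹)) using 1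
  ring

/-- Stein's lemma in dimension one. -/
theorem stein1 {g g' : ℝ → ℝ} (hg : ∀ y, HasDerivAt g (g' y) y)
    (h1 : Integrable g stdG) (h2 : Integrable (fun y => y * g y) stdG)
    (h3 : Integrable g' stdG) :
    ∫ y, y * g y ∂stdG = ∫ y, g' y ∂stdG := by
  rw [stdG_integral, stdG_integral]
  rw [stdG_integrable_iff] at h1 h2 h3
  have := integral_mul_deriv_eq_deriv_mul_of_integrable (u := g) (u' := g')
    (v := gaussianPDFReal 0 1) (v' := fun y => -(y * gaussianPDFReal 0 1 y))
    (fun x _ => hg x) (fun x _ => hasDerivAt_pdf x)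
    (by convert! h2.neg using 1; ext y; simp; ring)
    (by convert! h3 using 1; ext y; simp; ring)
    (by convert! h1 using 1; ext y; simp; ring)
  have e1 : ∫ y, gaussianPDFReal 0 1 y * (y * g y) = -∫ y, g y * -(y * gaussianPDFReal 0 1 y) := by
    rw [← integral_neg]; congr 1; ext y; ring
  rw [e1, this, neg_neg]; congr 1; ext y; ring

section multi
variable {A : Type*} [Fintype A]

/-- Exponential dominating function. -/
def edom (c : ℝ) (z : A → ℝ) : ℝ := Real.exp (c * ∑ a, |z a|)

theorem edom_pos (c : ℝ) (z : A → ℝ) : 0 < edom c z := Real.exp_pos _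

theorem continuous_edom (c : ℝ) : Continuous (edom (A := A) c) := by
  unfold edom; fun_prop

theorem integrable_edom (c : ℝ) : Integrable (edom (A := A) c) (gA A) := by
  have := Integrable.fintype_prod (ι := A) (f := fun _ y => Real.exp (c * |y|)) (μ := fun _ => stdG)
    (fun _ => integrable_exp_abs c)
  refine this.congr (Eventually.of_forall fun z => ?_)
  simp only [edom]
  rw [Finset.mul_sum, Real.exp_sum]

theorem integrable_of_edom {f : (A → ℝ) → ℝ} (hf : Continuous f) {C c : ℝ}
    (hb : ∀ z, |f z| ≤ C * edom c z) : Integrable f (gA A) :=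
  ((integrable_edom c).const_mul C).mono' hf.aestronglyMeasurable
    (Eventually.of_forall fun z => by simpa using hb z)

/-- Gaussian integration by parts in coordinate `a`. -/
theorem steinA [DecidableEq A] (a : A) {H H' : (A → ℝ) → ℝ} (hH : Continuous H) (hH' : Continuous H')
    (hd : ∀ z y, HasDerivAt (fun y => H (Function.update z a y)) (H' (Function.update z a y)) y)
    {C c : ℝ} (hb : ∀ z, |H z| ≤ C * edom c z) (hb' : ∀ z, |H' z| ≤ C * edom c z) :
    ∫ z, z a * H z ∂(gA A) = ∫ z, H' z ∂(gA A) := by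
  have hC : 0 ≤ C := by
    have := (abs_nonneg _).trans (hb 0)
    exact nonneg_of_mul_nonneg_left this (edom_pos _ _)
  have i1 : Integrable (fun z => z a * H z) (gA A) := by
    refine integrable_of_edom (C := C) (c := c + 1) (by fun_prop) fun z => ?_
    rw [abs_mul]
    have h1 : |z a| ≤ edom 1 z := by
      have h : |z a| ≤ ∑ b, |z b| :=
        Finset.single_le_sum (f := fun b => |z b|) (fun _ _ => abs_nonneg _) (Finset.mem_univ a)
      unfold edom
      linarith [Real.add_one_le_exp (1 * ∑ b, |z b|)]
    have h2 : edom (c + 1) z = edom 1 z * edom c z := by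
      unfold edom; rw [← Real.exp_add]; ring_nf
    rw [h2]
    calc |z a| * |H z| ≤ edom 1 z * (C * edom c z) :=
          mul_le_mul h1 (hb z) (abs_nonneg _) (edom_pos _ _).le
      _ = _ := by ring
  have i2 : Integrable H' (gA A) := integrable_of_edom hH' hb'
  have r1 := (integral_resample (fun _ : A => stdG) a i1).2
  have r2 := (integral_resample (fun _ : A => stdG) a i2).2
  unfold gA
  rw [r1, r2]
  refine integral_congr_ae (Eventually.of_forall fun z => ?_)
  simp only [Function.update_self]
  -- one-dimensional bounds
  have hcu : Continuous (fun y => Function.update z a y) := continuous_const.update a continuous_id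
  have hed : ∀ k y, edom k (Function.update z a y)
      = Real.exp (k * ∑ b ∈ Finset.univ.erase a, |z b|) * Real.exp (k * |y|) := by
    intro k y
    unfold edom
    rw [← Finset.add_sum_erase _ _ (Finset.mem_univ a), ← Real.exp_add]
    have : ∑ x ∈ Finset.univ.erase a, |Function.update z a y x|
        = ∑ x ∈ Finset.univ.erase a, |z x| :=
      Finset.sum_congr rfl fun j hj => by rw [Function.update_of_ne (Finset.ne_of_mem_erase hj)]
    rw [this]; simp; ring
  have key : ∀ (g : ℝ → ℝ) (D k : ℝ), Continuous g → (∀ y, |g y| ≤ D * Real.exp (k * |y|)) →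
      Integrable g stdG := fun g D k hg hb =>
    ((integrable_exp_abs k).const_mul D).mono' hg.aestronglyMeasurable
      (Eventually.of_forall fun z => by simpa using hb z)
  set E := Real.exp (c * ∑ b ∈ Finset.univ.erase a, |z b|)
  refine stein1 (hd z) (key _ (C * E) c (hH.comp hcu) fun y => ?_)
    (key _ (C * E) (c + 1) (continuous_id.mul (hH.comp hcu)) fun y => ?_)
    (key _ (C * E) c (hH'.comp hcu) fun y => ?_)
  · have := hb (Function.update z a y); rw [hed] at this; rw [mul_assoc]; exact this
  · have := hb (Function.update z a y); rw [hed] at this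
    show |y * H (Function.update z a y)| ≤ _
    rw [abs_mul]
    have h1 : |y| ≤ Real.exp (|y|) := by linarith [Real.add_one_le_exp (|y|)]
    have h2 : Real.exp ((c + 1) * |y|) = Real.exp (|y|) * Real.exp (c * |y|) := by
      rw [← Real.exp_add]; ring_nf
    rw [h2]
    calc |y| * |H (Function.update z a y)| ≤ Real.exp (|y|) * (C * (E * Real.exp (c * |y|))) :=
          mul_le_mul h1 this (abs_nonneg _) (Real.exp_pos _).le
      _ = _ := by ring
  · have := hb' (Function.update z a y); rw [hed] at this; rw [mul_assoc]; exact this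

end multi

end Part1

section Part2

theorem stdG_shift1 (b : ℝ) {s : Set ℝ} (hs : MeasurableSet s) :
    (gaussianReal b 1) s
      = ENNReal.ofReal (∫ y, s.indicator (fun y => Real.exp (b * y - b ^ 2 / 2)) y ∂stdG) := by
  rw [gaussianReal_apply_eq_integral _ (by norm_num), stdG_integral]
  congr 1
  rw [← integral_indicator hs]
  congr 1; ext y
  by_cases h : y ∈ s
  · simp only [Set.indicator_of_mem h, gaussianPDFReal_def]
    rw [mul_assoc (_⁻¹) (rexp (-(y - 0) ^ 2 / (2 * ((1 : NNReal) : ℝ)))), ← Real.exp_add]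
    congr 2
    simp; ring
  · simp [Set.indicator_of_notMem h]

theorem integrable_expb (b : ℝ) : Integrable (fun y => Real.exp (b * y - b ^ 2 / 2)) stdG := by
  have h1 : Integrable (fun y => Real.exp (b * y)) stdG := integrable_exp_mul_gaussianReal b
  refine (h1.mul_const (Real.exp (-(b^2/2)))).congr (Eventually.of_forall fun y => ?_)
  simp only [← Real.exp_add]; ring_nf

section
variable {A : Type*} [Fintype A]

theorem gA_shift (b : A → ℝ) :
    (gA A).map (fun z => z + b)
      = (gA A).withDensity (fun z => ENNReal.ofReal (Real.exp (∑ a, (b a * z a - b a ^ 2 / 2)))) := by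
  have h1 : (gA A).map (fun z => z + b) = Measure.pi fun a => gaussianReal (b a) 1 := by
    have := Measure.pi_map_pi (μ := fun _ : A => stdG) (f := fun a y => y + b a)
      (fun a => by fun_prop)
    have e : (fun z : A → ℝ => z + b) = fun z a => z a + b a := by ext; simp
    unfold gA
    rw [e, this]
    congr 1; ext1 a
    unfold stdG
    rw [gaussianReal_map_add_const]; simp
  rw [h1]
  refine (Measure.pi_eq fun s hs => ?_)
  rw [withDensity_apply _ (MeasurableSet.univ_pi hs)]
  have hi : Integrable (fun z : A → ℝ => ∏ a, (s a).indicator (fun y => Real.exp (b a * y - b a ^ 2 / 2)) (z a)) (gA A) :=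
    Integrable.fintype_prod (ι := A) (μ := fun _ => stdG) (fun a => (integrable_expb (b a)).indicator (hs a))
  have h0 : ∀ a y, 0 ≤ (s a).indicator (fun y => Real.exp (b a * y - b a ^ 2 / 2)) y :=
    fun a y => Set.indicator_nonneg (fun _ _ => (Real.exp_pos _).le) _
  have h2 : ∫⁻ z in Set.univ.pi s, ENNReal.ofReal (Real.exp (∑ a, (b a * z a - b a ^ 2 / 2))) ∂(gA A)
      = ∫⁻ z, ENNReal.ofReal (∏ a, (s a).indicator (fun y => Real.exp (b a * y - b a ^ 2 / 2)) (z a)) ∂(gA A) := by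
    rw [← lintegral_indicator (MeasurableSet.univ_pi hs)]
    refine lintegral_congr fun z => ?_
    by_cases h : z ∈ Set.univ.pi s
    · rw [Set.indicator_of_mem h, Real.exp_sum]
      congr 1
      refine Finset.prod_congr rfl fun a _ => ?_
      rw [Set.indicator_of_mem (h a (Set.mem_univ a))]
    · rw [Set.indicator_of_notMem h]
      simp only [Set.mem_pi, Set.mem_univ, true_implies, not_forall] at h
      obtain ⟨a, ha⟩ := h
      rw [Finset.prod_eq_zero (Finset.mem_univ a) (Set.indicator_of_notMem ha _)]; simp
  rw [h2, ← ofReal_integral_eq_lintegral_ofReal hi (Eventually.of_forall fun z =>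
    Finset.prod_nonneg fun a _ => h0 a _)]
  have h3 := integral_fintype_prod_eq_prod (ι := A) (μ := fun _ => stdG) (fun a y => (s a).indicator (fun y => Real.exp (b a * y - b a ^ 2 / 2)) y)
  unfold gA
  rw [h3, ENNReal.ofReal_prod_of_nonneg fun a _ => integral_nonneg (h0 a)]
  refine Finset.prod_congr rfl fun a _ => ?_
  rw [stdG_shift1 _ (hs a)]

theorem integral_shift (b : A → ℝ) {X : (A → ℝ) → ℝ} (hX : Continuous X) :
    ∫ z, X (z + b) ∂(gA A) = ∫ z, Real.exp (∑ a, (b a * z a - b a ^ 2 / 2)) * X z ∂(gA A) := by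
  have h := gA_shift b
  have h1 : ∫ z, X (z + b) ∂(gA A) = ∫ z, X z ∂((gA A).map (fun z => z + b)) := by
    rw [integral_map (by fun_prop) hX.aestronglyMeasurable]
  rw [h1, h, integral_withDensity_eq_integral_toReal_smul (by fun_prop) (by simp)]
  refine integral_congr_ae (Eventually.of_forall fun z => ?_)
  simp [ENNReal.toReal_ofReal (Real.exp_pos _).le]

end

section ES
variable {ι : Type*} [Fintype ι] [DecidableEq ι]

theorem efron_stein_aux (μ : ι → Measure ℝ) [∀ i, IsProbabilityMeasure (μ i)]
    (hμ : ∀ i, Integrable (fun x => x ^ 2) (μ i)) (T : Finset ι) :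
    ∀ (L : ι → ℝ) (f : (ι → ℝ) → ℝ), (∀ i, 0 ≤ L i) → (∀ i ∉ T, L i = 0) →
    (∀ x y, |f x - f y| ≤ ∑ i, L i * |x i - y i|) →
    ∫ x, f x ^ 2 ∂(Measure.pi μ) - (∫ x, f x ∂(Measure.pi μ)) ^ 2
      ≤ ∑ i ∈ T, L i ^ 2 * ∫ x, x ^ 2 ∂(μ i) := by
  induction T using Finset.induction_on with
  | empty =>
    intro L f hL hT hf
    have : ∀ x, f x = f 0 := fun x => by
      have := hf x 0
      simp only [hT _ (Finset.notMem_empty _), zero_mul, Finset.sum_const_zero] at this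
      exact sub_eq_zero.1 (abs_nonpos_iff.1 this)
    simp_rw [fun x => this x]; simp
  | insert i T hi ih =>
    intro L f hL hT hf
    have hcont : ∀ (g : (ι → ℝ) → ℝ), (∀ x y, |g x - g y| ≤ ∑ i, L i * |x i - y i|) →
        Continuous g := by
      intro g hg
      rw [continuous_iff_continuousAt]
      intro x
      rw [ContinuousAt, tendsto_iff_norm_sub_tendsto_zero]
      refine squeeze_zero (fun _ => norm_nonneg _) (fun y => hg y x) ?_
      have : Continuous fun y : ι → ℝ => ∑ i, L i * |y i - x i| := by fun_prop
      simpa using this.tendsto x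
    have hint2 : ∀ (g : (ι → ℝ) → ℝ), (∀ x y, |g x - g y| ≤ ∑ i, L i * |x i - y i|) →
        MemLp g 2 (Measure.pi μ) := by
      intro g hg
      have hc := hcont g hg
      have h1 : ∀ j, MemLp (fun x : ι → ℝ => L j * |x j|) 2 (Measure.pi μ) := by
        intro j
        have hj : MemLp (fun x : ℝ => x) 2 (μ j) := by
          rw [memLp_two_iff_integrable_sq (by fun_prop)]; exact hμ j
        have := hj.comp_measurePreserving (measurePreserving_eval μ j)
        exact (this.norm).const_mul (L j)
      have h2 : MemLp (fun x : ι → ℝ => |g 0| + ∑ j, L j * |x j|) 2 (Measure.pi μ) :=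
        by
          have h4 : MemLp (fun x : ι → ℝ => ∑ j, L j * |x j|) 2 (Measure.pi μ) :=
            memLp_finsetSum (f := fun j (x : ι → ℝ) => L j * |x j|) _ fun j _ => h1 j
          exact MemLp.add (memLp_const (|g 0|)) h4
      refine h2.mono hc.aestronglyMeasurable (Eventually.of_forall fun x => ?_)
      have h3 := hg x 0
      simp only [Pi.zero_apply, sub_zero] at h3
      rw [Real.norm_eq_abs, Real.norm_eq_abs]
      refine le_trans ?_ (le_abs_self _)
      have : |g x| ≤ |g x - g 0| + |g 0| := by
        have := abs_add_le (g x - g 0) (g 0); simpa using this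
      linarith
    set g : (ι → ℝ) → ℝ := fun x => ∫ y, f (Function.update x i y) ∂(μ i) with hg
    have hf1 : Integrable f (Measure.pi μ) := (hint2 f hf).integrable (by norm_num)
    have hf2 : Integrable (fun x => f x ^ 2) (Measure.pi μ) := (hint2 f hf).integrable_sq
    have hupd : ∀ x y, |f (Function.update x i y) - f (Function.update x i 0)| ≤ L i * |y| := by
      intro x y
      refine (hf _ _).trans (le_of_eq ?_)
      rw [Finset.sum_eq_single i]
      · simp
      · intro j _ hj; simp [Function.update_of_ne hj]
      · simp
    have hfc := hcont f hf
    have hcu : ∀ x : ι → ℝ, Continuous (fun y => Function.update x i y) :=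
      fun x => continuous_const.update i continuous_id
    have hm1 : ∀ x, MemLp (fun y => f (Function.update x i y)) 2 (μ i) := by
      intro x
      have hj : MemLp (fun x : ℝ => x) 2 (μ i) := by
        rw [memLp_two_iff_integrable_sq (by fun_prop)]; exact hμ i
      have h2 : MemLp (fun y : ℝ => |f (Function.update x i 0)| + L i * |y|) 2 (μ i) :=
        MemLp.add (memLp_const (|f (Function.update x i 0)|))
          (show MemLp (fun y : ℝ => L i * |y|) 2 (μ i) from (hj.norm).const_mul (L i))
      refine h2.mono (hfc.comp (hcu x)).aestronglyMeasurable (Eventually.of_forall fun y => ?_)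
      rw [Real.norm_eq_abs, Real.norm_eq_abs]
      refine le_trans ?_ (le_abs_self _)
      have h3 := hupd x y
      have := abs_add_le (f (Function.update x i y) - f (Function.update x i 0)) (f (Function.update x i 0))
      simp only [sub_add_cancel] at this
      linarith
    have hi1 : ∀ x, Integrable (fun y => f (Function.update x i y)) (μ i) := fun x =>
      (hm1 x).integrable (by norm_num)
    set L' : ι → ℝ := Function.update L i 0 with hL'
    have hgL' : ∀ x y, |g x - g y| ≤ ∑ j, L' j * |x j - y j| := by
      intro x y
      rw [hg]; simp only
      rw [← integral_sub (hi1 x) (hi1 y)]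
      refine (abs_integral_le_integral_abs).trans ?_
      have : ∀ s, |f (Function.update x i s) - f (Function.update y i s)| ≤ ∑ j, L' j * |x j - y j| := by
        intro s
        refine (hf _ _).trans (le_of_eq (Finset.sum_congr rfl fun j _ => ?_))
        by_cases hj : j = i
        · subst hj; simp [hL']
        · simp [hL', Function.update_of_ne hj]
      calc _ ≤ ∫ s, (∑ j, L' j * |x j - y j|) ∂(μ i) :=
            integral_mono ((hi1 x).sub (hi1 y)).abs (integrable_const _) this
        _ = _ := by simp
    have hL'0 : ∀ j, 0 ≤ L' j := by
      intro j; by_cases hj : j = i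
      · subst hj; simp [hL']
      · simp [hL', Function.update_of_ne hj, hL j]
    have hgL : ∀ x y, |g x - g y| ≤ ∑ j, L j * |x j - y j| := by
      intro x y
      refine (hgL' x y).trans (Finset.sum_le_sum fun j _ => ?_)
      refine mul_le_mul_of_nonneg_right ?_ (abs_nonneg _)
      by_cases hj : j = i
      · subst hj; simp [hL', hL j]
      · simp [hL', Function.update_of_ne hj]
    have key := ih L' g hL'0 (fun j hj => by
      by_cases hji : j = i
      · subst hji; simp [hL']
      · simp only [hL', Function.update_of_ne hji]; exact hT j (by simp [hji, hj])) hgL'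
    have hsum : ∑ j ∈ T, L' j ^ 2 * ∫ x, x ^ 2 ∂(μ j) = ∑ j ∈ T, L j ^ 2 * ∫ x, x ^ 2 ∂(μ j) :=
      Finset.sum_congr rfl fun j hj => by
        rw [hL', Function.update_of_ne (show j ≠ i by rintro rfl; exact hi hj)]
    have e1 : ∫ x, f x ∂(Measure.pi μ) = ∫ x, g x ∂(Measure.pi μ) := (integral_resample μ i hf1).2
    have e2 := integral_resample μ i hf2
    have hg2 : Integrable (fun x => g x ^ 2) (Measure.pi μ) := (hint2 g hgL).integrable_sq
    have step : ∀ x, ∫ y, f (Function.update x i y) ^ 2 ∂(μ i) ≤ g x ^ 2 + L i ^ 2 * ∫ y, y ^ 2 ∂(μ i) := by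
      intro x
      set c := f (Function.update x i 0)
      have h1 : ∫ y, (f (Function.update x i y) - c) ^ 2 ∂(μ i) ≤ L i ^ 2 * ∫ y, y ^ 2 ∂(μ i) := by
        rw [← integral_const_mul]
        refine integral_mono (((hm1 x).sub (memLp_const c)).integrable_sq) ((hμ i).const_mul _) fun y => ?_
        have := hupd x y
        simp only
        rw [← sq_abs, ← sq_abs y, ← mul_pow]
        exact pow_le_pow_left₀ (abs_nonneg _) this 2
      have h2 : ∫ y, (f (Function.update x i y) - c) ^ 2 ∂(μ i)
          = ∫ y, f (Function.update x i y) ^ 2 ∂(μ i) - 2 * c * g x + c ^ 2 := by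
        have : ∀ y, (f (Function.update x i y) - c) ^ 2
          = f (Function.update x i y) ^ 2 - 2 * c * f (Function.update x i y) + c ^ 2 := fun y => by ring
        simp_rw [this]
        have i1 : Integrable (fun y => f (Function.update x i y) ^ 2 - 2 * c * f (Function.update x i y)) (μ i) :=
          ((hm1 x).integrable_sq).sub ((hi1 x).const_mul _)
        rw [integral_add i1 (integrable_const _),
          integral_sub ((hm1 x).integrable_sq) ((hi1 x).const_mul _), integral_const_mul]
        simp [hg]
      nlinarith [sq_nonneg (g x - c)]
    have e3 : ∫ x, f x ^ 2 ∂(Measure.pi μ) ≤ ∫ x, g x ^ 2 ∂(Measure.pi μ) + L i ^ 2 * ∫ y, y ^ 2 ∂(μ i) := by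
      rw [e2.2]
      calc _ ≤ ∫ x, (g x ^ 2 + L i ^ 2 * ∫ y, y ^ 2 ∂(μ i)) ∂(Measure.pi μ) :=
            integral_mono e2.1 (hg2.add (integrable_const _)) step
        _ = _ := by rw [integral_add hg2 (integrable_const _)]; simp
    rw [Finset.sum_insert hi, e1]
    linarith [hsum]

/-- Efron–Stein inequality for Lipschitz functions. -/
theorem efron_stein (μ : ι → Measure ℝ) [∀ i, IsProbabilityMeasure (μ i)]
    (hμ : ∀ i, Integrable (fun x => x ^ 2) (μ i))
    (L : ι → ℝ) (f : (ι → ℝ) → ℝ) (hL : ∀ i, 0 ≤ L i)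
    (hf : ∀ x y, |f x - f y| ≤ ∑ i, L i * |x i - y i|) :
    ∫ x, f x ^ 2 ∂(Measure.pi μ) - (∫ x, f x ∂(Measure.pi μ)) ^ 2
      ≤ ∑ i, L i ^ 2 * ∫ x, x ^ 2 ∂(μ i) :=
  efron_stein_aux μ hμ Finset.univ L f hL (by simp) hf
end ES

end Part2

section Part3

/-- A finite-state Gaussian inference model with states `κ` and channels `A`. -/
structure FinModel (κ A : Type*) [Fintype κ] where
  w : κ → ℝ
  x : κ → A → ℝ
  B : ℝ
  hw : ∀ k, 0 ≤ w k
  hw1 : ∑ k, w k = 1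
  hB : 0 ≤ B
  hx : ∀ k a, |x k a| ≤ B

namespace FinModel
variable {κ A : Type*} [Fintype κ] (M : FinModel κ A)

/-- Generic partition function. -/
def gz (E : κ → ℝ) : ℝ := ∑ k, M.w k * Real.exp (E k)
/-- Generic Gibbs average. -/
def ga (f : κ → ℝ) (E : κ → ℝ) : ℝ := (∑ k, M.w k * f k * Real.exp (E k)) / M.gz E
theorem gz_pos (E : κ → ℝ) : 0 < M.gz E := by
  unfold gz
  refine Finset.sum_pos' (fun k _ => mul_nonneg (M.hw k) (Real.exp_pos _).le) ?_
  by_contra h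
  push Not at h
  have : ∑ k, M.w k = 0 := Finset.sum_eq_zero fun k hk => by
    have h1 := h k hk
    have h2 : M.w k ≤ 0 := by
      by_contra h3
      push Not at h3
      exact absurd h1 (not_le.2 (mul_pos h3 (Real.exp_pos _)))
    exact le_antisymm h2 (M.hw k)
  rw [M.hw1] at this; norm_num at this


theorem ga_add (f g : κ → ℝ) (E) : M.ga (f + g) E = M.ga f E + M.ga g E := by
  unfold ga
  rw [← add_div, ← Finset.sum_add_distrib]; congr 1
  refine Finset.sum_congr rfl fun k _ => ?_
  simp only [Pi.add_apply]; ring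

theorem ga_const_mul (c : ℝ) (g : κ → ℝ) (E) : M.ga (fun k => c * g k) E = c * M.ga g E := by
  unfold ga
  rw [← mul_div_assoc, Finset.mul_sum]; congr 1
  refine Finset.sum_congr rfl fun k _ => ?_
  ring

theorem ga_sum {ι : Type*} (T : Finset ι) (f : ι → κ → ℝ) (E) :
    M.ga (fun k => ∑ i ∈ T, f i k) E = ∑ i ∈ T, M.ga (f i) E := by
  unfold ga
  rw [← Finset.sum_div, Finset.sum_comm]; congr 1
  refine Finset.sum_congr rfl fun k _ => ?_
  rw [Finset.mul_sum, Finset.sum_mul]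

theorem ga_one (E) : M.ga (fun _ => 1) E = 1 := by
  unfold ga
  rw [div_eq_one_iff_eq (M.gz_pos E).ne']; simp [gz]

theorem ga_mono {f g : κ → ℝ} (h : ∀ k, f k ≤ g k) (E) : M.ga f E ≤ M.ga g E := by
  unfold ga
  refine div_le_div_of_nonneg_right ?_ (M.gz_pos E).le
  refine Finset.sum_le_sum fun k _ => ?_
  exact mul_le_mul_of_nonneg_right (mul_le_mul_of_nonneg_left (h k) (M.hw k)) (Real.exp_pos _).le

theorem ga_const (c : ℝ) (E) : M.ga (fun _ => c) E = c := by
  have := M.ga_const_mul c (fun _ => 1) E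
  simpa [M.ga_one] using this

theorem abs_ga_le {f : κ → ℝ} {C : ℝ} (h : ∀ k, |f k| ≤ C) (E) : |M.ga f E| ≤ C := by
  rw [abs_le]
  constructor
  · rw [← M.ga_const (-C) E]; exact M.ga_mono (fun k => (abs_le.1 (h k)).1) E
  · rw [← M.ga_const C E]; exact M.ga_mono (fun k => (abs_le.1 (h k)).2) E

section deriv
variable {E : ℝ → κ → ℝ} {g : κ → ℝ} {y : ℝ}

theorem hasDerivAt_num (hE : ∀ k, HasDerivAt (fun y => E y k) (g k) y) (f : κ → ℝ) :
    HasDerivAt (fun y => ∑ k, M.w k * f k * Real.exp (E y k))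
      (∑ k, M.w k * (f k * g k) * Real.exp (E y k)) y := by
  refine HasDerivAt.fun_sum fun k _ => ?_
  convert! ((hE k).exp.const_mul (M.w k * f k)) using 1
  ring

theorem hasDerivAt_gz (hE : ∀ k, HasDerivAt (fun y => E y k) (g k) y) :
    HasDerivAt (fun y => M.gz (E y)) (M.gz (E y) * M.ga g (E y)) y := by
  have := M.hasDerivAt_num hE (fun _ => 1)
  simp only [mul_one, one_mul] at this
  convert! this using 1
  unfold ga
  rw [mul_div_cancel₀ _ (M.gz_pos _).ne']

theorem hasDerivAt_log_gz (hE : ∀ k, HasDerivAt (fun y => E y k) (g k) y) :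
    HasDerivAt (fun y => Real.log (M.gz (E y))) (M.ga g (E y)) y := by
  convert! (M.hasDerivAt_gz hE).log (M.gz_pos _).ne' using 1
  rw [mul_div_cancel_left₀ _ (M.gz_pos _).ne']

theorem hasDerivAt_ga (hE : ∀ k, HasDerivAt (fun y => E y k) (g k) y) (f : κ → ℝ) :
    HasDerivAt (fun y => M.ga f (E y))
      (M.ga (fun k => f k * g k) (E y) - M.ga f (E y) * M.ga g (E y)) y := by
  have h1 := (M.hasDerivAt_num hE f).div (M.hasDerivAt_gz hE) (M.gz_pos _).ne'
  convert! h1 using 1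
  have := (M.gz_pos (E y)).ne'
  unfold ga
  field_simp
end deriv

variable [Fintype A]

/-- Energy. -/
def e (s z : A → ℝ) (k : κ) : ℝ := ∑ a, (√(s a) * M.x k a * z a - s a * M.x k a ^ 2 / 2)
def Z (s z : A → ℝ) : ℝ := M.gz (M.e s z)
def av (f : κ → ℝ) (s z : A → ℝ) : ℝ := M.ga f (M.e s z)
def ell (s z : A → ℝ) : ℝ := Real.log (M.Z s z)
/-- Planted expectation. -/
def EE (s : A → ℝ) (X : (A → ℝ) → ℝ) : ℝ := ∫ z, M.Z s z * X z ∂(gA A)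

theorem Z_pos (s z : A → ℝ) : 0 < M.Z s z := M.gz_pos _

/-! continuity -/
theorem continuous_e (k : κ) : Continuous (fun p : (A → ℝ) × (A → ℝ) => M.e p.1 p.2 k) := by
  unfold e; fun_prop

theorem continuous_Z2 : Continuous (fun p : (A → ℝ) × (A → ℝ) => M.Z p.1 p.2) := by
  unfold Z gz
  have := M.continuous_e
  fun_prop

theorem continuous_av2 (f : κ → ℝ) : Continuous (fun p : (A → ℝ) × (A → ℝ) => M.av f p.1 p.2) := by
  unfold av ga
  have := M.continuous_e
  refine Continuous.div (by fun_prop) M.continuous_Z2 fun p => (M.Z_pos _ _).ne'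

theorem continuous_ell2 : Continuous (fun p : (A → ℝ) × (A → ℝ) => M.ell p.1 p.2) := by
  unfold ell
  exact M.continuous_Z2.log fun p => (M.Z_pos _ _).ne'

theorem continuous_Z (s : A → ℝ) : Continuous (M.Z s) := by
  have h := M.continuous_Z2
  have h2 : Continuous (fun z : A → ℝ => (s, z)) := by fun_prop
  have h3 := h.comp h2
  simp only [Function.comp_def] at h3
  exact h3
theorem continuous_av (f : κ → ℝ) (s : A → ℝ) : Continuous (M.av f s) := by
  have h := M.continuous_av2 f
  have h2 : Continuous (fun z : A → ℝ => (s, z)) := by fun_prop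
  have h3 := h.comp h2
  simp only [Function.comp_def] at h3
  exact h3
theorem continuous_ell (s : A → ℝ) : Continuous (M.ell s) := by
  have h := M.continuous_ell2
  have h2 : Continuous (fun z : A → ℝ => (s, z)) := by fun_prop
  have h3 := h.comp h2
  simp only [Function.comp_def] at h3
  exact h3

/-! bounds -/
/-- Growth constant on `|s| ≤ R`. -/
def cst (R : ℝ) : ℝ := √R * M.B + Fintype.card A * (R * M.B ^ 2 / 2)

theorem cst_nonneg {R : ℝ} (hR : 0 ≤ R) : 0 ≤ M.cst R := by
  unfold cst; have := M.hB; positivity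

theorem abs_e_le {R : ℝ} {s : A → ℝ} (hs : ∀ a, |s a| ≤ R) (z : A → ℝ) (k : κ) :
    |M.e s z k| ≤ M.cst R * (1 + ∑ a, |z a|) := by
  unfold e
  by_cases hA : Nonempty A
  swap
  · have := not_nonempty_iff.1 hA
    simp only [Finset.univ_eq_empty, Finset.sum_empty, abs_zero, cst, Fintype.card_eq_zero]
    have := M.hB
    simp; positivity
  obtain ⟨a0⟩ := hA
  have hR : 0 ≤ R := (abs_nonneg _).trans (hs a0)
  have hB := M.hB
  refine (Finset.abs_sum_le_sum_abs _ _).trans ?_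
  have h1 : ∀ a ∈ Finset.univ, |√(s a) * M.x k a * z a - s a * M.x k a ^ 2 / 2|
      ≤ √R * M.B * |z a| + R * M.B ^ 2 / 2 := by
    intro a _
    refine (abs_sub _ _).trans (add_le_add ?_ ?_)
    · rw [abs_mul, abs_mul, abs_of_nonneg (Real.sqrt_nonneg _)]
      have : √(s a) ≤ √R := Real.sqrt_le_sqrt ((le_abs_self _).trans (hs a))
      have := M.hx k a
      gcongr
    · rw [abs_div, abs_mul, abs_pow]
      have h2 : |M.x k a| ^ 2 ≤ M.B ^ 2 := pow_le_pow_left₀ (abs_nonneg _) (M.hx k a) 2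
      have := hs a
      rw [abs_of_pos (show (0:ℝ) < 2 by norm_num)]
      gcongr
  refine (Finset.sum_le_sum h1).trans ?_
  rw [Finset.sum_add_distrib, ← Finset.mul_sum]
  simp only [Finset.sum_const, Finset.card_univ, nsmul_eq_mul, cst]
  have hS : 0 ≤ ∑ a, |z a| := Finset.sum_nonneg fun _ _ => abs_nonneg _
  have h3 : 0 ≤ √R * M.B := by positivity
  have h4 : 0 ≤ (Fintype.card A : ℝ) * (R * M.B ^ 2 / 2) := by positivity
  nlinarith [mul_nonneg h4 hS]

theorem Z_le {R : ℝ} {s : A → ℝ} (hs : ∀ a, |s a| ≤ R) (z : A → ℝ) :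
    M.Z s z ≤ Real.exp (M.cst R * (1 + ∑ a, |z a|)) := by
  unfold Z gz
  calc _ ≤ ∑ k, M.w k * Real.exp (M.cst R * (1 + ∑ a, |z a|)) := by
        refine Finset.sum_le_sum fun k _ => mul_le_mul_of_nonneg_left ?_ (M.hw k)
        exact Real.exp_le_exp.2 ((le_abs_self _).trans (M.abs_e_le hs z k))
    _ = _ := by rw [← Finset.sum_mul, M.hw1, one_mul]

theorem le_Z {R : ℝ} {s : A → ℝ} (hs : ∀ a, |s a| ≤ R) (z : A → ℝ) :
    Real.exp (-(M.cst R * (1 + ∑ a, |z a|))) ≤ M.Z s z := by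
  unfold Z gz
  calc _ = ∑ k, M.w k * Real.exp (-(M.cst R * (1 + ∑ a, |z a|))) := by
        rw [← Finset.sum_mul, M.hw1, one_mul]
    _ ≤ _ := by
        refine Finset.sum_le_sum fun k _ => mul_le_mul_of_nonneg_left ?_ (M.hw k)
        exact Real.exp_le_exp.2 ((abs_le.1 (M.abs_e_le hs z k)).1)

theorem abs_ell_le {R : ℝ} {s : A → ℝ} (hs : ∀ a, |s a| ≤ R) (z : A → ℝ) :
    |M.ell s z| ≤ M.cst R * (1 + ∑ a, |z a|) := by
  unfold ell
  rw [abs_le]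
  constructor
  · rw [Real.le_log_iff_exp_le (M.Z_pos _ _)]; exact M.le_Z hs z
  · rw [Real.log_le_iff_le_exp (M.Z_pos _ _)]; exact M.Z_le hs z

theorem abs_av_le {f : κ → ℝ} {C : ℝ} (h : ∀ k, |f k| ≤ C) (s z : A → ℝ) : |M.av f s z| ≤ C :=
  M.abs_ga_le h _

end FinModel

end Part3

section Part4

section Bd
variable {ι A : Type*} [Fintype A]
/-- Uniform exponential growth bound. -/
def Bd (P : Set ι) (F : ι → (A → ℝ) → ℝ) : Prop :=
  ∃ C : ℝ, 0 ≤ C ∧ ∀ p ∈ P, ∀ z, |F p z| ≤ Real.exp (C * (1 + ∑ a, |z a|))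

theorem sg_one_le (z : A → ℝ) : (1:ℝ) ≤ 1 + ∑ a, |z a| := by
  have : 0 ≤ ∑ a, |z a| := Finset.sum_nonneg fun _ _ => abs_nonneg _
  linarith

variable {P : Set ι} {F G : ι → (A → ℝ) → ℝ}

theorem Bd.mono_const {C C' : ℝ} (h : C ≤ C') (z : A → ℝ) :
    Real.exp (C * (1 + ∑ a, |z a|)) ≤ Real.exp (C' * (1 + ∑ a, |z a|)) :=
  Real.exp_le_exp.2 (mul_le_mul_of_nonneg_right h (by linarith [sg_one_le z]))

theorem Bd.add (hF : Bd P F) (hG : Bd P G) : Bd P fun p z => F p z + G p z := by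
  obtain ⟨C, hC, hF⟩ := hF
  obtain ⟨D, hD, hG⟩ := hG
  refine ⟨C + D + 1, by positivity, fun p hp z => ?_⟩
  have h1 := (hF p hp z).trans (Bd.mono_const (show C ≤ C + D by linarith) z)
  have h2 := (hG p hp z).trans (Bd.mono_const (show D ≤ C + D by linarith) z)
  have h3 : (2:ℝ) ≤ Real.exp (1 * (1 + ∑ a, |z a|)) := by
    have := Real.add_one_le_exp (1 * (1 + ∑ a, |z a|)); linarith [sg_one_le z]
  rw [add_mul (C + D), Real.exp_add]
  have h4 := Real.exp_pos ((C + D) * (1 + ∑ a, |z a|))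
  calc _ ≤ |F p z| + |G p z| := abs_add_le _ _
    _ ≤ Real.exp ((C + D) * (1 + ∑ a, |z a|)) * 2 := by linarith
    _ ≤ _ := mul_le_mul_of_nonneg_left h3 h4.le

theorem Bd.mul (hF : Bd P F) (hG : Bd P G) : Bd P fun p z => F p z * G p z := by
  obtain ⟨C, hC, hF⟩ := hF
  obtain ⟨D, hD, hG⟩ := hG
  refine ⟨C + D, by positivity, fun p hp z => ?_⟩
  rw [add_mul, Real.exp_add, abs_mul]
  exact mul_le_mul (hF p hp z) (hG p hp z) (abs_nonneg _) (Real.exp_pos _).le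

theorem Bd.bdd (C : ℝ) (h : ∀ p ∈ P, ∀ z, |F p z| ≤ C) : Bd P F := by
  refine ⟨max C 0, le_max_right _ _, fun p hp z => ?_⟩
  have h1 : max C 0 ≤ max C 0 * (1 + ∑ a, |z a|) := le_mul_of_one_le_right (le_max_right _ _) (sg_one_le z)
  have := Real.add_one_le_exp (max C 0 * (1 + ∑ a, |z a|))
  linarith [h p hp z, le_max_left C 0]

theorem Bd.const (c : ℝ) : Bd P fun (_ : ι) (_ : A → ℝ) => c := Bd.bdd |c| fun _ _ _ => le_rfl

theorem Bd.neg (hF : Bd P F) : Bd P fun p z => - F p z := by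
  obtain ⟨C, hC, hF⟩ := hF
  exact ⟨C, hC, fun p hp z => by rw [abs_neg]; exact hF p hp z⟩

theorem Bd.sub (hF : Bd P F) (hG : Bd P G) : Bd P fun p z => F p z - G p z := by
  simp only [sub_eq_add_neg]; exact hF.add hG.neg

theorem Bd.pow (hF : Bd P F) (n : ℕ) : Bd P fun p z => F p z ^ n := by
  induction n with
  | zero => simpa using Bd.const 1
  | succ n ih => simp only [pow_succ]; exact ih.mul hF

theorem Bd.sum {β : Type*} (T : Finset β) {F : β → ι → (A → ℝ) → ℝ} (h : ∀ b ∈ T, Bd P (F b)) :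
    Bd P fun p z => ∑ b ∈ T, F b p z := by
  classical
  induction T using Finset.induction_on with
  | empty => simpa using Bd.const 0
  | insert b T hb ih =>
    simp only [Finset.sum_insert hb]
    exact (h b (by simp)).add (ih fun b' hb' => h b' (by simp [hb']))

theorem Bd.coord (a : A) : Bd P fun (_ : ι) (z : A → ℝ) => z a := by
  refine ⟨1, by norm_num, fun p _ z => ?_⟩
  have h : |z a| ≤ ∑ b, |z b| :=
    Finset.single_le_sum (f := fun b => |z b|) (fun _ _ => abs_nonneg _) (Finset.mem_univ a)
  linarith [Real.add_one_le_exp (1 * (1 + ∑ b, |z b|))]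

theorem Bd.phi (φ : ℝ → ℝ) (K : ℝ) (hK : 0 ≤ K) (hφ : ∀ y, |φ y| ≤ Real.exp (K * (1 + |y|)))
    (hF : ∃ C : ℝ, 0 ≤ C ∧ ∀ p ∈ P, ∀ z, |F p z| ≤ C * (1 + ∑ a, |z a|)) :
    Bd P fun p z => φ (F p z) := by
  obtain ⟨C, hC, hF⟩ := hF
  refine ⟨K * (1 + C), by positivity, fun p hp z => (hφ _).trans (Real.exp_le_exp.2 ?_)⟩
  rw [mul_assoc]
  refine mul_le_mul_of_nonneg_left ?_ hK
  have := hF p hp z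
  have := sg_one_le z
  linarith

theorem Bd.mono {P' : Set ι} (h : P' ⊆ P) (hF : Bd P F) : Bd P' F := by
  obtain ⟨C, hC, hF⟩ := hF
  exact ⟨C, hC, fun p hp z => hF p (h hp) z⟩

theorem integrable_expsg (C : ℝ) :
    Integrable (fun z : A → ℝ => Real.exp (C * (1 + ∑ a, |z a|))) (gA A) := by
  refine ((integrable_edom (A := A) C).const_mul (Real.exp C)).congr (Eventually.of_forall fun z => ?_)
  simp only [edom]; rw [← Real.exp_add]; ring_nf

theorem Bd.integrable {p : ι} (hF : Bd P F) (hp : p ∈ P) (hc : Continuous (F p)) :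
    Integrable (F p) (gA A) := by
  obtain ⟨C, hC, hF⟩ := hF
  exact (integrable_expsg C).mono' hc.aestronglyMeasurable (Eventually.of_forall (hF p hp))

theorem Bd.edom {p : ι} (hF : Bd P F) (hp : p ∈ P) : ∃ C c, ∀ z, |F p z| ≤ C * edom c z := by
  obtain ⟨C, hC, hF⟩ := hF
  refine ⟨Real.exp C, C, fun z => (hF p hp z).trans (le_of_eq ?_)⟩
  simp only [_root_.edom]; rw [← Real.exp_add]; ring_nf
end Bd

namespace FinModel
variable {κ A : Type*} [Fintype κ] (M : FinModel κ A) [Fintype A]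

section
variable {ι : Type*} {P : Set ι} {S : ι → A → ℝ} {R : ℝ}

theorem Bd_Z (hR : 0 ≤ R) (hS : ∀ p ∈ P, ∀ a, |S p a| ≤ R) : Bd P fun p z => M.Z (S p) z :=
  ⟨M.cst R, M.cst_nonneg hR, fun p hp z => by
    rw [abs_of_pos (M.Z_pos _ _)]; exact M.Z_le (hS p hp) z⟩

theorem Bd_phi_ell (hR : 0 ≤ R) (hS : ∀ p ∈ P, ∀ a, |S p a| ≤ R) (φ : ℝ → ℝ) (K : ℝ) (hK : 0 ≤ K)
    (hφ : ∀ y, |φ y| ≤ Real.exp (K * (1 + |y|))) : Bd P fun p z => φ (M.ell (S p) z) :=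
  Bd.phi φ K hK hφ ⟨M.cst R, M.cst_nonneg hR, fun p hp z => M.abs_ell_le (hS p hp) z⟩

theorem Bd_av (f : κ → ℝ) : Bd P fun p z => M.av f (S p) z :=
  Bd.bdd (∑ k, |f k|) fun p _ z => M.abs_av_le (fun k =>
    Finset.single_le_sum (f := fun k => |f k|) (fun _ _ => abs_nonneg _) (Finset.mem_univ k)) _ _
end

section zderiv
variable [DecidableEq A] (s z : A → ℝ) (a : A) (y : ℝ)

theorem hasDerivAt_e_z (k : κ) :
    HasDerivAt (fun y => M.e s (Function.update z a y) k) (√(s a) * M.x k a) y := by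
  unfold e
  have : ∀ b ∈ Finset.univ, HasDerivAt (fun y => √(s b) * M.x k b * Function.update z a y b - s b * M.x k b ^ 2 / 2)
      (if b = a then √(s a) * M.x k a else 0) y := by
    intro b _
    by_cases h : b = a
    · subst h
      simp only [Function.update_self, if_true]
      have := ((hasDerivAt_id y).const_mul (√(s b) * M.x k b)).sub_const (s b * M.x k b ^ 2 / 2)
      simpa using this
    · simp only [Function.update_of_ne h, if_neg h]; exact hasDerivAt_const _ _
  have := HasDerivAt.fun_sum this
  simpa using this

theorem hasDerivAt_Z_z : HasDerivAt (fun y => M.Z s (Function.update z a y))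
    (√(s a) * (M.Z s (Function.update z a y) * M.av (fun k => M.x k a) s (Function.update z a y))) y := by
  have := M.hasDerivAt_gz (fun k => M.hasDerivAt_e_z s z a y k)
  rw [M.ga_const_mul] at this
  unfold Z av; convert! this using 1; ring

theorem hasDerivAt_ell_z : HasDerivAt (fun y => M.ell s (Function.update z a y))
    (√(s a) * M.av (fun k => M.x k a) s (Function.update z a y)) y := by
  have := M.hasDerivAt_log_gz (fun k => M.hasDerivAt_e_z s z a y k)
  rw [M.ga_const_mul] at this
  exact this

theorem hasDerivAt_av_z (f : κ → ℝ) : HasDerivAt (fun y => M.av f s (Function.update z a y))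
    (√(s a) * (M.av (fun k => f k * M.x k a) s (Function.update z a y)
      - M.av f s (Function.update z a y) * M.av (fun k => M.x k a) s (Function.update z a y))) y := by
  have := M.hasDerivAt_ga (fun k => M.hasDerivAt_e_z s z a y k) f
  have h2 : (fun k => f k * (√(s a) * M.x k a)) = fun k => √(s a) * (f k * M.x k a) := by
    ext; ring
  rw [h2, M.ga_const_mul, M.ga_const_mul] at this
  unfold av; convert! this using 1; ring
end zderiv

section tderiv
variable (s0 d : A → ℝ) (τ : ℝ)

/-- `τ`-derivative of the energy. -/
def eD (z : A → ℝ) (k : κ) : ℝ :=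
  ∑ a, (d a / (2 * √(s0 a + τ * d a)) * M.x k a * z a - d a * M.x k a ^ 2 / 2)

theorem hasDerivAt_e_t (hpos : ∀ a, d a = 0 ∨ 0 < s0 a + τ * d a) (z : A → ℝ) (k : κ) :
    HasDerivAt (fun τ => M.e (fun a => s0 a + τ * d a) z k) (M.eD s0 d τ z k) τ := by
  unfold e eD
  refine HasDerivAt.fun_sum fun a _ => ?_
  have h1 : HasDerivAt (fun τ => s0 a + τ * d a) (d a) τ := by
    simpa using ((hasDerivAt_id τ).mul_const (d a)).const_add (s0 a)
  have h2 : HasDerivAt (fun τ => √(s0 a + τ * d a)) (d a / (2 * √(s0 a + τ * d a))) τ := by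
    rcases hpos a with h | h
    · simp only [h, mul_zero, zero_div, add_zero]; exact hasDerivAt_const _ _
    · exact h1.sqrt h.ne'
  exact ((h2.mul_const (M.x k a)).mul_const (z a)).sub ((h1.mul_const (M.x k a ^ 2)).div_const 2)

theorem av_eD (f : κ → ℝ) (s z : A → ℝ) :
    M.av (fun k => f k * M.eD s0 d τ z k) s z
     = ∑ a, (d a / (2 * √(s0 a + τ * d a)) * z a * M.av (fun k => f k * M.x k a) s z
        - d a / 2 * M.av (fun k => f k * M.x k a * M.x k a) s z) := by
  have h : (fun k => f k * M.eD s0 d τ z k)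
     = fun k => ∑ a, ((fun k => d a / (2 * √(s0 a + τ * d a)) * z a * (f k * M.x k a))
        + (fun k => (-(d a / 2)) * (f k * M.x k a * M.x k a))) k := by
    ext k
    unfold eD
    rw [Finset.mul_sum]
    refine Finset.sum_congr rfl fun a _ => ?_
    simp only [Pi.add_apply]; ring
  unfold av
  rw [h, M.ga_sum]
  refine Finset.sum_congr rfl fun a _ => ?_
  rw [M.ga_add, M.ga_const_mul, M.ga_const_mul]; ring

end tderiv
end FinModel

end Part4

section Part5

namespace FinModel
variable {κ A : Type*} [Fintype κ] (M : FinModel κ A) [Fintype A]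

/-- `⟨x_a⟩` -/
def mx (a : A) (s z : A → ℝ) : ℝ := M.av (fun k => M.x k a) s z
/-- `⟨f x_a⟩ - ⟨f⟩⟨x_a⟩` -/
def cov (f : κ → ℝ) (a : A) (s z : A → ℝ) : ℝ :=
  M.av (fun k => f k * M.x k a) s z - M.av f s z * M.mx a s z

theorem continuous_mx (a : A) (s : A → ℝ) : Continuous (M.mx a s) := M.continuous_av _ s
theorem continuous_cov (f : κ → ℝ) (a : A) (s : A → ℝ) : Continuous (M.cov f a s) := by
  unfold cov
  exact (M.continuous_av _ s).sub ((M.continuous_av _ s).mul (M.continuous_mx a s))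

theorem nhds_good (s0 d : A → ℝ) (τ0 : ℝ) (hpos : ∀ a, d a = 0 ∨ 0 < s0 a + τ0 * d a) :
    ∃ R : ℝ, 0 ≤ R ∧ ∃ P ∈ 𝓝 τ0, ∀ τ ∈ P, ∀ a, (d a = 0 ∨ 0 < s0 a + τ * d a) ∧
      |d a / (2 * √(s0 a + τ * d a))| ≤ R ∧ |s0 a + τ * d a| ≤ R := by
  classical
  set R0 : A → ℝ := fun a => |d a / (2 * √(s0 a + τ0 * d a))| + |s0 a + τ0 * d a| + 1 with hR0
  have hR0' : ∀ a, 0 ≤ R0 a := fun a => by positivity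
  refine ⟨∑ a, R0 a, Finset.sum_nonneg fun a _ => hR0' a,
    {τ | ∀ a, (d a = 0 ∨ 0 < s0 a + τ * d a) ∧
      |d a / (2 * √(s0 a + τ * d a))| ≤ ∑ a, R0 a ∧ |s0 a + τ * d a| ≤ ∑ a, R0 a}, ?_, fun τ h => h⟩
  change ∀ᶠ τ in 𝓝 τ0, ∀ a, _
  rw [eventually_all]
  intro a
  have hle : R0 a ≤ ∑ a, R0 a := Finset.single_le_sum (fun a _ => hR0' a) (Finset.mem_univ a)
  have hc : ContinuousAt (fun τ => s0 a + τ * d a) τ0 := by fun_prop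
  have e1 : ∀ᶠ τ in 𝓝 τ0, (d a = 0 ∨ 0 < s0 a + τ * d a) := by
    rcases hpos a with h | h
    · exact Eventually.of_forall fun _ => Or.inl h
    · exact (hc.eventually (lt_mem_nhds h)).mono fun _ h => Or.inr h
  have e2 : ∀ᶠ τ in 𝓝 τ0, |s0 a + τ * d a| < R0 a :=
    (hc.abs).eventually_lt_const (by
      rw [hR0]; simp only; linarith [abs_nonneg (d a / (2 * √(s0 a + τ0 * d a)))])
  have e3 : ∀ᶠ τ in 𝓝 τ0, |d a / (2 * √(s0 a + τ * d a))| < R0 a := by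
    rcases hpos a with h | h
    · refine Eventually.of_forall fun τ => ?_
      simp only [h, zero_div, abs_zero, mul_zero, add_zero, hR0]
      positivity
    · have hc' : ContinuousAt (fun τ => |d a / (2 * √(s0 a + τ * d a))|) τ0 := by
        refine (ContinuousAt.div continuousAt_const (continuousAt_const.mul hc.sqrt) ?_).abs
        exact (mul_pos two_pos (Real.sqrt_pos.2 h)).ne'
      exact hc'.eventually_lt_const (by
        rw [hR0]; simp only; linarith [abs_nonneg (s0 a + τ0 * d a)])
  filter_upwards [e1, e2, e3] with τ h1 h2 h3
  exact ⟨h1, h3.le.trans hle, h2.le.trans hle⟩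

/-- The key derivative formula. -/
theorem hasDerivAt_EE (s0 d : A → ℝ) (τ0 : ℝ) (hpos : ∀ a, d a = 0 ∨ 0 < s0 a + τ0 * d a)
    (f : κ → ℝ) (φ φ' φ'' : ℝ → ℝ) (hφ : ∀ y, HasDerivAt φ (φ' y) y)
    (hφ' : ∀ y, HasDerivAt φ' (φ'' y) y) (hφ'' : Continuous φ'') (K : ℝ) (hK : 0 ≤ K)
    (b0 : ∀ y, |φ y| ≤ Real.exp (K * (1 + |y|))) (b1 : ∀ y, |φ' y| ≤ Real.exp (K * (1 + |y|)))
    (b2 : ∀ y, |φ'' y| ≤ Real.exp (K * (1 + |y|))) :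
    HasDerivAt (fun τ => M.EE (fun a => s0 a + τ * d a)
        (fun z => φ (M.ell (fun a => s0 a + τ * d a) z) * M.av f (fun a => s0 a + τ * d a) z ^ 2))
      (∑ a, d a * M.EE (fun a => s0 a + τ0 * d a) (fun z =>
        φ (M.ell (fun a => s0 a + τ0 * d a) z) * M.cov f a (fun a => s0 a + τ0 * d a) z ^ 2
        + φ' (M.ell (fun a => s0 a + τ0 * d a) z) *
          (2 * M.av f (fun a => s0 a + τ0 * d a) z * M.mx a (fun a => s0 a + τ0 * d a) z
            * M.cov f a (fun a => s0 a + τ0 * d a) z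
           + M.av f (fun a => s0 a + τ0 * d a) z ^ 2 * M.mx a (fun a => s0 a + τ0 * d a) z ^ 2 / 2)
        + φ'' (M.ell (fun a => s0 a + τ0 * d a) z) *
            (M.av f (fun a => s0 a + τ0 * d a) z ^ 2 * M.mx a (fun a => s0 a + τ0 * d a) z ^ 2 / 2)))
      τ0 := by
  classical
  obtain ⟨R, hR, P, hP, hPg⟩ := nhds_good s0 d τ0 hpos
  set S : ℝ → A → ℝ := fun τ a => s0 a + τ * d a with hS
  set ρ : ℝ → A → ℝ := fun τ a => d a / (2 * √(s0 a + τ * d a)) with hρ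
  have hP0 : τ0 ∈ P := mem_of_mem_nhds hP
  have hSb : ∀ τ ∈ P, ∀ a, |S τ a| ≤ R := fun τ h a => (hPg τ h a).2.2
  -- basic bounds
  have BZ : Bd P fun τ z => M.Z (S τ) z := M.Bd_Z hR hSb
  have Bav : ∀ g : κ → ℝ, Bd P fun τ z => M.av g (S τ) z := fun g => M.Bd_av g
  have B0 : Bd P fun τ z => φ (M.ell (S τ) z) := M.Bd_phi_ell hR hSb φ K hK b0
  have B1 : Bd P fun τ z => φ' (M.ell (S τ) z) := M.Bd_phi_ell hR hSb φ' K hK b1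
  have B2 : Bd P fun τ z => φ'' (M.ell (S τ) z) := M.Bd_phi_ell hR hSb φ'' K hK b2
  have Bρ : ∀ a, Bd P fun τ (_ : A → ℝ) => ρ τ a := fun a => Bd.bdd R fun τ h _ => (hPg τ h a).2.1
  -- continuity
  have cφ : Continuous φ := continuous_iff_continuousAt.2 fun y => (hφ y).continuousAt
  have cφ' : Continuous φ' := continuous_iff_continuousAt.2 fun y => (hφ' y).continuousAt
  have cZ : ∀ τ, Continuous fun z => M.Z (S τ) z := fun τ => M.continuous_Z _
  have cav : ∀ τ g, Continuous fun z => M.av g (S τ) z := fun τ g => M.continuous_av g _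
  have c0 : ∀ τ, Continuous fun z => φ (M.ell (S τ) z) := fun τ => cφ.comp (M.continuous_ell _)
  have c1 : ∀ τ, Continuous fun z => φ' (M.ell (S τ) z) := fun τ => cφ'.comp (M.continuous_ell _)
  have c2 : ∀ τ, Continuous fun z => φ'' (M.ell (S τ) z) := fun τ => hφ''.comp (M.continuous_ell _)
  -- the functions
  set H : ℝ → A → (A → ℝ) → ℝ := fun τ a z => M.Z (S τ) z *
    (φ (M.ell (S τ) z) * (M.av (fun k => M.x k a) (S τ) z * M.av f (S τ) z ^ 2)
     + φ' (M.ell (S τ) z) * (M.av (fun k => M.x k a) (S τ) z * M.av f (S τ) z ^ 2)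
     + φ (M.ell (S τ) z) * (2 * M.av f (S τ) z * (M.av (fun k => f k * M.x k a) (S τ) z
        - M.av f (S τ) z * M.av (fun k => M.x k a) (S τ) z))) with hH
  set Kf : ℝ → A → (A → ℝ) → ℝ := fun τ a z => M.Z (S τ) z *
    (φ (M.ell (S τ) z) * (M.av (fun k => M.x k a * M.x k a) (S τ) z * M.av f (S τ) z ^ 2)
     + φ' (M.ell (S τ) z) * (M.av (fun k => M.x k a * M.x k a) (S τ) z * M.av f (S τ) z ^ 2)
     + φ (M.ell (S τ) z) * (2 * M.av f (S τ) z * (M.av (fun k => f k * M.x k a * M.x k a) (S τ) z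
        - M.av f (S τ) z * M.av (fun k => M.x k a * M.x k a) (S τ) z))) with hKf
  set D : A → (A → ℝ) → ℝ := fun a z => M.Z (S τ0) z *
    (M.av (fun k => M.x k a) (S τ0) z *
      (φ (M.ell (S τ0) z) * (M.av (fun k => M.x k a) (S τ0) z * M.av f (S τ0) z ^ 2)
     + φ' (M.ell (S τ0) z) * (M.av (fun k => M.x k a) (S τ0) z * M.av f (S τ0) z ^ 2)
     + φ (M.ell (S τ0) z) * (2 * M.av f (S τ0) z * (M.av (fun k => f k * M.x k a) (S τ0) z
        - M.av f (S τ0) z * M.av (fun k => M.x k a) (S τ0) z)))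
    + (φ' (M.ell (S τ0) z) * M.av (fun k => M.x k a) (S τ0) z + φ'' (M.ell (S τ0) z) * M.av (fun k => M.x k a) (S τ0) z)
        * (M.av (fun k => M.x k a) (S τ0) z * M.av f (S τ0) z ^ 2)
    + (φ (M.ell (S τ0) z) + φ' (M.ell (S τ0) z)) *
       ((M.av (fun k => M.x k a * M.x k a) (S τ0) z - M.av (fun k => M.x k a) (S τ0) z * M.av (fun k => M.x k a) (S τ0) z) * M.av f (S τ0) z ^ 2
        + M.av (fun k => M.x k a) (S τ0) z * (2 * M.av f (S τ0) z * (M.av (fun k => f k * M.x k a) (S τ0) z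
        - M.av f (S τ0) z * M.av (fun k => M.x k a) (S τ0) z)))
    + φ' (M.ell (S τ0) z) * M.av (fun k => M.x k a) (S τ0) z * (2 * M.av f (S τ0) z * (M.av (fun k => f k * M.x k a) (S τ0) z
        - M.av f (S τ0) z * M.av (fun k => M.x k a) (S τ0) z))
    + φ (M.ell (S τ0) z) * (2 * (M.av (fun k => f k * M.x k a) (S τ0) z
        - M.av f (S τ0) z * M.av (fun k => M.x k a) (S τ0) z) * (M.av (fun k => f k * M.x k a) (S τ0) z
        - M.av f (S τ0) z * M.av (fun k => M.x k a) (S τ0) z)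
       + 2 * M.av f (S τ0) z * ((M.av (fun k => f k * M.x k a * M.x k a) (S τ0) z
          - M.av (fun k => f k * M.x k a) (S τ0) z * M.av (fun k => M.x k a) (S τ0) z)
         - (M.av (fun k => f k * M.x k a) (S τ0) z
        - M.av f (S τ0) z * M.av (fun k => M.x k a) (S τ0) z) * M.av (fun k => M.x k a) (S τ0) z
         - M.av f (S τ0) z * (M.av (fun k => M.x k a * M.x k a) (S τ0) z
            - M.av (fun k => M.x k a) (S τ0) z * M.av (fun k => M.x k a) (S τ0) z)))) with hD
  set G' : ℝ → (A → ℝ) → ℝ := fun τ z => ∑ a, (ρ τ a * (z a * H τ a z) - d a / 2 * Kf τ a z) with hG'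
  have BH : ∀ a, Bd P fun τ z => H τ a z := by
    intro a
    simp only [hH]
    repeat' first | exact BZ | exact B0 | exact B1 | exact Bav _ | exact Bd.const _ | apply Bd.pow | apply Bd.mul | apply Bd.sub | apply Bd.add
  have BK : ∀ a, Bd P fun τ z => Kf τ a z := by
    intro a
    simp only [hKf]
    repeat' first | exact BZ | exact B0 | exact B1 | exact Bav _ | exact Bd.const _ | apply Bd.pow | apply Bd.mul | apply Bd.sub | apply Bd.add
  have cH : ∀ τ a, Continuous (H τ a) := by
    intro τ a
    have h0 : Continuous fun z => M.ell (S τ) z := M.continuous_ell _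
    have h1 := cZ τ; have h2 := cav τ; have h3 := c0 τ; have h4 := c1 τ
    simp only [hH]; fun_prop
  have cK : ∀ τ a, Continuous (Kf τ a) := by
    intro τ a
    have h0 : Continuous fun z => M.ell (S τ) z := M.continuous_ell _
    have h1 := cZ τ; have h2 := cav τ; have h3 := c0 τ; have h4 := c1 τ
    simp only [hKf]; fun_prop
  have cD : ∀ a, Continuous (D a) := by
    intro a
    have h0 : Continuous fun z => M.ell (S τ0) z := M.continuous_ell _
    have h1 := cZ τ0; have h2 := cav τ0; have h3 := c0 τ0; have h4 := c1 τ0; have h5 := c2 τ0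
    simp only [hD]; fun_prop
  have BD : ∀ a, Bd ({τ0} : Set ℝ) fun _ z => D a z := by
    intro a
    have hsub : ({τ0} : Set ℝ) ⊆ P := by simpa using hP0
    have hSb' : ∀ τ ∈ ({τ0} : Set ℝ), ∀ a, |S τ0 a| ≤ R := fun _ _ => hSb τ0 hP0
    have BZ : Bd ({τ0} : Set ℝ) fun _ z => M.Z (S τ0) z := M.Bd_Z hR hSb'
    have Bav : ∀ g : κ → ℝ, Bd ({τ0} : Set ℝ) fun _ z => M.av g (S τ0) z := fun g => M.Bd_av g
    have B0 : Bd ({τ0} : Set ℝ) fun _ z => φ (M.ell (S τ0) z) := M.Bd_phi_ell hR hSb' φ K hK b0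
    have B1 : Bd ({τ0} : Set ℝ) fun _ z => φ' (M.ell (S τ0) z) := M.Bd_phi_ell hR hSb' φ' K hK b1
    have B2 : Bd ({τ0} : Set ℝ) fun _ z => φ'' (M.ell (S τ0) z) := M.Bd_phi_ell hR hSb' φ'' K hK b2
    simp only [hD]
    repeat' first | exact BZ | exact B0 | exact B1 | exact B2 | exact Bav _ | exact Bd.const _ | apply Bd.pow | apply Bd.mul | apply Bd.sub | apply Bd.add
  have BG' : Bd P G' := by
    simp only [hG']
    refine Bd.sum _ fun a _ => ?_
    exact ((Bρ a).mul ((Bd.coord a).mul (BH a))).sub ((Bd.const _).mul (BK a))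
  -- pointwise derivative
  have hder : ∀ τ ∈ P, ∀ z, HasDerivAt (fun τ => M.Z (S τ) z * (φ (M.ell (S τ) z) * M.av f (S τ) z ^ 2)) (G' τ z) τ := by
    intro τ hτ z
    have hp : ∀ a, d a = 0 ∨ 0 < s0 a + τ * d a := fun a => (hPg τ hτ a).1
    have hE := fun k => M.hasDerivAt_e_t s0 d τ hp z k
    have d1 : HasDerivAt (fun τ => M.Z (S τ) z) (M.Z (S τ) z * M.av (M.eD s0 d τ z) (S τ) z) τ := M.hasDerivAt_gz hE
    have d2 : HasDerivAt (fun τ => M.ell (S τ) z) (M.av (M.eD s0 d τ z) (S τ) z) τ := M.hasDerivAt_log_gz hE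
    have d3 : HasDerivAt (fun τ => M.av f (S τ) z) (M.av (fun k => f k * M.eD s0 d τ z k) (S τ) z - M.av f (S τ) z * M.av (M.eD s0 d τ z) (S τ) z) τ := M.hasDerivAt_ga hE f
    have d4 := (hφ (M.ell (S τ) z)).comp τ d2
    have d5 := d1.mul (d4.mul (d3.pow 2))
    have a1 := M.av_eD s0 d τ f (S τ) z
    have a2 := M.av_eD s0 d τ (fun _ => 1) (S τ) z
    simp only [one_mul] at a2
    convert! d5 using 1
    rw [a1]
    have a2' : M.av (M.eD s0 d τ z) (S τ) z = _ := a2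
    rw [a2']
    simp only [hG', hH, hKf, Function.comp_apply, Nat.cast_ofNat, Nat.add_one_sub_one, pow_one, Pi.pow_apply, Pi.mul_apply]
    generalize M.Z (S τ) z = Zv
    generalize M.ell (S τ) z = lv
    generalize M.av f (S τ) z = m
    have : ∀ (α β γ : ℝ) (X Y : A → ℝ), α * ∑ a, X a + β * ∑ a, Y a = ∑ a, (α * X a + β * Y a) := by
      intro α β γ X Y; rw [Finset.mul_sum, Finset.mul_sum, ← Finset.sum_add_distrib]
    set X : A → ℝ := fun a => d a / (2 * √(s0 a + τ * d a)) * z a * M.av (fun k => M.x k a) (S τ) z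
        - d a / 2 * M.av (fun k => M.x k a * M.x k a) (S τ) z with hX
    set Y : A → ℝ := fun a => d a / (2 * √(s0 a + τ * d a)) * z a * M.av (fun k => f k * M.x k a) (S τ) z
        - d a / 2 * M.av (fun k => f k * M.x k a * M.x k a) (S τ) z with hY
    trans (Zv * (φ lv * m ^ 2 + φ' lv * m ^ 2 - φ lv * 2 * m * m)) * ∑ a, X a + (Zv * φ lv * 2 * m) * ∑ a, Y a
    · rw [this _ _ 0]
      refine Finset.sum_congr rfl fun a _ => ?_
      simp only [hX, hY, hρ]; ring
    · ring
  obtain ⟨C, hC, hbC⟩ := BG'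
  have cG : ∀ τ, Continuous fun z => M.Z (S τ) z * (φ (M.ell (S τ) z) * M.av f (S τ) z ^ 2) := by
    intro τ
    have h0 : Continuous fun z => M.ell (S τ) z := M.continuous_ell _
    have h1 := cZ τ; have h2 := cav τ; have h3 := c0 τ
    fun_prop
  have BG : Bd P fun τ z => M.Z (S τ) z * (φ (M.ell (S τ) z) * M.av f (S τ) z ^ 2) :=
    BZ.mul (B0.mul ((Bav f).pow 2))
  have cG' : Continuous (G' τ0) := by
    simp only [hG']
    have := cH τ0; have := cK τ0
    fun_prop
  have main := (hasDerivAt_integral_of_dominated_loc_of_deriv_le (μ := gA A) hP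
    (F := fun τ z => M.Z (S τ) z * (φ (M.ell (S τ) z) * M.av f (S τ) z ^ 2)) (F' := G')
    (Eventually.of_forall fun τ => (cG τ).aestronglyMeasurable)
    (BG.integrable hP0 (cG τ0)) cG'.aestronglyMeasurable
    (Eventually.of_forall fun z τ hτ => hbC τ hτ z) (integrable_expsg C)
    (Eventually.of_forall fun z τ hτ => hder τ hτ z)).2
  -- identify the derivative
  have hval : ∫ z, G' τ0 z ∂(gA A) = ∑ a, d a * M.EE (S τ0) (fun z =>
        φ (M.ell (S τ0) z) * M.cov f a (S τ0) z ^ 2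
        + φ' (M.ell (S τ0) z) *
          (2 * M.av f (S τ0) z * M.mx a (S τ0) z * M.cov f a (S τ0) z
           + M.av f (S τ0) z ^ 2 * M.mx a (S τ0) z ^ 2 / 2)
        + φ'' (M.ell (S τ0) z) * (M.av f (S τ0) z ^ 2 * M.mx a (S τ0) z ^ 2 / 2)) := by
    simp only [hG']
    have iH : ∀ a, Integrable (fun z => z a * H τ0 a z) (gA A) := fun a =>
      ((Bd.coord a).mul (BH a)).integrable hP0 ((continuous_apply a).mul (cH τ0 a))
    have iK : ∀ a, Integrable (fun z => Kf τ0 a z) (gA A) := fun a =>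
      (BK a).integrable hP0 (cK τ0 a)
    have iD : ∀ a, Integrable (fun z => D a z) (gA A) := fun a =>
      (BD a).integrable (p := τ0) rfl (cD a)
    have iHK : ∀ a ∈ Finset.univ, Integrable (fun z => ρ τ0 a * (z a * H τ0 a z) - d a / 2 * Kf τ0 a z) (gA A) :=
      fun a _ => ((iH a).const_mul _).sub ((iK a).const_mul _)
    rw [integral_finsetSum _ iHK]
    refine Finset.sum_congr rfl fun a _ => ?_
    rw [integral_sub ((iH a).const_mul _) ((iK a).const_mul _), integral_const_mul, integral_const_mul]
    have hstein : ∫ z, z a * H τ0 a z ∂(gA A) = ∫ z, √(S τ0 a) * D a z ∂(gA A) := by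
      obtain ⟨C1, e1, hb1⟩ := (BH a).edom hP0
      obtain ⟨C2, e2, hb2⟩ := ((Bd.const (√(S τ0 a))).mul (BD a)).edom (p := τ0) rfl
      have hC1 : 0 ≤ C1 := nonneg_of_mul_nonneg_left ((abs_nonneg _).trans (hb1 0)) (edom_pos _ _)
      have hC2 : 0 ≤ C2 := nonneg_of_mul_nonneg_left ((abs_nonneg _).trans (hb2 0)) (edom_pos _ _)
      have hm : ∀ e e' : ℝ, e ≤ e' → ∀ z : A → ℝ, edom e z ≤ edom e' z := fun e e' h z =>
        Real.exp_le_exp.2 (mul_le_mul_of_nonneg_right h (Finset.sum_nonneg fun _ _ => abs_nonneg _))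
      refine steinA (C := C1 + C2) (c := max e1 e2) a (cH τ0 a) (continuous_const.mul (cD a)) ?_ ?_ ?_
      · intro z y
        have d1 := M.hasDerivAt_Z_z (S τ0) z a y
        have d2 := M.hasDerivAt_ell_z (S τ0) z a y
        have d3 := M.hasDerivAt_av_z (S τ0) z a y f
        have d4 := M.hasDerivAt_av_z (S τ0) z a y (fun k => M.x k a)
        have d5 := M.hasDerivAt_av_z (S τ0) z a y (fun k => f k * M.x k a)
        have p0 := (hφ (M.ell (S τ0) (Function.update z a y))).comp y d2
        have p1 := (hφ' (M.ell (S τ0) (Function.update z a y))).comp y d2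
        have q1 := d4.mul (d3.pow 2)
        have q2 := (d3.const_mul 2).mul (d5.sub (d3.mul d4))
        have q3 := d1.mul (((p0.mul q1).add (p1.mul q1)).add (p0.mul q2))
        convert! q3 using 1
        simp only [hD, Function.comp, Nat.cast_ofNat, Nat.add_one_sub_one, pow_one, Pi.pow_apply, Pi.mul_apply, Pi.add_apply, Pi.sub_apply]
        ring
      · intro z
        refine (hb1 z).trans (mul_le_mul (by linarith) (hm _ _ (le_max_left _ _) z) (edom_pos _ _).le (by positivity))
      · intro z
        refine (hb2 z).trans (mul_le_mul (by linarith) (hm _ _ (le_max_right _ _) z) (edom_pos _ _).le (by positivity))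
    rw [hstein, integral_const_mul, ← mul_assoc]
    have hrs : ρ τ0 a * √(S τ0 a) = d a / 2 := by
      rcases hpos a with h | h
      · simp [hρ, h]
      · have := Real.sqrt_pos.2 h
        simp only [hρ, hS]; rw [div_mul_eq_mul_div, mul_div_mul_right _ _ this.ne']
    rw [hrs, ← integral_const_mul, ← integral_const_mul, ← integral_sub ((iD a).const_mul _) ((iK a).const_mul _)]
    unfold EE
    rw [← integral_const_mul]
    refine integral_congr_ae (Eventually.of_forall fun z => ?_)
    simp only [hD, hKf, cov, mx]
    ring
  rw [hval] at main
  exact main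

end FinModel

end Part5

section Part6

namespace FinModel
variable {κ A : Type*} [Fintype κ] (M : FinModel κ A) [Fintype A]

/-- Admissible observables. -/
def Ok (X : (A → ℝ) → ℝ) : Prop := Continuous X ∧ Bd (Set.univ : Set Unit) fun _ => X

section Ok
variable {X Y : (A → ℝ) → ℝ}
theorem Ok.integrable (h : Ok X) : Integrable X (gA A) := h.2.integrable (Set.mem_univ ()) h.1
theorem Ok.add (h : Ok X) (h' : Ok Y) : Ok fun z => X z + Y z := ⟨h.1.add h'.1, h.2.add h'.2⟩
theorem Ok.sub (h : Ok X) (h' : Ok Y) : Ok fun z => X z - Y z := ⟨h.1.sub h'.1, h.2.sub h'.2⟩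
theorem Ok.mul (h : Ok X) (h' : Ok Y) : Ok fun z => X z * Y z := ⟨h.1.mul h'.1, h.2.mul h'.2⟩
theorem Ok.pow (h : Ok X) (n : ℕ) : Ok fun z => X z ^ n := ⟨h.1.pow n, h.2.pow n⟩
theorem Ok.const (c : ℝ) : Ok fun _ : A → ℝ => c := ⟨continuous_const, Bd.const c⟩
theorem Ok.sum {β : Type*} (T : Finset β) {X : β → (A → ℝ) → ℝ} (h : ∀ b ∈ T, Ok (X b)) :
    Ok fun z => ∑ b ∈ T, X b z :=
  ⟨continuous_finsetSum _ fun b hb => (h b hb).1, Bd.sum T fun b hb => (h b hb).2⟩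
theorem Ok.abs (h : Ok X) : Ok fun z => |X z| := by
  refine ⟨h.1.abs, ?_⟩
  obtain ⟨C, hC, hb⟩ := h.2
  exact ⟨C, hC, fun p hp z => by rw [abs_abs]; exact hb p hp z⟩

theorem abs_le_Rsum (s : A → ℝ) (a : A) : |s a| ≤ ∑ a, |s a| :=
  Finset.single_le_sum (f := fun a => |s a|) (fun _ _ => abs_nonneg _) (Finset.mem_univ a)
theorem Ok_Z (s : A → ℝ) : Ok (M.Z s) :=
  ⟨M.continuous_Z s, M.Bd_Z (R := ∑ a, |s a|) (Finset.sum_nonneg fun _ _ => abs_nonneg _)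
    (S := fun _ => s) fun _ _ => abs_le_Rsum s⟩
theorem Ok_av (f : κ → ℝ) (s : A → ℝ) : Ok (M.av f s) :=
  ⟨M.continuous_av f s, M.Bd_av f (S := fun _ => s)⟩
theorem Ok_mx (a : A) (s : A → ℝ) : Ok (M.mx a s) := M.Ok_av _ s
theorem Ok_cov (f : κ → ℝ) (a : A) (s : A → ℝ) : Ok (M.cov f a s) :=
  (M.Ok_av _ s).sub ((M.Ok_av _ s).mul (M.Ok_mx a s))
theorem Ok_phi (s : A → ℝ) (φ : ℝ → ℝ) (hc : Continuous φ) (K : ℝ) (hK : 0 ≤ K)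
    (hφ : ∀ y, |φ y| ≤ Real.exp (K * (1 + |y|))) : Ok fun z => φ (M.ell s z) :=
  ⟨hc.comp (M.continuous_ell s), M.Bd_phi_ell (R := ∑ a, |s a|) (Finset.sum_nonneg fun _ _ => abs_nonneg _)
    (S := fun _ => s) (fun _ _ => abs_le_Rsum s) φ K hK hφ⟩
theorem abs_le_exp_one (y : ℝ) : |y| ≤ Real.exp (1 * (1 + |y|)) := by
  have := Real.add_one_le_exp (1 * (1 + |y|)); linarith
theorem Ok_ell (s : A → ℝ) : Ok (M.ell s) :=
  M.Ok_phi s (fun y => y) continuous_id 1 (by norm_num) abs_le_exp_one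
theorem Ok_exp (s : A → ℝ) (k : κ) : Ok fun z => Real.exp (M.e s z k) := by
  have hc : Continuous fun z => M.e s z k := by unfold e; fun_prop
  refine ⟨Real.continuous_exp.comp hc,
    Bd.phi (F := fun (_ : Unit) z => M.e s z k) Real.exp 1 (by norm_num) (fun y => ?_)
      ⟨M.cst (∑ a, |s a|), M.cst_nonneg (Finset.sum_nonneg fun _ _ => abs_nonneg _),
        fun _ _ z => M.abs_e_le (abs_le_Rsum s) z k⟩⟩
  rw [abs_of_pos (Real.exp_pos _)]
  exact Real.exp_le_exp.2 (by linarith [le_abs_self y])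
end Ok

/-! EE algebra -/
section EE
variable {X Y : (A → ℝ) → ℝ} (s : A → ℝ)
theorem EE_add (h : Ok X) (h' : Ok Y) : M.EE s (fun z => X z + Y z) = M.EE s X + M.EE s Y := by
  unfold EE
  rw [← integral_add ((M.Ok_Z s).mul h).integrable ((M.Ok_Z s).mul h').integrable]
  simp only [mul_add]
theorem EE_sub (h : Ok X) (h' : Ok Y) : M.EE s (fun z => X z - Y z) = M.EE s X - M.EE s Y := by
  unfold EE
  rw [← integral_sub ((M.Ok_Z s).mul h).integrable ((M.Ok_Z s).mul h').integrable]
  simp only [mul_sub]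
theorem EE_const_mul (c : ℝ) : M.EE s (fun z => c * X z) = c * M.EE s X := by
  unfold EE
  rw [← integral_const_mul]; congr 1; ext z; ring
theorem EE_sum {β : Type*} (T : Finset β) {X : β → (A → ℝ) → ℝ} (h : ∀ b ∈ T, Ok (X b)) :
    M.EE s (fun z => ∑ b ∈ T, X b z) = ∑ b ∈ T, M.EE s (X b) := by
  unfold EE
  rw [← integral_finsetSum _ fun b hb => ((M.Ok_Z s).mul (h b hb)).integrable]
  simp only [Finset.mul_sum]
theorem EE_mono (h : Ok X) (h' : Ok Y) (hXY : ∀ z, X z ≤ Y z) : M.EE s X ≤ M.EE s Y :=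
  integral_mono ((M.Ok_Z s).mul h).integrable ((M.Ok_Z s).mul h').integrable fun z =>
    mul_le_mul_of_nonneg_left (hXY z) (M.Z_pos s z).le
theorem EE_nonneg (hX : ∀ z, 0 ≤ X z) : 0 ≤ M.EE s X :=
  integral_nonneg fun z => mul_nonneg (M.Z_pos s z).le (hX z)
end EE

/-- The planted shift. -/
def sh (s : A → ℝ) (k : κ) : A → ℝ := fun a => √(s a) * M.x k a

theorem e_eq (s : A → ℝ) (hs : ∀ a, 0 ≤ s a) (z : A → ℝ) (k : κ) :
    M.e s z k = ∑ a, (M.sh s k a * z a - M.sh s k a ^ 2 / 2) := by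
  unfold e sh
  refine Finset.sum_congr rfl fun a _ => ?_
  rw [mul_pow, Real.sq_sqrt (hs a)]

theorem planted_gen (s : A → ℝ) (hs : ∀ a, 0 ≤ s a) {X : κ → (A → ℝ) → ℝ} (hX : ∀ k, Ok (X k)) :
    ∑ k, M.w k * ∫ z, X k (z + M.sh s k) ∂(gA A)
      = ∫ z, ∑ k, M.w k * Real.exp (M.e s z k) * X k z ∂(gA A) := by
  have hi : ∀ k ∈ Finset.univ, Integrable (fun z => M.w k * Real.exp (M.e s z k) * X k z) (gA A) := fun k _ =>
    (((Ok.const (M.w k)).mul (M.Ok_exp s k)).mul (hX k)).integrable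
  rw [integral_finsetSum _ hi]
  refine Finset.sum_congr rfl fun k _ => ?_
  rw [integral_shift _ (hX k).1, ← integral_const_mul]
  congr 1; ext z
  rw [M.e_eq s hs]; ring

theorem EE_eq_planted (s : A → ℝ) (hs : ∀ a, 0 ≤ s a) {X : (A → ℝ) → ℝ} (hX : Ok X) :
    M.EE s X = ∑ k, M.w k * ∫ z, X (z + M.sh s k) ∂(gA A) := by
  rw [M.planted_gen s hs fun _ => hX]
  unfold EE Z gz
  congr 1; ext z; rw [Finset.sum_mul]

/-- Nishimori identity. -/
theorem nishimori (s : A → ℝ) (hs : ∀ a, 0 ≤ s a) {X : (A → ℝ) → ℝ} (hX : Ok X) (f : κ → ℝ) :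
    ∑ k, M.w k * ∫ z, f k * X (z + M.sh s k) ∂(gA A) = M.EE s (fun z => M.av f s z * X z) := by
  rw [M.planted_gen s hs (X := fun k z => f k * X z) fun k => (Ok.const (f k)).mul hX]
  unfold EE
  congr 1; ext z
  have h := (M.Z_pos s z).ne'
  unfold av ga
  change _ = M.Z s z * ((∑ k, M.w k * f k * rexp (M.e s z k)) / M.Z s z * X z)
  rw [← mul_assoc, mul_div_cancel₀ _ h, Finset.sum_mul]
  refine Finset.sum_congr rfl fun k _ => by ring

theorem EE_one (s : A → ℝ) (hs : ∀ a, 0 ≤ s a) : M.EE s (fun _ => 1) = 1 := by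
  rw [M.EE_eq_planted s hs (Ok.const 1)]; simp [M.hw1]

theorem EE_const (s : A → ℝ) (hs : ∀ a, 0 ≤ s a) (c : ℝ) : M.EE s (fun _ => c) = c := by
  have := M.EE_const_mul (X := fun _ => 1) s c
  rw [M.EE_one s hs] at this; simpa using this

/-- Free energy. -/
def Fr (s : A → ℝ) : ℝ := M.EE s (M.ell s)
/-- Overlap. -/
def Q (f : κ → ℝ) (s : A → ℝ) : ℝ := M.EE s (fun z => M.av f s z ^ 2)

theorem Q_nonneg (f : κ → ℝ) (s : A → ℝ) : 0 ≤ M.Q f s := M.EE_nonneg s fun _ => sq_nonneg _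

theorem Q_le {f : κ → ℝ} {C : ℝ} (hf : ∀ k, |f k| ≤ C) (s : A → ℝ) (hs : ∀ a, 0 ≤ s a) : M.Q f s ≤ C ^ 2 := by
  rw [← M.EE_const s hs (C ^ 2)]
  refine M.EE_mono s ((M.Ok_av f s).pow 2) (Ok.const _) fun z => ?_
  rw [← sq_abs]; exact pow_le_pow_left₀ (abs_nonneg _) (M.abs_av_le hf s z) 2

theorem continuous_EE_phi (f : κ → ℝ) (φ : ℝ → ℝ) (hc : Continuous φ) (K : ℝ) (hK : 0 ≤ K)
    (hφ : ∀ y, |φ y| ≤ Real.exp (K * (1 + |y|))) :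
    Continuous fun s => M.EE s (fun z => φ (M.ell s z) * M.av f s z ^ 2) := by
  rw [continuous_iff_continuousAt]
  intro s0
  set R : ℝ := ∑ a, |s0 a| + 1 with hR
  have hR0 : 0 ≤ R := by
    have : 0 ≤ ∑ a, |s0 a| := Finset.sum_nonneg fun _ _ => abs_nonneg _
    linarith
  set P : Set (A → ℝ) := {s | ∀ a, |s a| ≤ R}
  have hP : P ∈ 𝓝 s0 := by
    change ∀ᶠ s in 𝓝 s0, ∀ a, |s a| ≤ R
    rw [eventually_all]
    intro a
    have h1 : ContinuousAt (fun s : A → ℝ => |s a|) s0 := ((continuous_apply a).abs).continuousAt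
    have h2 := h1.eventually_lt_const (show |s0 a| < R by linarith [abs_le_Rsum s0 a])
    exact h2.mono fun _ h => h.le
  have hb : Bd P fun s z => M.Z s z * (φ (M.ell s z) * M.av f s z ^ 2) :=
    (M.Bd_Z (S := fun s => s) hR0 fun s hs => hs).mul
      ((M.Bd_phi_ell (S := fun s => s) hR0 (fun s hs => hs) φ K hK hφ).mul ((M.Bd_av f).pow 2))
  obtain ⟨C, hC, hb⟩ := hb
  unfold EE
  refine continuousAt_of_dominated (bound := fun z => Real.exp (C * (1 + ∑ a, |z a|))) ?_ ?_ (integrable_expsg C) ?_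
  · exact Eventually.of_forall fun s => ((M.continuous_Z s).mul ((hc.comp (M.continuous_ell s)).mul ((M.continuous_av f s).pow 2))).aestronglyMeasurable
  · filter_upwards [hP] with s hs
    exact Eventually.of_forall fun z => hb s hs z
  · refine Eventually.of_forall fun z => Continuous.continuousAt ?_
    have h2 : Continuous (fun s : A → ℝ => (s, z)) := by fun_prop
    have c1 := M.continuous_Z2.comp h2
    have c2 := M.continuous_ell2.comp h2
    have c3 := (M.continuous_av2 f).comp h2
    simp only [Function.comp_def] at c1 c2 c3
    exact c1.mul ((hc.comp c2).mul (c3.pow 2))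

theorem continuous_Q (f : κ → ℝ) : Continuous (M.Q f) := by
  have := M.continuous_EE_phi f (fun _ => 1) continuous_const 0 le_rfl (by intro y; simp)
  simp only [one_mul] at this; exact this

theorem av_one (s z : A → ℝ) : M.av (fun _ => 1) s z = 1 := M.ga_one _

theorem continuous_Fr : Continuous M.Fr := by
  have := M.continuous_EE_phi (fun _ => 1) (fun y => y) continuous_id 1 (by norm_num) abs_le_exp_one
  simp only [M.av_one, one_pow, mul_one] at this
  exact this


theorem hasDerivAt_Q (s0 d : A → ℝ) (τ0 : ℝ) (hpos : ∀ a, d a = 0 ∨ 0 < s0 a + τ0 * d a) (f : κ → ℝ) :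
    HasDerivAt (fun τ => M.Q f (fun a => s0 a + τ * d a))
      (∑ a, d a * M.EE (fun a => s0 a + τ0 * d a) (fun z => M.cov f a (fun a => s0 a + τ0 * d a) z ^ 2)) τ0 := by
  have := M.hasDerivAt_EE s0 d τ0 hpos f (fun _ => 1) (fun _ => 0) (fun _ => 0)
    (fun y => hasDerivAt_const _ _) (fun y => hasDerivAt_const _ _) continuous_const 0 le_rfl
    (by intro y; simp) (by intro y; simp) (by intro y; simp)
  simpa [Q] using this

theorem hasDerivAt_Fr (s0 d : A → ℝ) (τ0 : ℝ) (hpos : ∀ a, d a = 0 ∨ 0 < s0 a + τ0 * d a) :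
    HasDerivAt (fun τ => M.Fr (fun a => s0 a + τ * d a))
      (∑ a, d a * (M.Q (fun k => M.x k a) (fun a => s0 a + τ0 * d a) / 2)) τ0 := by
  have := M.hasDerivAt_EE s0 d τ0 hpos (fun _ => 1) (fun y => y) (fun _ => 1) (fun _ => 0)
    (fun y => hasDerivAt_id y) (fun y => hasDerivAt_const _ _) continuous_const 1 (by norm_num)
    abs_le_exp_one (by intro y; simp; positivity) (by intro y; simp; positivity)
  have hcov : ∀ a z, M.cov (fun _ => 1) a (fun a => s0 a + τ0 * d a) z = 0 := by
    intro a z; simp [cov, M.av_one, mx]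
  simp only [M.av_one, one_pow, mul_one, hcov, mul_zero, one_mul, zero_mul, add_zero, zero_add, ne_eq,
    OfNat.ofNat_ne_zero, not_false_eq_true, zero_pow] at this
  convert! this using 3 with a
  rw [Q, div_eq_inv_mul, ← M.EE_const_mul]
  congr 1; ext z; simp only [mx]; ring

end FinModel

end Part6

section Part7

namespace FinModel
variable {κ A : Type*} [Fintype κ] (M : FinModel κ A) [Fintype A]

theorem line_pos {s s' : A → ℝ} (hs : ∀ a, 0 ≤ s a) (hs' : ∀ a, 0 ≤ s' a) {τ : ℝ} (h0 : 0 < τ) (h1 : τ < 1)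
    (a : A) : (s' a - s a) = 0 ∨ 0 < s a + τ * (s' a - s a) := by
  rcases eq_or_ne (s' a - s a) 0 with h | h
  · exact Or.inl h
  right
  have e : s a + τ * (s' a - s a) = (1 - τ) * s a + τ * s' a := by ring
  rw [e]
  have := hs a; have := hs' a
  rcases (hs a).eq_or_lt with h2 | h2
  · have h3 : 0 < s' a := lt_of_le_of_ne (hs' a) fun h4 => h (by rw [← h2, ← h4]; ring)
    have := mul_pos h0 h3
    nlinarith [mul_nonneg (sub_nonneg.2 h1.le) (hs a)]
  · have := mul_pos (sub_pos.2 h1) h2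
    nlinarith [mul_nonneg h0.le (hs' a)]

theorem line_nonneg {s s' : A → ℝ} (hs : ∀ a, 0 ≤ s a) (hs' : ∀ a, 0 ≤ s' a) {τ : ℝ} (h0 : 0 ≤ τ) (h1 : τ ≤ 1)
    (a : A) : 0 ≤ s a + τ * (s' a - s a) := by
  have e : s a + τ * (s' a - s a) = (1 - τ) * s a + τ * s' a := by ring
  rw [e]
  exact add_nonneg (mul_nonneg (sub_nonneg.2 h1) (hs a)) (mul_nonneg h0 (hs' a))

theorem Fr_mvt {s s' : A → ℝ} (hs : ∀ a, 0 ≤ s a) (hs' : ∀ a, 0 ≤ s' a) :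
    ∃ τ ∈ Set.Ioo (0:ℝ) 1, M.Fr s' - M.Fr s =
      ∑ a, (s' a - s a) * (M.Q (fun k => M.x k a) (fun a => s a + τ * (s' a - s a)) / 2) := by
  have hc : Continuous fun τ : ℝ => M.Fr (fun a => s a + τ * (s' a - s a)) :=
    M.continuous_Fr.comp (by fun_prop)
  obtain ⟨c, hc, h⟩ := exists_hasDerivAt_eq_slope (fun τ : ℝ => M.Fr (fun a => s a + τ * (s' a - s a)))
    (fun τ => ∑ a, (s' a - s a) * (M.Q (fun k => M.x k a) (fun a => s a + τ * (s' a - s a)) / 2))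
    (zero_lt_one) hc.continuousOn (fun τ hτ => M.hasDerivAt_Fr s (fun a => s' a - s a) τ
      (fun a => line_pos hs hs' hτ.1 hτ.2 a))
  refine ⟨c, hc, ?_⟩
  rw [h]; simp

theorem cov_psd (s z d : A → ℝ) :
    0 ≤ ∑ a, ∑ b, d a * d b * M.cov (fun k => M.x k a) b s z ^ 2 := by
  set p : κ → ℝ := fun k => M.w k * Real.exp (M.e s z k) / M.Z s z with hp
  have hp0 : ∀ k, 0 ≤ p k := fun k => div_nonneg (mul_nonneg (M.hw k) (Real.exp_pos _).le) (M.Z_pos s z).le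
  have hav : ∀ f, M.av f s z = ∑ k, p k * f k := by
    intro f
    unfold av ga
    rw [Finset.sum_div]
    refine Finset.sum_congr rfl fun k _ => ?_
    rw [hp]; change _ / M.Z s z = _; ring
  have hp1 : ∑ k, p k = 1 := by
    have := hav (fun _ => 1); rw [M.av_one] at this; simpa using this.symm
  set y : κ → A → ℝ := fun k a => M.x k a - M.mx a s z with hy
  have hcov : ∀ a b, M.cov (fun k => M.x k a) b s z = ∑ k, p k * (y k a * y k b) := by
    intro a b
    have e1 : M.av (fun k => M.x k a * M.x k b) s z = ∑ k, p k * (M.x k a * M.x k b) := hav _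
    have e2 : M.mx a s z = ∑ k, p k * M.x k a := hav _
    have e3 : M.mx b s z = ∑ k, p k * M.x k b := hav _
    have : ∑ k, p k * (y k a * y k b) = ∑ k, p k * (M.x k a * M.x k b) - (∑ k, p k * M.x k a) * M.mx b s z
        - (∑ k, p k * M.x k b) * M.mx a s z + (∑ k, p k) * (M.mx a s z * M.mx b s z) := by
      rw [Finset.sum_mul, Finset.sum_mul, Finset.sum_mul, ← Finset.sum_sub_distrib, ← Finset.sum_sub_distrib,
        ← Finset.sum_add_distrib]
      refine Finset.sum_congr rfl fun k _ => ?_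
      rw [hy]; ring
    rw [this, ← e1, ← e2, ← e3, hp1]
    simp only [cov, mx]; ring
  have key : ∑ a, ∑ b, d a * d b * M.cov (fun k => M.x k a) b s z ^ 2
      = ∑ k, ∑ l, p k * p l * (∑ a, d a * (y k a * y l a)) ^ 2 := by
    have h1 : ∀ a b, d a * d b * M.cov (fun k => M.x k a) b s z ^ 2
        = ∑ k, ∑ l, p k * p l * ((d a * (y k a * y l a)) * (d b * (y k b * y l b))) := by
      intro a b
      rw [hcov, sq, Finset.sum_mul_sum, Finset.mul_sum]
      refine Finset.sum_congr rfl fun k _ => ?_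
      rw [Finset.mul_sum]
      refine Finset.sum_congr rfl fun l _ => ?_
      ring
    simp only [h1]
    have h2 : ∀ k l, p k * p l * (∑ a, d a * (y k a * y l a)) ^ 2
        = ∑ a, ∑ b, p k * p l * ((d a * (y k a * y l a)) * (d b * (y k b * y l b))) := by
      intro k l
      rw [sq, Finset.sum_mul_sum, Finset.mul_sum]
      refine Finset.sum_congr rfl fun a _ => ?_
      rw [Finset.mul_sum]
    simp only [h2]
    simp only [← Finset.sum_product']
    refine Finset.sum_nbij' (fun q => (q.2.2.1, q.2.2.2, q.1, q.2.1)) (fun q => (q.2.2.1, q.2.2.2, q.1, q.2.1)) ?_ ?_ ?_ ?_ ?_ <;> simp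
  rw [key]
  exact Finset.sum_nonneg fun k _ => Finset.sum_nonneg fun l _ =>
    mul_nonneg (mul_nonneg (hp0 k) (hp0 l)) (sq_nonneg _)

/-- Tangent inequality (convexity of the free energy in the snr's). -/
theorem Fr_tangent {s s' : A → ℝ} (hs : ∀ a, 0 ≤ s a) (hs' : ∀ a, 0 ≤ s' a) :
    M.Fr s + ∑ a, (s' a - s a) * (M.Q (fun k => M.x k a) s / 2) ≤ M.Fr s' := by
  obtain ⟨c, hc, h⟩ := M.Fr_mvt hs hs'
  set G : ℝ → ℝ := fun τ => ∑ a, (s' a - s a) * (M.Q (fun k => M.x k a) (fun a => s a + τ * (s' a - s a)) / 2) with hG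
  have hGd : ∀ τ, 0 < τ → τ < 1 → HasDerivAt G (∑ a, (s' a - s a) * ((∑ b, (s' b - s b) *
      M.EE (fun a => s a + τ * (s' a - s a)) (fun z => M.cov (fun k => M.x k a) b (fun a => s a + τ * (s' a - s a)) z ^ 2)) / 2)) τ := by
    intro τ h0 h1
    refine HasDerivAt.fun_sum fun a _ => ?_
    exact ((M.hasDerivAt_Q s (fun a => s' a - s a) τ (fun a => line_pos hs hs' h0 h1 a) _).div_const 2).const_mul _
  have hnn : ∀ τ, 0 < τ → τ < 1 → 0 ≤ (∑ a, (s' a - s a) * ((∑ b, (s' b - s b) *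
      M.EE (fun a => s a + τ * (s' a - s a)) (fun z => M.cov (fun k => M.x k a) b (fun a => s a + τ * (s' a - s a)) z ^ 2)) / 2)) := by
    intro τ h0 h1
    set r : A → ℝ := (fun a => s a + τ * (s' a - s a))
    have := M.EE_nonneg r (fun z => M.cov_psd r z (fun a => s' a - s a))
    rw [M.EE_sum r Finset.univ] at this
    · have e : ∀ a, M.EE r (fun z => ∑ b, (s' a - s a) * (s' b - s b) * M.cov (fun k => M.x k a) b r z ^ 2)
          = (s' a - s a) * ∑ b, (s' b - s b) * M.EE r (fun z => M.cov (fun k => M.x k a) b r z ^ 2) := by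
        intro a
        rw [M.EE_sum r Finset.univ, Finset.mul_sum]
        · refine Finset.sum_congr rfl fun b _ => ?_
          rw [M.EE_const_mul]; ring
        · intro b _; exact (Ok.const _).mul ((M.Ok_cov _ _ _).pow 2)
      simp only [e] at this
      have e2 : ∀ a b : ℝ, a * (b / 2) = (a * b) / 2 := fun a b => by ring
      simp only [e2, ← Finset.sum_div]
      linarith
    · intro b _; exact Ok.sum _ fun b _ => (Ok.const _).mul ((M.Ok_cov _ _ _).pow 2)
  have hcont : Continuous G := by
    refine continuous_finsetSum _ fun a _ => continuous_const.mul (Continuous.div_const ?_ 2)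
    exact (M.continuous_Q _).comp (by fun_prop)
  have hmono : MonotoneOn G (Set.Icc 0 1) := by
    refine monotoneOn_of_deriv_nonneg (convex_Icc 0 1) hcont.continuousOn ?_ ?_
    · rw [interior_Icc]
      exact fun τ hτ => (hGd τ hτ.1 hτ.2).differentiableAt.differentiableWithinAt
    · rw [interior_Icc]
      intro τ hτ
      rw [(hGd τ hτ.1 hτ.2).deriv]; exact hnn τ hτ.1 hτ.2
  have := hmono (Set.left_mem_Icc.2 zero_le_one) ⟨hc.1.le, hc.2.le⟩ hc.1.le
  have hG0 : G 0 = ∑ a, (s' a - s a) * (M.Q (fun k => M.x k a) s / 2) := by simp [hG]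
  have hGc : G c = M.Fr s' - M.Fr s := h.symm
  linarith

theorem Q_mono (f : κ → ℝ) {s s' : A → ℝ} (hs : ∀ a, 0 ≤ s a) (hss : ∀ a, s a ≤ s' a) :
    M.Q f s ≤ M.Q f s' := by
  have hs' : ∀ a, 0 ≤ s' a := fun a => (hs a).trans (hss a)
  set G : ℝ → ℝ := fun τ => M.Q f (fun a => s a + τ * (s' a - s a)) with hG
  have hGd := fun τ (h : τ ∈ Set.Ioo (0:ℝ) 1) => M.hasDerivAt_Q s (fun a => s' a - s a) τ (fun a => line_pos hs hs' h.1 h.2 a) f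
  have hcont : Continuous G := (M.continuous_Q _).comp (by fun_prop)
  have hmono : MonotoneOn G (Set.Icc 0 1) := by
    refine monotoneOn_of_deriv_nonneg (convex_Icc 0 1) hcont.continuousOn ?_ ?_
    · rw [interior_Icc]
      exact fun τ hτ => (hGd τ hτ).differentiableAt.differentiableWithinAt
    · rw [interior_Icc]
      intro τ hτ
      rw [(hGd τ hτ).deriv]
      exact Finset.sum_nonneg fun a _ => mul_nonneg (sub_nonneg.2 (hss a)) (M.EE_nonneg _ fun _ => sq_nonneg _)
  have := hmono (Set.left_mem_Icc.2 zero_le_one) (Set.right_mem_Icc.2 zero_le_one) zero_le_one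
  simpa [hG] using this

theorem Fr_mono {s s' : A → ℝ} (hs : ∀ a, 0 ≤ s a) (hss : ∀ a, s a ≤ s' a) : M.Fr s ≤ M.Fr s' := by
  have hs' : ∀ a, 0 ≤ s' a := fun a => (hs a).trans (hss a)
  obtain ⟨c, hc, h⟩ := M.Fr_mvt hs hs'
  have : 0 ≤ M.Fr s' - M.Fr s := by
    rw [h]
    exact Finset.sum_nonneg fun a _ => mul_nonneg (sub_nonneg.2 (hss a)) (div_nonneg (M.Q_nonneg _ _) zero_le_two)
  linarith

theorem Fr_lip {s s' : A → ℝ} (hs : ∀ a, 0 ≤ s a) (hs' : ∀ a, 0 ≤ s' a) {b : A → ℝ} (hb : ∀ k a, |M.x k a| ≤ b a) :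
    |M.Fr s' - M.Fr s| ≤ ∑ a, |s' a - s a| * (b a ^ 2 / 2) := by
  obtain ⟨c, hc, h⟩ := M.Fr_mvt hs hs'
  rw [h]
  refine (Finset.abs_sum_le_sum_abs _ _).trans (Finset.sum_le_sum fun a _ => ?_)
  rw [abs_mul]
  refine mul_le_mul_of_nonneg_left ?_ (abs_nonneg _)
  rw [abs_of_nonneg (div_nonneg (M.Q_nonneg _ _) zero_le_two)]
  have := M.Q_le (f := fun k => M.x k a) (fun k => hb k a) (fun a => s a + c * (s' a - s a))
    (line_nonneg hs hs' hc.1.le hc.2.le)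
  linarith

end FinModel

end Part7

section Part8

/-- Channels of the perturbed model. -/
abbrev Ch (ι : Type*) := (ι × ι) ⊕ (ι ⊕ ι)

/-- snr vector. -/
def snr (ι : Type*) (t h1 h2 : ℝ) : Ch ι → ℝ := Sum.elim (fun _ => t) (Sum.elim (fun _ => h1) (fun _ => h2))

namespace FinModel
variable {κ ι : Type*} [Fintype κ] (M : FinModel κ (Ch ι)) [Fintype ι]

theorem snr_line (t h2 τ : ℝ) : (fun a => snr ι t 0 h2 a + τ * snr ι 0 1 0 a) = snr ι t τ h2 := by
  ext a; rcases a with a | a | a <;> simp [snr]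

theorem snr_pos {t h2 τ : ℝ} (hτ : 0 < τ) (a : Ch ι) : snr ι 0 1 0 a = 0 ∨ 0 < snr ι t 0 h2 a + τ * snr ι 0 1 0 a := by
  rcases a with a | a | a <;> simp [snr, hτ]

theorem snr_nonneg {t h1 h2 : ℝ} (ht : 0 ≤ t) (h1' : 0 ≤ h1) (h2' : 0 ≤ h2) (a : Ch ι) : 0 ≤ snr ι t h1 h2 a := by
  rcases a with a | a | a <;> simp [snr, ht, h1', h2']

/-- u-channel. -/
def uc (i : ι) : Ch ι := Sum.inr (Sum.inl i)
/-- v-channel. -/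
def vc (i : ι) : Ch ι := Sum.inr (Sum.inr i)

theorem sum_uc (g : Ch ι → ℝ) : ∑ a, snr ι 0 1 0 a * g a = ∑ i, g (uc i) := by
  simp [Fintype.sum_sum_type, snr, uc]

/-- Sum of squared u-means. -/
def Nn (s z : Ch ι → ℝ) : ℝ := ∑ i, M.mx (uc i) s z ^ 2
def Ci (i j : ι) (s z : Ch ι → ℝ) : ℝ := M.cov (fun k => M.x k (uc i)) (uc j) s z
def Ss (s z : Ch ι → ℝ) : ℝ := ∑ i, ∑ j, M.Ci i j s z ^ 2
def Pp (s z : Ch ι → ℝ) : ℝ := ∑ i, ∑ j, M.mx (uc i) s z * M.mx (uc j) s z * M.Ci i j s z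

theorem Ok_Nn (s) : Ok (M.Nn s) := Ok.sum _ fun i _ => (M.Ok_mx _ s).pow 2
theorem Ok_Ci (i j s) : Ok (M.Ci i j s) := M.Ok_cov _ _ _
theorem Ok_Ss (s) : Ok (M.Ss s) := Ok.sum _ fun i _ => Ok.sum _ fun j _ => (M.Ok_Ci i j s).pow 2
theorem Ok_Pp (s) : Ok (M.Pp s) := Ok.sum _ fun i _ => Ok.sum _ fun j _ => ((M.Ok_mx _ s).mul (M.Ok_mx _ s)).mul (M.Ok_Ci i j s)

/-- oscillating functional -/
def Hs (a θ : ℝ) (s : Ch ι → ℝ) : ℝ := M.EE s fun z => (a * sin ((M.ell s z - θ) / a)) * M.Nn s z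

section trig
variable {a : ℝ} (ha : 0 < a)
theorem b_sin (θ y : ℝ) (ha : 0 < a) : |a * sin ((y - θ) / a)| ≤ exp ((a + 1 / a) * (1 + |y|)) := by
  have h1 := abs_sin_le_one ((y - θ) / a)
  have h2 := add_one_le_exp ((a + 1 / a) * (1 + |y|))
  have h3 : 0 ≤ 1 / a := by positivity
  rw [abs_mul, abs_of_pos ha]
  nlinarith [abs_nonneg y, mul_nonneg ha.le (abs_nonneg y), mul_nonneg h3 (abs_nonneg y)]
theorem b_cos (θ y : ℝ) (ha : 0 < a) : |cos ((y - θ) / a)| ≤ exp ((a + 1 / a) * (1 + |y|)) := by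
  have h1 := abs_cos_le_one ((y - θ) / a)
  refine h1.trans (one_le_exp ?_); positivity
theorem b_sin' (θ y : ℝ) (ha : 0 < a) : |-(sin ((y - θ) / a) / a)| ≤ exp ((a + 1 / a) * (1 + |y|)) := by
  have h1 := abs_sin_le_one ((y - θ) / a)
  have h2 := add_one_le_exp ((a + 1 / a) * (1 + |y|))
  have h3 : 0 ≤ 1 / a := by positivity
  rw [abs_neg, abs_div, abs_of_pos ha]
  have h4 : |sin ((y - θ) / a)| / a ≤ 1 / a := div_le_div_of_nonneg_right h1 ha.le
  nlinarith [abs_nonneg y, mul_nonneg ha.le (abs_nonneg y), mul_nonneg h3 (abs_nonneg y)]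
theorem Ok_sin (s : Ch ι → ℝ) (θ : ℝ) (ha : 0 < a) : Ok fun z => a * sin ((M.ell s z - θ) / a) :=
  M.Ok_phi s (fun y => a * sin ((y - θ) / a)) (by fun_prop) (a + 1 / a) (by positivity) fun y => b_sin θ y ha
theorem Ok_cos (s : Ch ι → ℝ) (θ : ℝ) (ha : 0 < a) : Ok fun z => cos ((M.ell s z - θ) / a) :=
  M.Ok_phi s (fun y => cos ((y - θ) / a)) (by fun_prop) (a + 1 / a) (by positivity) fun y => b_cos θ y ha
theorem Ok_sin' (s : Ch ι → ℝ) (θ : ℝ) (ha : 0 < a) : Ok fun z => -(sin ((M.ell s z - θ) / a) / a) :=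
  M.Ok_phi s (fun y => -(sin ((y - θ) / a) / a)) (by fun_prop) (a + 1 / a) (by positivity) fun y => b_sin' θ y ha
end trig

/-- The derivative of `Hs`. -/
def HsD (a θ : ℝ) (s : Ch ι → ℝ) : ℝ := M.EE s fun z =>
  (a * sin ((M.ell s z - θ) / a)) * M.Ss s z
    + cos ((M.ell s z - θ) / a) * (2 * M.Pp s z + M.Nn s z ^ 2 / 2)
    + (-(sin ((M.ell s z - θ) / a) / a)) * (M.Nn s z ^ 2 / 2)

theorem Hs_sum {a : ℝ} (ha : 0 < a) (θ : ℝ) (s : Ch ι → ℝ) :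
    M.Hs a θ s = ∑ i, M.EE s fun z => (a * sin ((M.ell s z - θ) / a)) * M.av (fun k => M.x k (uc i)) s z ^ 2 := by
  rw [← M.EE_sum s _ fun i _ => (M.Ok_sin s θ ha).mul ((M.Ok_av _ s).pow 2)]
  unfold Hs
  congr 1; ext z; rw [← Finset.mul_sum]; rfl

theorem hasDerivAt_Hs {a : ℝ} (ha : 0 < a) (θ t h2 : ℝ) {h : ℝ} (hh : 0 < h) :
    HasDerivAt (fun τ => M.Hs a θ (snr ι t τ h2)) (M.HsD a θ (snr ι t h h2)) h := by
  have hd : ∀ i, HasDerivAt _ _ h := fun i : ι => M.hasDerivAt_EE (snr ι t 0 h2) (snr ι 0 1 0) h (snr_pos hh) (fun k => M.x k (uc i))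
    (fun y => a * sin ((y - θ) / a)) (fun y => cos ((y - θ) / a)) (fun y => -(sin ((y - θ) / a) / a))
    (fun y => by
      have := (((hasDerivAt_id y).sub_const θ).div_const a).sin.const_mul a
      convert! this using 1; simp; field_simp)
    (fun y => by
      have := (((hasDerivAt_id y).sub_const θ).div_const a).cos
      convert! this using 1; simp; field_simp)
    (by fun_prop) (a + 1 / a) (by positivity) (fun y => b_sin θ y ha) (fun y => b_cos θ y ha) (fun y => b_sin' θ y ha)
  simp only [snr_line, sum_uc] at hd
  have hsum := HasDerivAt.fun_sum (u := Finset.univ) fun i _ => hd i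
  have e : (fun τ => M.Hs a θ (snr ι t τ h2)) = fun τ => ∑ i, M.EE (snr ι t τ h2) fun z =>
      (a * sin ((M.ell (snr ι t τ h2) z - θ) / a)) * M.av (fun k => M.x k (uc i)) (snr ι t τ h2) z ^ 2 := by
    ext τ; exact M.Hs_sum ha θ _
  rw [e]
  convert! hsum using 1
  set s := snr ι t h h2
  have o1 := M.Ok_sin s θ ha
  have o2 := M.Ok_cos s θ ha
  have o3 := M.Ok_sin' s θ ha
  have ok : ∀ i j, Ok fun z => a * sin ((M.ell s z - θ) / a) * M.cov (fun k => M.x k (uc i)) (uc j) s z ^ 2 +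
            cos ((M.ell s z - θ) / a) *
              (2 * M.av (fun k => M.x k (uc i)) s z * M.mx (uc j) s z * M.cov (fun k => M.x k (uc i)) (uc j) s z +
                M.av (fun k => M.x k (uc i)) s z ^ 2 * M.mx (uc j) s z ^ 2 / 2) +
          -(sin ((M.ell s z - θ) / a) / a) * (M.av (fun k => M.x k (uc i)) s z ^ 2 * M.mx (uc j) s z ^ 2 / 2) := by
    intro i j
    have q1 := M.Ok_av (fun k => M.x k (uc i)) s
    have q2 := M.Ok_mx (uc j) s
    have q3 := M.Ok_cov (fun k => M.x k (uc i)) (uc j) s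
    have q4 : Ok fun z => M.av (fun k => M.x k (uc i)) s z ^ 2 * M.mx (uc j) s z ^ 2 / 2 := by
      simp only [div_eq_mul_inv]; exact ((q1.pow 2).mul (q2.pow 2)).mul (Ok.const _)
    exact ((o1.mul (q3.pow 2)).add (o2.mul (((((Ok.const 2).mul q1).mul q2).mul q3).add q4))).add (o3.mul q4)
  have h1 : ∀ i, ∑ j, M.EE s (fun z => _) = M.EE s fun z => ∑ j, _ := fun i => (M.EE_sum s Finset.univ fun j _ => ok i j).symm
  rw [Finset.sum_congr rfl fun i _ => h1 i, ← M.EE_sum s Finset.univ fun i _ => Ok.sum _ fun j _ => ok i j]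
  unfold HsD
  congr 1; ext z
  simp only [Finset.sum_add_distrib, ← Finset.mul_sum]
  congr 1
  · congr 1
    · congr 1
      · unfold Pp; rw [Finset.mul_sum, Nn, sq, Finset.sum_mul_sum, Finset.sum_div]
        congr 1
        · refine Finset.sum_congr rfl fun i _ => ?_
          rw [Finset.mul_sum]
          refine Finset.sum_congr rfl fun j _ => ?_
          simp only [Ci, mx]; ring
        · refine Finset.sum_congr rfl fun i _ => ?_
          rw [Finset.sum_div]; rfl
  · congr 1
    rw [Nn, sq, Finset.sum_mul_sum, Finset.sum_div]
    refine Finset.sum_congr rfl fun i _ => ?_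
    rw [Finset.sum_div]; rfl

end FinModel

end Part8

section Part9

namespace FinModel
variable {κ ι : Type*} [Fintype κ] (M : FinModel κ (Ch ι)) [Fintype ι]

theorem hasDerivAt_Fr_u (t h2 : ℝ) {h : ℝ} (hh : 0 < h) :
    HasDerivAt (fun τ => M.Fr (snr ι t τ h2)) (M.EE (snr ι t h h2) (M.Nn (snr ι t h h2)) / 2) h := by
  have := M.hasDerivAt_Fr (snr ι t 0 h2) (snr ι 0 1 0) h (snr_pos hh)
  simp only [snr_line, sum_uc] at this
  convert! this using 1
  unfold Nn
  rw [M.EE_sum _ _ fun i _ => (M.Ok_mx _ _).pow 2, Finset.sum_div]; rfl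

theorem hasDerivAt_N (t h2 : ℝ) {h : ℝ} (hh : 0 < h) :
    HasDerivAt (fun τ => M.EE (snr ι t τ h2) (M.Nn (snr ι t τ h2))) (M.EE (snr ι t h h2) (M.Ss (snr ι t h h2))) h := by
  have hd : ∀ i, HasDerivAt _ _ h := fun i : ι => M.hasDerivAt_Q (snr ι t 0 h2) (snr ι 0 1 0) h (snr_pos hh) (fun k => M.x k (uc i))
  simp only [snr_line, sum_uc] at hd
  have hsum := HasDerivAt.fun_sum (u := Finset.univ) fun i _ => hd i
  convert! hsum using 1
  · ext τ
    unfold Nn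
    rw [M.EE_sum _ _ fun i _ => (M.Ok_mx _ _).pow 2]; rfl
  · unfold Ss
    rw [M.EE_sum _ _ fun i _ => Ok.sum _ fun j _ => (M.Ok_Ci i j _).pow 2]
    refine Finset.sum_congr rfl fun i _ => ?_
    rw [M.EE_sum _ _ fun j _ => (M.Ok_Ci i j _).pow 2]; rfl

theorem Hs_expand {a : ℝ} (ha : 0 < a) (θ : ℝ) (s : Ch ι → ℝ) :
    M.Hs a θ s = cos (θ / a) * M.Hs a 0 s - sin (θ / a) * M.Hs a (-(a * (π / 2))) s := by
  unfold Hs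
  rw [← M.EE_const_mul, ← M.EE_const_mul, ← M.EE_sub]
  · congr 1; ext z
    have e1 : (M.ell s z - θ) / a = M.ell s z / a - θ / a := by ring
    have e2 : (M.ell s z - -(a * (π / 2))) / a = M.ell s z / a + π / 2 := by field_simp; ring
    rw [e1, e2, sub_zero, sin_sub, sin_add_pi_div_two]; ring
  · exact (Ok.const _).mul ((M.Ok_sin s _ ha).mul (M.Ok_Nn s))
  · exact (Ok.const _).mul ((M.Ok_sin s _ ha).mul (M.Ok_Nn s))

theorem Hs_expand' {a : ℝ} (ha : 0 < a) (θ : ℝ) (s : Ch ι → ℝ) :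
    a * M.EE s (fun z => cos ((M.ell s z - θ) / a) * M.Nn s z)
      = sin (θ / a) * M.Hs a 0 s + cos (θ / a) * M.Hs a (-(a * (π / 2))) s := by
  unfold Hs
  rw [← M.EE_const_mul, ← M.EE_const_mul, ← M.EE_const_mul, ← M.EE_add]
  · congr 1; ext z
    have e1 : (M.ell s z - θ) / a = M.ell s z / a - θ / a := by ring
    have e2 : (M.ell s z - -(a * (π / 2))) / a = M.ell s z / a + π / 2 := by field_simp; ring
    rw [e1, e2, sub_zero, cos_sub, sin_add_pi_div_two]; ring
  · exact (Ok.const _).mul ((M.Ok_sin s _ ha).mul (M.Ok_Nn s))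
  · exact (Ok.const _).mul ((M.Ok_sin s _ ha).mul (M.Ok_Nn s))

/-- The derivative of `Y`. -/
def YD (a : ℝ) (s : Ch ι → ℝ) : ℝ := M.HsD a (M.Fr s) s -
  M.EE s (M.Nn s) / 2 * M.EE s (fun z => cos ((M.ell s z - M.Fr s) / a) * M.Nn s z)

theorem hasDerivAt_Y {a : ℝ} (ha : 0 < a) (t h2 : ℝ) {h : ℝ} (hh : 0 < h) :
    HasDerivAt (fun τ => M.Hs a (M.Fr (snr ι t τ h2)) (snr ι t τ h2)) (M.YD a (snr ι t h h2)) h := by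
  have e : (fun τ => M.Hs a (M.Fr (snr ι t τ h2)) (snr ι t τ h2)) = fun τ =>
      cos (M.Fr (snr ι t τ h2) / a) * M.Hs a 0 (snr ι t τ h2)
       - sin (M.Fr (snr ι t τ h2) / a) * M.Hs a (-(a * (π / 2))) (snr ι t τ h2) := by
    ext τ; exact M.Hs_expand ha _ _
  rw [e]
  have dc := (M.hasDerivAt_Fr_u t h2 hh).div_const a
  have d0 := M.hasDerivAt_Hs ha 0 t h2 hh
  have d1 := M.hasDerivAt_Hs ha (-(a * (π / 2))) t h2 hh
  have D := (dc.cos.fun_mul d0).fun_sub (dc.sin.fun_mul d1)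
  set s := snr ι t h h2 with hs
  set c := M.Fr s
  -- derivative at frozen θ
  have d2 := M.hasDerivAt_Hs ha c t h2 hh
  have e2 : (fun τ => M.Hs a c (snr ι t τ h2)) = fun τ =>
      cos (c / a) * M.Hs a 0 (snr ι t τ h2) - sin (c / a) * M.Hs a (-(a * (π / 2))) (snr ι t τ h2) := by
    ext τ; exact M.Hs_expand ha _ _
  rw [e2] at d2
  have d3 := (d0.const_mul (cos (c / a))).fun_sub (d1.const_mul (sin (c / a)))
  have eq := d2.unique d3
  convert! D using 1
  unfold YD
  have e3 := M.Hs_expand' ha c s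
  have e4 : M.EE s (fun z => cos ((M.ell s z - c) / a) * M.Nn s z)
     = (sin (c / a) * M.Hs a 0 s + cos (c / a) * M.Hs a (-(a * (π / 2))) s) / a := by
    rw [← e3]; field_simp
  rw [e4]
  change M.HsD a c s - _ = _
  rw [← hs] at eq
  rw [eq]; ring

variable {K : ℝ} (hK : ∀ k i, |M.x k (uc i)| ≤ K)

theorem Nn_nonneg (s z) : 0 ≤ M.Nn s z := Finset.sum_nonneg fun _ _ => sq_nonneg _
theorem Ss_nonneg (s z) : 0 ≤ M.Ss s z := Finset.sum_nonneg fun _ _ => Finset.sum_nonneg fun _ _ => sq_nonneg _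
theorem Nn_le (hK : ∀ k i, |M.x k (uc i)| ≤ K) (s z) : M.Nn s z ≤ Fintype.card ι * K ^ 2 := by
  unfold Nn
  have : ∀ i ∈ Finset.univ, M.mx (uc i) s z ^ 2 ≤ K ^ 2 := fun i _ => by
    rw [← sq_abs]; exact pow_le_pow_left₀ (abs_nonneg _) (M.abs_av_le (fun k => hK k i) s z) 2
  have := Finset.sum_le_card_nsmul Finset.univ _ _ this
  simpa using this

theorem two_Pp_le {θ : ℝ} (hθ : 0 < θ) (s z) : |2 * M.Pp s z| ≤ θ * M.Nn s z ^ 2 + M.Ss s z / θ := by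
  have e : θ * M.Nn s z ^ 2 + M.Ss s z / θ = ∑ i, ∑ j, (θ * (M.mx (uc i) s z ^ 2 * M.mx (uc j) s z ^ 2) + M.Ci i j s z ^ 2 / θ) := by
    simp only [Finset.sum_add_distrib, ← Finset.mul_sum, ← Finset.sum_div]
    congr 1; congr 1
    rw [Nn, sq, Finset.sum_mul]
  rw [e, Pp, Finset.mul_sum]
  refine (Finset.abs_sum_le_sum_abs _ _).trans (Finset.sum_le_sum fun i _ => ?_)
  rw [Finset.mul_sum]
  refine (Finset.abs_sum_le_sum_abs _ _).trans (Finset.sum_le_sum fun j _ => ?_)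
  set p := M.mx (uc i) s z
  set q := M.mx (uc j) s z
  set c := M.Ci i j s z
  have h1 : θ * (p ^ 2 * q ^ 2) + c ^ 2 / θ = ((θ * (p * q)) ^ 2 + c ^ 2) / θ := by field_simp
  rw [h1, le_div_iff₀ hθ]
  rw [← abs_of_pos hθ, ← abs_mul, abs_of_pos hθ, abs_le]
  constructor <;> nlinarith [sq_nonneg (θ * (p * q) + c), sq_nonneg (θ * (p * q) - c)]

/-- Main variance inequality. -/
theorem var_N_le (hK : ∀ k i, |M.x k (uc i)| ≤ K) {a θ : ℝ} (ha : 0 < a) (hθ : 0 < θ) (s : Ch ι → ℝ) (hs : ∀ b, 0 ≤ s b) {W : ℝ}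
    (hW : W = Fintype.card ι * K ^ 2) :
    (M.EE s (fun z => M.Nn s z ^ 2) - M.EE s (M.Nn s) ^ 2) / 2 ≤ M.YD a s + (a + 1 / θ) * M.EE s (M.Ss s)
      + θ * W ^ 2 + W ^ 2 / (4 * a ^ 2) * M.EE s (fun z => (M.ell s z - M.Fr s) ^ 2) + W ^ 2 / (2 * a) := by
  set c := M.Fr s with hc
  set m := M.EE s (M.Nn s) with hm
  have hm0 : 0 ≤ m := M.EE_nonneg s (M.Nn_nonneg s)
  have hmW : m ≤ W := by
    rw [← M.EE_const s hs W, hm]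
    exact M.EE_mono s (M.Ok_Nn s) (Ok.const _) fun z => by rw [hW]; exact M.Nn_le hK s z
  have oN := M.Ok_Nn s
  have oS := M.Ok_Ss s
  have oP := M.Ok_Pp s
  have o1 := M.Ok_sin s c ha
  have o2 := M.Ok_cos s c ha
  have o3 := M.Ok_sin' s c ha
  have oL : Ok fun z => (M.ell s z - c) ^ 2 := ((M.Ok_ell s).sub (Ok.const c)).pow 2
  have oN2 : Ok fun z => M.Nn s z ^ 2 / 2 := by
    simp only [div_eq_mul_inv]; exact (oN.pow 2).mul (Ok.const _)
  have oD : Ok fun z => (a * sin ((M.ell s z - c) / a)) * M.Ss s z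
    + cos ((M.ell s z - c) / a) * (2 * M.Pp s z + M.Nn s z ^ 2 / 2)
    + (-(sin ((M.ell s z - c) / a) / a)) * (M.Nn s z ^ 2 / 2) :=
    ((o1.mul oS).add (o2.mul (((Ok.const 2).mul oP).add oN2))).add (o3.mul oN2)
  have oD2 : Ok fun z => m / 2 * (cos ((M.ell s z - c) / a) * M.Nn s z) := (Ok.const _).mul (o2.mul oN)
  have eY : M.YD a s = M.EE s fun z => ((a * sin ((M.ell s z - c) / a)) * M.Ss s z
    + cos ((M.ell s z - c) / a) * (2 * M.Pp s z + M.Nn s z ^ 2 / 2)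
    + (-(sin ((M.ell s z - c) / a) / a)) * (M.Nn s z ^ 2 / 2)) - m / 2 * (cos ((M.ell s z - c) / a) * M.Nn s z) := by
    rw [M.EE_sub s oD oD2, M.EE_const_mul]; rfl
  have oLow : Ok fun z => (1 / 2 * M.Nn s z ^ 2 - m / 2 * M.Nn s z) - (a + 1 / θ) * M.Ss s z
     - W ^ 2 / (4 * a ^ 2) * (M.ell s z - c) ^ 2 - (θ * W ^ 2 + W ^ 2 / (2 * a)) :=
    (((((Ok.const _).mul (oN.pow 2)).sub ((Ok.const _).mul oN)).sub ((Ok.const _).mul oS)).sub ((Ok.const _).mul oL)).sub (Ok.const _)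
  have key : M.EE s (fun z => (1 / 2 * M.Nn s z ^ 2 - m / 2 * M.Nn s z) - (a + 1 / θ) * M.Ss s z
     - W ^ 2 / (4 * a ^ 2) * (M.ell s z - c) ^ 2 - (θ * W ^ 2 + W ^ 2 / (2 * a))) ≤ M.YD a s := by
    rw [eY]
    refine M.EE_mono s oLow (oD.sub oD2) fun z => ?_
    have hN0 := M.Nn_nonneg s z
    have hNW : M.Nn s z ≤ W := by rw [hW]; exact M.Nn_le hK s z
    have hS0 := M.Ss_nonneg s z
    have hP := M.two_Pp_le hθ s z
    set N := M.Nn s z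
    set Sv := M.Ss s z
    set P := M.Pp s z
    set y := (M.ell s z - c) / a with hy
    have hy2 : (M.ell s z - c) ^ 2 = a ^ 2 * y ^ 2 := by rw [hy]; field_simp
    rw [hy2]
    have b1 : -(a * Sv) ≤ a * sin y * Sv := by
      have := neg_one_le_sin y
      nlinarith [mul_nonneg ha.le hS0]
    have hN2 : N ^ 2 ≤ W ^ 2 := pow_le_pow_left₀ hN0 hNW 2
    have b2 : -(θ * W ^ 2 + Sv / θ) ≤ cos y * (2 * P) := by
      have h1 : |cos y * (2 * P)| ≤ |2 * P| := by
        rw [abs_mul]; exact mul_le_of_le_one_left (abs_nonneg _) (abs_cos_le_one y)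
      have h2 := (abs_le.1 (h1.trans hP)).1
      nlinarith
    have b3 : -(W ^ 2 / (2 * a)) ≤ -(sin y / a) * (N ^ 2 / 2) := by
      have h1 : -(sin y / a) * (N ^ 2 / 2) = -(sin y * N ^ 2) / (2 * a) := by field_simp
      rw [h1, ← neg_div]
      refine div_le_div_of_nonneg_right ?_ (by positivity)
      have := sin_le_one y
      nlinarith [sq_nonneg N]
    have b4 : 1 / 2 * N ^ 2 - m / 2 * N - W ^ 2 / 4 * y ^ 2 ≤ cos y * (N ^ 2 / 2) - m / 2 * (cos y * N) := by
      have h1 := one_sub_sq_div_two_le_cos (x := y)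
      have h2 := cos_le_one y
      have h3 : |N ^ 2 - m * N| ≤ W ^ 2 := by
        rw [abs_le]; constructor <;> nlinarith [mul_nonneg hm0 hN0]
      have h4 : (1 - cos y) * (N ^ 2 - m * N) ≤ (1 - cos y) * W ^ 2 :=
        mul_le_mul_of_nonneg_left ((le_abs_self _).trans h3) (by linarith)
      nlinarith [sq_nonneg W]
    have e1 : (a + 1 / θ) * Sv = a * Sv + Sv / θ := by ring
    have e2 : W ^ 2 / (4 * a ^ 2) * (a ^ 2 * y ^ 2) = W ^ 2 / 4 * y ^ 2 := by field_simp
    rw [e1, e2]; linarith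
  rw [M.EE_sub s ((((((Ok.const _).mul (oN.pow 2)).sub ((Ok.const _).mul oN)).sub ((Ok.const _).mul oS)).sub ((Ok.const _).mul oL))) (Ok.const _),
    M.EE_sub s (((((Ok.const _).mul (oN.pow 2)).sub ((Ok.const _).mul oN)).sub ((Ok.const _).mul oS))) ((Ok.const _).mul oL),
    M.EE_sub s (((Ok.const _).mul (oN.pow 2)).sub ((Ok.const _).mul oN)) ((Ok.const _).mul oS),
    M.EE_sub s ((Ok.const _).mul (oN.pow 2)) ((Ok.const _).mul oN), M.EE_const s hs,
    M.EE_const_mul, M.EE_const_mul, M.EE_const_mul, M.EE_const_mul] at key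
  change _ - m / 2 * m - _ - _ - _ ≤ _ at key
  nlinarith

end FinModel

end Part9

section Part10

namespace FinModel

section
variable {κ A : Type*} [Fintype κ] (M : FinModel κ A) [Fintype A]
theorem exists_prob (s z : A → ℝ) : ∃ p : κ → ℝ, (∀ k, 0 ≤ p k) ∧ ∑ k, p k = 1 ∧ ∀ f, M.av f s z = ∑ k, p k * f k := by
  set p : κ → ℝ := fun k => M.w k * Real.exp (M.e s z k) / M.Z s z with hp
  have hav : ∀ f, M.av f s z = ∑ k, p k * f k := by
    intro f
    unfold av ga
    rw [Finset.sum_div]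
    refine Finset.sum_congr rfl fun k _ => ?_
    rw [hp]; change _ / M.Z s z = _; ring
  refine ⟨p, fun k => div_nonneg (mul_nonneg (M.hw k) (Real.exp_pos _).le) (M.Z_pos s z).le, ?_, hav⟩
  have := hav (fun _ => 1); rw [M.av_one] at this; simpa using this.symm
end

variable {κ ι : Type*} [Fintype κ] (M : FinModel κ (Ch ι)) [Fintype ι]

/-- `Σ ⟨v_j⟩²` -/
def Nv (s z : Ch ι → ℝ) : ℝ := ∑ j, M.mx (vc j) s z ^ 2
def Tt (s z : Ch ι → ℝ) : ℝ := ∑ i, ∑ j, M.av (fun k => M.x k (uc i) * M.x k (vc j)) s z ^ 2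
theorem Ok_Nv (s) : Ok (M.Nv s) := Ok.sum _ fun i _ => (M.Ok_mx _ s).pow 2
theorem Ok_Tt (s) : Ok (M.Tt s) := Ok.sum _ fun i _ => Ok.sum _ fun j _ => (M.Ok_av _ s).pow 2

theorem dec_pt {K : ℝ} (hKv : ∀ k i, |M.x k (vc i)| ≤ K) {W B : ℝ}
    (hW : W = Fintype.card ι * K ^ 2) (hB : 0 < B) (m : ℝ) (s z : Ch ι → ℝ) :
    |M.Tt s z - m * M.Nv s z| ≤ W / 2 * (B + (M.Ss s z + 2 * M.Pp s z + M.Nn s z ^ 2 - 2 * m * M.Nn s z + m ^ 2) / B) := by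
  obtain ⟨p, hp0, hp1, hav⟩ := M.exists_prob s z
  have sq2 : ∀ f, M.av f s z ^ 2 = ∑ k, ∑ l, p k * p l * (f k * f l) := by
    intro f
    rw [hav, sq, Finset.sum_mul_sum]
    exact Finset.sum_congr rfl fun k _ => Finset.sum_congr rfl fun l _ => by ring
  set ru : κ → κ → ℝ := fun k l => ∑ i, M.x k (uc i) * M.x l (uc i) with hru
  set rv : κ → κ → ℝ := fun k l => ∑ i, M.x k (vc i) * M.x l (vc i) with hrv
  have swap1 : ∀ g : ι → κ → κ → ℝ, ∑ i, ∑ k, ∑ l, p k * p l * g i k l = ∑ k, ∑ l, p k * p l * ∑ i, g i k l := by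
    intro g
    rw [Finset.sum_comm]
    refine Finset.sum_congr rfl fun k _ => ?_
    rw [Finset.sum_comm]
    refine Finset.sum_congr rfl fun l _ => ?_
    rw [Finset.mul_sum]
  have eT : M.Tt s z = ∑ k, ∑ l, p k * p l * (ru k l * rv k l) := by
    unfold Tt
    simp only [sq2, swap1]
    refine Finset.sum_congr rfl fun k _ => Finset.sum_congr rfl fun l _ => ?_
    congr 1
    rw [hru, hrv]; simp only
    rw [Finset.sum_mul_sum]
    exact Finset.sum_congr rfl fun i _ => Finset.sum_congr rfl fun j _ => by ring
  have eV : M.Nv s z = ∑ k, ∑ l, p k * p l * rv k l := by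
    unfold Nv mx; simp only [sq2, swap1]; rfl
  have eN : M.Nn s z = ∑ k, ∑ l, p k * p l * ru k l := by
    unfold Nn mx; simp only [sq2, swap1]; rfl
  have eQ : M.Ss s z + 2 * M.Pp s z + M.Nn s z ^ 2 = ∑ k, ∑ l, p k * p l * (ru k l) ^ 2 := by
    have h1 : M.Ss s z + 2 * M.Pp s z + M.Nn s z ^ 2 = ∑ i, ∑ j, M.av (fun k => M.x k (uc i) * M.x k (uc j)) s z ^ 2 := by
      unfold Ss Pp Nn
      rw [sq (∑ i, M.mx (uc i) s z ^ 2), Finset.sum_mul_sum, Finset.mul_sum, ← Finset.sum_add_distrib, ← Finset.sum_add_distrib]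
      refine Finset.sum_congr rfl fun i _ => ?_
      rw [Finset.mul_sum, ← Finset.sum_add_distrib, ← Finset.sum_add_distrib]
      refine Finset.sum_congr rfl fun j _ => ?_
      simp only [Ci, cov, mx]; ring
    rw [h1]
    simp only [sq2, swap1]
    refine Finset.sum_congr rfl fun k _ => Finset.sum_congr rfl fun l _ => ?_
    congr 1
    rw [hru]; simp only
    rw [sq, Finset.sum_mul_sum]
    exact Finset.sum_congr rfl fun i _ => Finset.sum_congr rfl fun j _ => by ring
  have hrvb : ∀ k l, |rv k l| ≤ W := by
    intro k l
    rw [hrv, hW]; simp only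
    refine (Finset.abs_sum_le_sum_abs _ _).trans ?_
    have : ∀ i ∈ Finset.univ, |M.x k (vc i) * M.x l (vc i)| ≤ K ^ 2 := fun i _ => by
      rw [abs_mul, sq]
      exact mul_le_mul (hKv k i) (hKv l i) (abs_nonneg _) ((abs_nonneg _).trans (hKv k i))
    have := Finset.sum_le_card_nsmul Finset.univ _ _ this
    simpa using this
  have eL : M.Tt s z - m * M.Nv s z = ∑ k, ∑ l, p k * p l * ((ru k l - m) * rv k l) := by
    rw [eT, eV, Finset.mul_sum, ← Finset.sum_sub_distrib]
    refine Finset.sum_congr rfl fun k _ => ?_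
    rw [Finset.mul_sum, ← Finset.sum_sub_distrib]
    exact Finset.sum_congr rfl fun l _ => by ring
  have eR : W / 2 * (B + (M.Ss s z + 2 * M.Pp s z + M.Nn s z ^ 2 - 2 * m * M.Nn s z + m ^ 2) / B)
      = ∑ k, ∑ l, p k * p l * (W / 2 * (B + (ru k l - m) ^ 2 / B)) := by
    have h2 : ∀ k l, p k * p l * (W / 2 * (B + (ru k l - m) ^ 2 / B)) = W / 2 * B * (p k * p l)
      + W / 2 / B * (p k * p l * ru k l ^ 2) - W / B * m * (p k * p l * ru k l) + W / 2 / B * m ^ 2 * (p k * p l) := by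
      intro k l; field_simp; ring
    simp only [h2, Finset.sum_add_distrib, Finset.sum_sub_distrib, ← Finset.mul_sum]
    rw [← eN, ← eQ]; simp only [hp1, mul_one]; field_simp; ring
  rw [eL, eR]
  refine (Finset.abs_sum_le_sum_abs _ _).trans (Finset.sum_le_sum fun k _ => ?_)
  refine (Finset.abs_sum_le_sum_abs _ _).trans (Finset.sum_le_sum fun l _ => ?_)
  rw [abs_mul, abs_of_nonneg (mul_nonneg (hp0 k) (hp0 l))]
  refine mul_le_mul_of_nonneg_left ?_ (mul_nonneg (hp0 k) (hp0 l))
  rw [abs_mul]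
  have hW0 : 0 ≤ W := (abs_nonneg _).trans (hrvb k l)
  set r := ru k l - m
  have h1 : |r| ≤ 1 / 2 * (B + r ^ 2 / B) := by
    have : 1 / 2 * (B + r ^ 2 / B) = (B ^ 2 + |r| ^ 2) / (2 * B) := by rw [sq_abs]; field_simp
    rw [this, le_div_iff₀ (by positivity)]
    nlinarith [sq_nonneg (B - |r|)]
  calc |r| * |rv k l| ≤ |r| * W := mul_le_mul_of_nonneg_left (hrvb k l) (abs_nonneg _)
    _ ≤ 1 / 2 * (B + r ^ 2 / B) * W := mul_le_mul_of_nonneg_right h1 hW0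
    _ = _ := by ring

theorem dec_EE {K : ℝ} (hK : ∀ k i, |M.x k (uc i)| ≤ K) (hKv : ∀ k i, |M.x k (vc i)| ≤ K) {W B a θ : ℝ}
    (hW : W = Fintype.card ι * K ^ 2) (hB : 0 < B) (ha : 0 < a) (hθ : 0 < θ) (s : Ch ι → ℝ) (hs : ∀ b, 0 ≤ s b) :
    |M.EE s (M.Tt s) - M.EE s (M.Nn s) * M.EE s (M.Nv s)| ≤ W / 2 * (B + (2 * M.YD a s + (1 + 3 / θ + 2 * a) * M.EE s (M.Ss s)
      + 3 * θ * W ^ 2 + W ^ 2 / (2 * a ^ 2) * M.EE s (fun z => (M.ell s z - M.Fr s) ^ 2) + W ^ 2 / a) / B) := by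
  set m := M.EE s (M.Nn s) with hm
  have hW0 : 0 ≤ W := by rw [hW]; positivity
  have oN := M.Ok_Nn s
  have oS := M.Ok_Ss s
  have oP := M.Ok_Pp s
  have o1 : Ok fun z => M.Tt s z - m * M.Nv s z := (M.Ok_Tt s).sub ((Ok.const m).mul (M.Ok_Nv s))
  have o2 : Ok fun z => W / 2 * B + W / 2 / B * (M.Ss s z + (θ * W ^ 2 + 1 / θ * M.Ss s z) + M.Nn s z ^ 2 - 2 * m * M.Nn s z + m ^ 2) :=
    (Ok.const _).add ((Ok.const _).mul ((((oS.add ((Ok.const _).add ((Ok.const _).mul oS))).add (oN.pow 2)).sub ((Ok.const _).mul oN)).add (Ok.const _)))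
  have hpt : ∀ z, |M.Tt s z - m * M.Nv s z| ≤ W / 2 * B + W / 2 / B * (M.Ss s z + (θ * W ^ 2 + 1 / θ * M.Ss s z) + M.Nn s z ^ 2 - 2 * m * M.Nn s z + m ^ 2) := by
    intro z
    refine (M.dec_pt hKv hW hB m s z).trans ?_
    have hN0 := M.Nn_nonneg s z
    have hNW : M.Nn s z ≤ W := by rw [hW]; exact M.Nn_le hK s z
    have hN2 : M.Nn s z ^ 2 ≤ W ^ 2 := pow_le_pow_left₀ hN0 hNW 2
    have hP := (le_abs_self _).trans (M.two_Pp_le hθ s z)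
    have e : W / 2 * (B + (M.Ss s z + 2 * M.Pp s z + M.Nn s z ^ 2 - 2 * m * M.Nn s z + m ^ 2) / B)
      = W / 2 * B + W / 2 / B * (M.Ss s z + 2 * M.Pp s z + M.Nn s z ^ 2 - 2 * m * M.Nn s z + m ^ 2) := by ring
    rw [e]
    have hc : 0 ≤ W / 2 / B := by positivity
    have : 2 * M.Pp s z ≤ θ * W ^ 2 + 1 / θ * M.Ss s z := by
      have : 1 / θ * M.Ss s z = M.Ss s z / θ := by ring
      nlinarith
    gcongr
  have hE : |M.EE s (fun z => M.Tt s z - m * M.Nv s z)| ≤ M.EE s fun z => W / 2 * B + W / 2 / B * (M.Ss s z + (θ * W ^ 2 + 1 / θ * M.Ss s z) + M.Nn s z ^ 2 - 2 * m * M.Nn s z + m ^ 2) := by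
    rw [abs_le]
    constructor
    · have := M.EE_mono s ((Ok.const (-1)).mul o2) o1 fun z => by have := (abs_le.1 (hpt z)).1; linarith
      rw [M.EE_const_mul] at this; linarith
    · exact M.EE_mono s o1 o2 fun z => (abs_le.1 (hpt z)).2
  rw [M.EE_sub s (M.Ok_Tt s) ((Ok.const m).mul (M.Ok_Nv s)), M.EE_const_mul] at hE
  refine hE.trans ?_
  have a1 : Ok fun z => 1 / θ * M.Ss s z := (Ok.const _).mul oS
  have a2 : Ok fun z => θ * W ^ 2 + 1 / θ * M.Ss s z := (Ok.const _).add a1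
  have a3 := oS.add a2
  have a4 := a3.add (oN.pow 2)
  have a4' : Ok fun z => 2 * m * M.Nn s z := (Ok.const _).mul oN
  have a5 := a4.sub a4'
  have a6 := a5.add (Ok.const (m ^ 2))
  rw [M.EE_add s (Ok.const _) ((Ok.const _).mul a6), M.EE_const s hs, M.EE_const_mul, M.EE_add s a5 (Ok.const _), M.EE_const s hs,
    M.EE_sub s a4 a4', M.EE_const_mul, M.EE_add s a3 (oN.pow 2), M.EE_add s oS a2, M.EE_add s (Ok.const _) a1, M.EE_const s hs, M.EE_const_mul]
  change _ + W / 2 / B * (_ - 2 * m * m + _) ≤ _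
  have hv := M.var_N_le hK ha hθ s hs hW
  have hc : 0 ≤ W / 2 / B := by positivity
  have e : ∀ x, W / 2 * (B + x / B) = W / 2 * B + W / 2 / B * x := fun x => by ring
  rw [e]
  refine add_le_add le_rfl (mul_le_mul_of_nonneg_left ?_ hc)
  have e1 : (1 + 3 / θ + 2 * a) * M.EE s (M.Ss s) = M.EE s (M.Ss s) + 3 * (1 / θ * M.EE s (M.Ss s)) + 2 * a * M.EE s (M.Ss s) := by ring
  have e2 : (a + 1 / θ) * M.EE s (M.Ss s) = a * M.EE s (M.Ss s) + 1 / θ * M.EE s (M.Ss s) := by ring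
  have e3 : W ^ 2 / (2 * a ^ 2) = 2 * (W ^ 2 / (4 * a ^ 2)) := by field_simp; norm_num
  have e4 : W ^ 2 / a = 2 * (W ^ 2 / (2 * a)) := by field_simp
  rw [e1, e3, e4]
  rw [e2] at hv
  linarith

end FinModel

end Part10

section Part11

/-- Explicit error bound. -/
def errc (b C δ α β n : ℝ) : ℝ := b / 2 * (β * δ + 1 / β * (6 * α * b + (1 + 3 / α) * b / n
  + δ * (3 * α * b ^ 2 + b ^ 2 * C / (2 * α ^ 2 * n) + b ^ 2 / (α * n))))

namespace FinModel
variable {κ ι : Type*} [Fintype κ] (M : FinModel κ (Ch ι)) [Fintype ι]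

/-- normalised overlaps -/
def nT (t h1 h2 : ℝ) : ℝ := M.EE (snr ι t h1 h2) (M.Tt (snr ι t h1 h2)) / (Fintype.card ι : ℝ) ^ 2
def nA1 (t h1 h2 : ℝ) : ℝ := M.EE (snr ι t h1 h2) (M.Nn (snr ι t h1 h2)) / (Fintype.card ι : ℝ)
def nA2 (t h1 h2 : ℝ) : ℝ := M.EE (snr ι t h1 h2) (M.Nv (snr ι t h1 h2)) / (Fintype.card ι : ℝ)
def nF (t h1 h2 : ℝ) : ℝ := M.Fr (snr ι t h1 h2) / (Fintype.card ι : ℝ)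
/-- variance of the log partition function -/
def Vr (t h1 h2 : ℝ) : ℝ := M.EE (snr ι t h1 h2) fun z => (M.ell (snr ι t h1 h2) z - M.Fr (snr ι t h1 h2)) ^ 2

theorem EE_Nn (s : Ch ι → ℝ) : M.EE s (M.Nn s) = ∑ i, M.Q (fun k => M.x k (uc i)) s :=
  M.EE_sum s _ fun i _ => (M.Ok_mx _ s).pow 2
theorem EE_Nv (s : Ch ι → ℝ) : M.EE s (M.Nv s) = ∑ i, M.Q (fun k => M.x k (vc i)) s :=
  M.EE_sum s _ fun i _ => (M.Ok_mx _ s).pow 2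
theorem EE_Tt (s : Ch ι → ℝ) : M.EE s (M.Tt s) = ∑ i, ∑ j, M.Q (fun k => M.x k (uc i) * M.x k (vc j)) s := by
  unfold Tt
  rw [M.EE_sum s _ fun i _ => Ok.sum _ fun j _ => (M.Ok_av _ s).pow 2]
  refine Finset.sum_congr rfl fun i _ => ?_
  exact M.EE_sum s _ fun j _ => (M.Ok_av _ s).pow 2

theorem continuous_snr : Continuous fun p : ℝ × ℝ × ℝ => snr ι p.1 p.2.1 p.2.2 := by
  refine continuous_pi fun a => ?_
  rcases a with a | a | a <;> simp only [snr, Sum.elim_inl, Sum.elim_inr] <;> fun_prop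

theorem continuous_nA1 : Continuous fun p : ℝ × ℝ × ℝ => M.nA1 p.1 p.2.1 p.2.2 := by
  unfold nA1; simp only [EE_Nn]
  exact (continuous_finsetSum _ fun i _ => (M.continuous_Q _).comp continuous_snr).div_const _
theorem continuous_nA2 : Continuous fun p : ℝ × ℝ × ℝ => M.nA2 p.1 p.2.1 p.2.2 := by
  unfold nA2; simp only [EE_Nv]
  exact (continuous_finsetSum _ fun i _ => (M.continuous_Q _).comp continuous_snr).div_const _
theorem continuous_nT : Continuous fun p : ℝ × ℝ × ℝ => M.nT p.1 p.2.1 p.2.2 := by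
  unfold nT; simp only [EE_Tt]
  exact (continuous_finsetSum _ fun i _ => continuous_finsetSum _ fun j _ => (M.continuous_Q _).comp continuous_snr).div_const _
theorem continuous_nF : Continuous fun p : ℝ × ℝ × ℝ => M.nF p.1 p.2.1 p.2.2 :=
  (M.continuous_Fr.comp continuous_snr).div_const _

theorem abs_Hs_le {K : ℝ} (hK : ∀ k i, |M.x k (uc i)| ≤ K) {a : ℝ} (ha : 0 < a) (θ : ℝ) (s : Ch ι → ℝ) (hs : ∀ b, 0 ≤ s b) :
    |M.Hs a θ s| ≤ a * (Fintype.card ι * K ^ 2) := by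
  have o1 := (M.Ok_sin s θ ha).mul (M.Ok_Nn s)
  have hpt : ∀ z, |a * sin ((M.ell s z - θ) / a) * M.Nn s z| ≤ a * (Fintype.card ι * K ^ 2) := by
    intro z
    rw [abs_mul, abs_mul, abs_of_pos ha, abs_of_nonneg (M.Nn_nonneg s z), mul_assoc]
    refine mul_le_mul_of_nonneg_left ?_ ha.le
    calc _ ≤ 1 * M.Nn s z := mul_le_mul_of_nonneg_right (abs_sin_le_one _) (M.Nn_nonneg s z)
      _ ≤ _ := by rw [one_mul]; exact M.Nn_le hK s z
  unfold Hs
  rw [abs_le]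
  constructor
  · rw [← M.EE_const s hs (-(a * (Fintype.card ι * K ^ 2)))]
    exact M.EE_mono s (Ok.const _) o1 fun z => (abs_le.1 (hpt z)).1
  · rw [← M.EE_const s hs (a * (Fintype.card ι * K ^ 2))]
    exact M.EE_mono s o1 (Ok.const _) fun z => (abs_le.1 (hpt z)).2

theorem decouple {K : ℝ} (hK : ∀ k i, |M.x k (uc i)| ≤ K) (hKv : ∀ k i, |M.x k (vc i)| ≤ K)
    {n : ℝ} (hn : n = Fintype.card ι) (hn0 : 0 < n) {t h2 h h' C α β : ℝ} (ht : 0 ≤ t) (hh2 : 0 ≤ h2)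
    (hh : 0 < h) (hhh : h ≤ h') (hα : 0 < α) (hβ : 0 < β)
    (hV : ∀ τ ∈ Set.Icc h h', M.Vr t τ h2 ≤ C * n) :
    ∫ τ in h..h', |M.nT t τ h2 - M.nA1 t τ h2 * M.nA2 t τ h2| ≤ errc (K ^ 2) C (h' - h) α β n := by
  set b := K ^ 2 with hb
  have hb0 : 0 ≤ b := by positivity
  set D : ℝ := 3 * α * b ^ 2 + b ^ 2 * C / (2 * α ^ 2 * n) + b ^ 2 / (α * n) with hD
  set Ψ : ℝ → ℝ := fun τ => b / 2 * (β * τ + 1 / β * ((2 * M.Hs (α * n) (M.Fr (snr ι t τ h2)) (snr ι t τ h2) +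
    (1 + 3 / α + 2 * (α * n)) * M.EE (snr ι t τ h2) (M.Nn (snr ι t τ h2))) / n ^ 2 + D * τ)) with hΨ
  set Ψ' : ℝ → ℝ := fun τ => b / 2 * (β * 1 + 1 / β * ((2 * M.YD (α * n) (snr ι t τ h2) +
    (1 + 3 / α + 2 * (α * n)) * M.EE (snr ι t τ h2) (M.Ss (snr ι t τ h2))) / n ^ 2 + D * 1)) with hΨ'
  have ha : 0 < α * n := mul_pos hα hn0
  have hder : ∀ τ, 0 < τ → HasDerivAt Ψ (Ψ' τ) τ := by
    intro τ hτ
    have d1 := M.hasDerivAt_Y ha t h2 hτ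
    have d2 := M.hasDerivAt_N t h2 hτ
    have d3 := hasDerivAt_id τ
    exact ((d3.const_mul β).fun_add (((((d1.const_mul 2).fun_add (d2.const_mul _)).div_const (n ^ 2)).fun_add (d3.const_mul D)).const_mul (1 / β))).const_mul (b / 2)
  have hbd : ∀ τ ∈ Set.Icc h h', |M.nT t τ h2 - M.nA1 t τ h2 * M.nA2 t τ h2| ≤ Ψ' τ := by
    intro τ hτ
    have hτ0 : 0 < τ := hh.trans_le hτ.1
    have := M.dec_EE hK hKv (B := β * n) (a := α * n) (θ := α) (W := n * b) (by rw [hn]) (by positivity) ha hα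
      (snr ι t τ h2) (snr_nonneg ht hτ0.le hh2)
    have hv := hV τ hτ
    unfold Vr at hv
    set s := snr ι t τ h2
    set V := M.EE s fun z => (M.ell s z - M.Fr s) ^ 2
    have e0 : M.nT t τ h2 - M.nA1 t τ h2 * M.nA2 t τ h2 = (M.EE s (M.Tt s) - M.EE s (M.Nn s) * M.EE s (M.Nv s)) / n ^ 2 := by
      unfold nT nA1 nA2; rw [← hn]; field_simp; rfl
    rw [e0, abs_div, abs_of_pos (show (0:ℝ) < n ^ 2 by positivity), div_le_iff₀ (by positivity)]
    refine this.trans ?_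
    have e1 : (n * b) ^ 2 / (2 * (α * n) ^ 2) * V ≤ b ^ 2 / (2 * α ^ 2) * (C * n) := by
      have : (n * b) ^ 2 / (2 * (α * n) ^ 2) = b ^ 2 / (2 * α ^ 2) := by field_simp
      rw [this]; exact mul_le_mul_of_nonneg_left hv (by positivity)
    have e2 : Ψ' τ * n ^ 2 = n * b / 2 * (β * n + (2 * M.YD (α * n) s + (1 + 3 / α + 2 * (α * n)) * M.EE s (M.Ss s) +
      3 * α * (n * b) ^ 2 + b ^ 2 / (2 * α ^ 2) * (C * n) + (n * b) ^ 2 / (α * n)) / (β * n)) := by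
      rw [hΨ', hD]; simp only; field_simp; ring
    rw [e2]
    gcongr
  have hcont : Continuous fun τ => |M.nT t τ h2 - M.nA1 t τ h2 * M.nA2 t τ h2| := by
    have hc : Continuous fun τ : ℝ => (t, τ, h2) := by fun_prop
    exact ((M.continuous_nT.comp hc).sub ((M.continuous_nA1.comp hc).mul (M.continuous_nA2.comp hc))).abs
  have hintg : ∫ τ in h..h', |M.nT t τ h2 - M.nA1 t τ h2 * M.nA2 t τ h2| ≤ Ψ h' - Ψ h := by
    refine intervalIntegral.integral_le_sub_of_hasDeriv_right_of_le (g' := Ψ') hhh ?_ ?_ ?_ ?_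
    · exact fun τ hτ => (hder τ (hh.trans_le hτ.1)).continuousAt.continuousWithinAt
    · exact fun τ hτ => (hder τ (hh.trans hτ.1)).hasDerivWithinAt
    · exact hcont.integrableOn_Icc
    · exact fun τ hτ => hbd τ ⟨hτ.1.le, hτ.2.le⟩
  refine hintg.trans ?_
  have y1 := abs_le.1 (M.abs_Hs_le hK ha (M.Fr (snr ι t h h2)) (snr ι t h h2) (snr_nonneg ht hh.le hh2))
  have y2 := abs_le.1 (M.abs_Hs_le hK ha (M.Fr (snr ι t h' h2)) (snr ι t h' h2) (snr_nonneg ht (hh.le.trans hhh) hh2))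
  have n1 : 0 ≤ M.EE (snr ι t h h2) (M.Nn (snr ι t h h2)) := M.EE_nonneg _ (M.Nn_nonneg _)
  have n2 : M.EE (snr ι t h' h2) (M.Nn (snr ι t h' h2)) ≤ n * b := by
    rw [← M.EE_const _ (snr_nonneg ht (hh.le.trans hhh) hh2) (n * b)]
    exact M.EE_mono _ (M.Ok_Nn _) (Ok.const _) fun z => by rw [hn]; exact M.Nn_le hK _ z
  rw [← hn, ← hb] at y1 y2
  set p1 := M.Hs (α * n) (M.Fr (snr ι t h h2)) (snr ι t h h2) with hp1
  set p2 := M.Hs (α * n) (M.Fr (snr ι t h' h2)) (snr ι t h' h2) with hp2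
  set r1 := M.EE (snr ι t h h2) (M.Nn (snr ι t h h2)) with hr1
  set r2 := M.EE (snr ι t h' h2) (M.Nn (snr ι t h' h2)) with hr2
  have e3 : Ψ h' - Ψ h = b / 2 * (β * (h' - h) + 1 / β * ((2 * (p2 - p1) + (1 + 3 / α + 2 * (α * n)) * (r2 - r1)) / n ^ 2 + (h' - h) * D)) := by
    rw [hΨ]; simp only [← hp1, ← hp2, ← hr1, ← hr2]; ring
  rw [e3]
  unfold errc
  have e4 : (2 * (p2 - p1) + (1 + 3 / α + 2 * (α * n)) * (r2 - r1)) / n ^ 2 ≤ 6 * α * b + (1 + 3 / α) * b / n := by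
    have : 6 * α * b + (1 + 3 / α) * b / n = (6 * α * b * n ^ 2 + (1 + 3 / α) * (n * b)) / n ^ 2 := by field_simp
    rw [this]
    refine div_le_div_of_nonneg_right ?_ (by positivity)
    have hc : (1 + 3 / α + 2 * (α * n)) * (r2 - r1) ≤ (1 + 3 / α + 2 * (α * n)) * (n * b) :=
      mul_le_mul_of_nonneg_left (by linarith) (by positivity)
    nlinarith [y1.1, y2.2]
  gcongr

end FinModel

end Part11

section Part12

/-! Finite support integrals -/
theorem integrable_fin {X : Type*} [MeasurableSpace X] [MeasurableSingletonClass X] (μ : Measure X) [IsProbabilityMeasure μ]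
    (T : Finset X) (hT : μ ((↑T : Set X)ᶜ) = 0) (f : X → ℝ) : Integrable f μ := by
  have hr : μ.restrict (↑T : Set X) = μ := Measure.restrict_eq_self_of_ae_mem (by
    rw [ae_iff]; exact hT)
  have : IntegrableOn f (↑T : Set X) μ := by
    refine IntegrableOn.finset
  rw [IntegrableOn, hr] at this; exact this

theorem integral_fin {X : Type*} [MeasurableSpace X] [MeasurableSingletonClass X] (μ : Measure X) [IsProbabilityMeasure μ]
    (T : Finset X) (hT : μ ((↑T : Set X)ᶜ) = 0) (f : X → ℝ) : ∫ x, f x ∂μ = ∑ x ∈ T, μ.real {x} * f x := by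
  have hr : μ.restrict (↑T : Set X) = μ := Measure.restrict_eq_self_of_ae_mem (by
    rw [ae_iff]; exact hT)
  have h := setIntegral_finset (μ := μ) (f := f) T (integrable_fin μ T hT f).integrableOn
  rw [hr] at h; simpa using h

theorem integral_fin' (μ : Measure ℝ) [IsProbabilityMeasure μ]
    (S : Finset ℝ) (hT : μ ((↑S : Set ℝ)ᶜ) = 0) (f : ℝ → ℝ) : ∫ x, f x ∂μ = ∑ x : ↥S, μ.real {(x:ℝ)} * f x := by
  rw [integral_fin μ S hT, ← Finset.sum_coe_sort S (fun x => μ.real {x} * f x)]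

section pi
variable {ι : Type*} [Fintype ι] [DecidableEq ι] (P : ι → Measure ℝ) [∀ i, IsProbabilityMeasure (P i)]
    (S : Finset ℝ) (hP : ∀ i, P i ((↑S : Set ℝ)ᶜ) = 0)

theorem pi_null (hP : ∀ i, P i ((↑S : Set ℝ)ᶜ) = 0) :
    Measure.pi P ((↑(Fintype.piFinset fun _ : ι => S) : Set (ι → ℝ))ᶜ) = 0 := by
  rw [prob_compl_eq_zero_iff (Finset.measurableSet _), Fintype.coe_piFinset, Measure.pi_pi]
  refine Finset.prod_eq_one fun i _ => ?_
  exact (prob_compl_eq_zero_iff S.measurableSet).1 (hP i)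

theorem integral_pi_fin (hP : ∀ i, P i ((↑S : Set ℝ)ᶜ) = 0) (f : (ι → ℝ) → ℝ) :
    ∫ u, f u ∂(Measure.pi P) = ∑ u : ι → ↥S, (∏ i, (P i).real {(u i : ℝ)}) * f (fun i => u i) := by
  rw [integral_fin (Measure.pi P) _ (pi_null P S hP)]
  have e : Fintype.piFinset (fun _ : ι => S) = (Finset.univ : Finset (ι → ↥S)).image (fun u i => (u i : ℝ)) := by
    ext u
    simp only [Fintype.mem_piFinset, Finset.mem_image, Finset.mem_univ, true_and]
    constructor
    · intro h; exact ⟨fun i => ⟨u i, h i⟩, rfl⟩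
    · rintro ⟨v, rfl⟩ i; exact (v i).2
  rw [e, Finset.sum_image]
  · refine Finset.sum_congr rfl fun u _ => ?_
    congr 1
    rw [measureReal_def, Measure.pi_singleton, ENNReal.toReal_prod]; rfl
  · intro u _ v _ h
    ext i; exact congrFun h i

theorem integrable_pi_fin (hP : ∀ i, P i ((↑S : Set ℝ)ᶜ) = 0) (f : (ι → ℝ) → ℝ) : Integrable f (Measure.pi P) :=
  integrable_fin _ _ (pi_null P S hP) f
end pi

namespace FinModel
section lip
variable {κ A : Type*} [Fintype κ] (M : FinModel κ A) [Fintype A]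

theorem log_gz_lip {E E' : κ → ℝ} {D : ℝ} (h : ∀ k, |E k - E' k| ≤ D) : |log (M.gz E) - log (M.gz E')| ≤ D := by
  have key : ∀ E E' : κ → ℝ, (∀ k, |E k - E' k| ≤ D) → log (M.gz E) - log (M.gz E') ≤ D := by
    intro E E' h
    have : M.gz E ≤ exp D * M.gz E' := by
      unfold gz; rw [Finset.mul_sum]
      refine Finset.sum_le_sum fun k _ => ?_
      have : exp (E k) ≤ exp D * exp (E' k) := by
        rw [← exp_add]; exact exp_le_exp.2 (by have := (abs_le.1 (h k)).2; linarith)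
      calc _ ≤ M.w k * (exp D * exp (E' k)) := mul_le_mul_of_nonneg_left this (M.hw k)
        _ = _ := by ring
    have h2 := Real.log_le_log (M.gz_pos E) this
    rw [Real.log_mul (exp_pos _).ne' (M.gz_pos E').ne', log_exp] at h2
    linarith
  rw [abs_le]
  constructor
  · have := key E' E fun k => by rw [abs_sub_comm]; exact h k
    linarith
  · exact key E E' h

theorem ell_lip (s : A → ℝ) {b : A → ℝ} (hb : ∀ k a, |M.x k a| ≤ b a) (z z' : A → ℝ) :
    |M.ell s z - M.ell s z'| ≤ ∑ a, √(s a) * b a * |z a - z' a| := by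
  refine M.log_gz_lip fun k => ?_
  unfold e
  rw [← Finset.sum_sub_distrib]
  refine (Finset.abs_sum_le_sum_abs _ _).trans (Finset.sum_le_sum fun a _ => ?_)
  have : √(s a) * M.x k a * z a - s a * M.x k a ^ 2 / 2 - (√(s a) * M.x k a * z' a - s a * M.x k a ^ 2 / 2)
    = √(s a) * M.x k a * (z a - z' a) := by ring
  rw [this, abs_mul, abs_mul, abs_of_nonneg (sqrt_nonneg _)]
  gcongr; exact hb k a
end lip
end FinModel

/-- signal in all channels -/
def xx {ι : Type*} (U V : ι → ℝ) : Ch ι → ℝ := Sum.elim (fun p => U p.1 * V p.2) (Sum.elim U V)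

theorem xx_bd {ι : Type*} {U V : ι → ℝ} {K : ℝ} (hK : 1 ≤ K) (hU : ∀ i, |U i| ≤ K) (hV : ∀ i, |V i| ≤ K) (a : Ch ι) :
    |xx U V a| ≤ (Sum.elim (fun _ => K ^ 2) (fun _ => K) : Ch ι → ℝ) a := by
  rcases a with a | a | a
  · simp only [xx, Sum.elim_inl, abs_mul, sq]; exact mul_le_mul (hU _) (hV _) (abs_nonneg _) (by linarith)
  · exact hU a
  · exact hV a

section model
variable (n : ℕ) (K : ℝ) (S : Finset ℝ) (PU PV : Measure ℝ) [IsProbabilityMeasure PU] [IsProbabilityMeasure PV]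

/-- Standing assumptions. -/
structure Std (K : ℝ) (S : Finset ℝ) (PU PV : Measure ℝ) [IsProbabilityMeasure PU] [IsProbabilityMeasure PV] : Prop where
  hK : 1 ≤ K
  hS : ∀ x ∈ S, |x| ≤ K
  hU : PU ((↑S : Set ℝ)ᶜ) = 0
  hV : PV ((↑S : Set ℝ)ᶜ) = 0

variable {K S PU PV}

theorem sum_w {P : Measure ℝ} [IsProbabilityMeasure P] (hP : P ((↑S : Set ℝ)ᶜ) = 0) :
    ∑ u : Fin n → ↥S, ∏ i, P.real {(u i : ℝ)} = 1 := by
  have := integral_pi_fin (fun _ : Fin n => P) S (fun _ => hP) (fun _ => 1)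
  simpa using this.symm

/-- The model of size `n`. -/
def mdl (h : Std K S PU PV) : FinModel ((Fin n → ↥S) × (Fin n → ↥S)) (Ch (Fin n)) where
  w k := (∏ i, PU.real {(k.1 i : ℝ)}) * ∏ i, PV.real {(k.2 i : ℝ)}
  x k := xx (fun i => k.1 i) (fun i => k.2 i)
  B := K ^ 2
  hw k := mul_nonneg (Finset.prod_nonneg fun _ _ => measureReal_nonneg) (Finset.prod_nonneg fun _ _ => measureReal_nonneg)
  hw1 := by
    rw [Fintype.sum_prod_type]
    simp only [← Finset.mul_sum, sum_w n h.hV, mul_one, sum_w n h.hU]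
  hB := by positivity
  hx k a := by
    have := xx_bd h.hK (fun i => h.hS _ (k.1 i).2) (fun i => h.hS _ (k.2 i).2) a
    refine this.trans ?_
    have := h.hK
    rcases a with a | a | a
    · simp
    · simp; nlinarith
    · simp; nlinarith

theorem sum_mdl (h : Std K S PU PV) (f : (Fin n → ℝ) → (Fin n → ℝ) → ℝ) :
    ∑ k, (mdl n h).w k * f (fun i => k.1 i) (fun i => k.2 i) = ∫ u, ∫ v, f u v ∂(Measure.pi fun _ => PV) ∂(Measure.pi fun _ => PU) := by
  rw [integral_pi_fin _ S fun _ => h.hU, Fintype.sum_prod_type]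
  refine Finset.sum_congr rfl fun u _ => ?_
  rw [integral_pi_fin _ S fun _ => h.hV, Finset.mul_sum]
  refine Finset.sum_congr rfl fun v _ => ?_
  simp only [mdl]; ring

theorem sum_mdl' (h : Std K S PU PV) (f : (Fin n → ℝ) → (Fin n → ℝ) → ℝ) :
    ∑ k, (mdl n h).w k * f (fun i => k.1 i) (fun i => k.2 i)
      = ∫ y, f (fun i => y (Sum.inl i)) (fun i => y (Sum.inr i)) ∂(Measure.pi (Sum.elim (fun _ : Fin n => PU) (fun _ : Fin n => PV))) := by
  have : ∀ i, IsProbabilityMeasure ((Sum.elim (fun _ : Fin n => PU) (fun _ : Fin n => PV)) i) := by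
    rintro (i | i) <;> simp <;> infer_instance
  rw [integral_pi_fin _ S (by rintro (i | i) <;> simp [h.hU, h.hV])]
  refine Fintype.sum_equiv (Equiv.sumArrowEquivProdArrow _ _ _).symm _ _ fun k => ?_
  rw [Fintype.prod_sum_type]
  simp [mdl]; rfl

end model

end Part12

section Part13

/-- clamp -/
def cl (K x : ℝ) : ℝ := max (min x K) (-K)
theorem cl_eq {K x : ℝ} (h : |x| ≤ K) : cl K x = x := by
  unfold cl; rw [min_eq_left (abs_le.1 h).2, max_eq_left (abs_le.1 h).1]
theorem cl_lip (K x y : ℝ) : |cl K x - cl K y| ≤ |x - y| := by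
  unfold cl
  exact (abs_max_sub_max_le_abs _ _ _).trans (by
    have := abs_min_sub_min_le_max x K y K
    simpa using this)
theorem cl_bd {K : ℝ} (hK : 0 ≤ K) (x : ℝ) : |cl K x| ≤ K := by
  unfold cl
  rw [abs_le]
  exact ⟨le_max_right _ _, max_le (min_le_right _ _) (by linarith)⟩

section var
variable {n : ℕ} {K : ℝ} {S : Finset ℝ} {PU PV : Measure ℝ} [IsProbabilityMeasure PU] [IsProbabilityMeasure PV]

/-- bounds of channels -/
def bch (K : ℝ) (n : ℕ) : Ch (Fin n) → ℝ := Sum.elim (fun _ => K ^ 2) (fun _ => K)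

theorem mdl_bd (h : Std K S PU PV) (k) (a : Ch (Fin n)) : |(mdl n h).x k a| ≤ bch K n a :=
  xx_bd h.hK (fun i => h.hS _ (k.1 i).2) (fun i => h.hS _ (k.2 i).2) a

theorem bch_nonneg (hK : 0 ≤ K) (a : Ch (Fin n)) : 0 ≤ bch K n a := by
  rcases a with a | a | a <;> simp [bch, hK]

theorem stdG_sq : ∫ x, x ^ 2 ∂stdG = 1 := by
  have h := variance_eq_integral (μ := gaussianReal 0 1) (X := fun x => x) measurable_id.aemeasurable
  rw [variance_fun_id_gaussianReal, integral_id_gaussianReal] at h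
  simpa [stdG] using h.symm

theorem stdG_sq_int : Integrable (fun x : ℝ => x ^ 2) stdG := by
  have := (memLp_id_gaussianReal (μ := 0) (v := 1) 2).integrable_sq
  simpa [stdG] using this

theorem sq_int_le {P : Measure ℝ} [IsProbabilityMeasure P] (hP : P ((↑S : Set ℝ)ᶜ) = 0) (hS : ∀ x ∈ S, |x| ≤ K) :
    ∫ x, x ^ 2 ∂P ≤ K ^ 2 := by
  have : ∫ x, x ^ 2 ∂P ≤ ∫ x, K ^ 2 ∂P := by
    refine integral_mono_ae (integrable_fin P S hP _) (integrable_const _) ?_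
    have : ∀ᵐ x ∂P, x ∈ S := by rw [ae_iff]; exact hP
    filter_upwards [this] with x hx
    rw [← sq_abs]; exact pow_le_pow_left₀ (abs_nonneg _) (hS x hx) 2
  simpa using this

theorem var_bound (h : Std K S PU PV) {t h1 h2 : ℝ} (ht : 0 ≤ t) (hh1 : 0 ≤ h1) (hh2 : 0 ≤ h2) :
    (mdl n h).Vr t h1 h2 ≤ n ^ 2 * t * K ^ 4 + n * (h1 + h2) * K ^ 2
      + n * ((n * t * K ^ 3 + h1 * K) ^ 2 + (n * t * K ^ 3 + h2 * K) ^ 2) * K ^ 2 := by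
  have hK0 : 0 ≤ K := by linarith [h.hK]
  set M := mdl n h with hM
  unfold FinModel.Vr
  set s := snr (Fin n) t h1 h2 with hs
  have hs0 : ∀ a, 0 ≤ s a := FinModel.snr_nonneg ht hh1 hh2
  have oL := M.Ok_ell s
  have hlip := M.ell_lip s (mdl_bd h)
  set c := M.Fr s with hc
  have e1 : M.EE s (fun z => (M.ell s z - c) ^ 2) = M.EE s (fun z => M.ell s z ^ 2) - c ^ 2 := by
    have : (fun z => (M.ell s z - c) ^ 2) = fun z => M.ell s z ^ 2 - 2 * c * M.ell s z + c ^ 2 := by ext z; ring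
    have o2 : FinModel.Ok fun z => 2 * c * M.ell s z := (FinModel.Ok.const _).mul oL
    rw [this, M.EE_add s ((oL.pow 2).sub o2) (FinModel.Ok.const _), M.EE_sub s (oL.pow 2) o2,
      M.EE_const s hs0, M.EE_const_mul]
    change _ - 2 * c * c + _ = _
    ring
  rw [e1]
  set G : (Fin n → ℝ) → (Fin n → ℝ) → ℝ := fun U V => ∫ z, M.ell s (z + fun a => √(s a) * xx (fun i => cl K (U i)) (fun i => cl K (V i)) a) ∂(gA (Ch (Fin n))) with hG
  have hGk : ∀ k : (Fin n → ↥S) × (Fin n → ↥S), ∫ z, M.ell s (z + M.sh s k) ∂(gA (Ch (Fin n))) = G (fun i => k.1 i) (fun i => k.2 i) := by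
    intro k
    simp only [hG]
    have e1 : (fun i => cl K (k.1 i : ℝ)) = fun i => (k.1 i : ℝ) := funext fun i => cl_eq (h.hS _ (k.1 i).2)
    have e2 : (fun i => cl K (k.2 i : ℝ)) = fun i => (k.2 i : ℝ) := funext fun i => cl_eq (h.hS _ (k.2 i).2)
    rw [e1, e2]; rfl
  have hcG : c = ∑ k, M.w k * G (fun i => k.1 i) (fun i => k.2 i) := by
    rw [hc, FinModel.Fr, M.EE_eq_planted s hs0 oL]
    exact Finset.sum_congr rfl fun k _ => by rw [hGk]
  -- inner variance
  have hin : ∀ k, ∫ z, M.ell s (z + M.sh s k) ^ 2 ∂(gA (Ch (Fin n))) ≤ G (fun i => k.1 i) (fun i => k.2 i) ^ 2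
      + (n ^ 2 * t * K ^ 4 + n * (h1 + h2) * K ^ 2) := by
    intro k
    have := efron_stein (fun _ : Ch (Fin n) => stdG) (fun _ => stdG_sq_int) (fun a => √(s a) * bch K n a)
      (fun z => M.ell s (z + M.sh s k)) (fun a => mul_nonneg (sqrt_nonneg _) (bch_nonneg hK0 a)) (fun z z' => by
        refine (hlip _ _).trans (le_of_eq ?_)
        refine Finset.sum_congr rfl fun a _ => ?_
        simp)
    change ∫ z, M.ell s (z + M.sh s k) ^ 2 ∂(gA (Ch (Fin n))) - (∫ z, M.ell s (z + M.sh s k) ∂(gA (Ch (Fin n)))) ^ 2 ≤ _ at this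
    rw [hGk] at this
    have e : ∑ a, (√(s a) * bch K n a) ^ 2 * ∫ x, x ^ 2 ∂stdG = n ^ 2 * t * K ^ 4 + n * (h1 + h2) * K ^ 2 := by
      rw [stdG_sq]
      simp only [mul_pow, Real.sq_sqrt (hs0 _), mul_one]
      rw [Fintype.sum_sum_type, Fintype.sum_sum_type]
      simp [hs, snr, bch]
      ring
    rw [e] at this
    linarith
  have e2 : M.EE s (fun z => M.ell s z ^ 2) ≤ ∑ k, M.w k * G (fun i => k.1 i) (fun i => k.2 i) ^ 2
      + (n ^ 2 * t * K ^ 4 + n * (h1 + h2) * K ^ 2) := by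
    rw [M.EE_eq_planted s hs0 (oL.pow 2)]
    have : (n ^ 2 * t * K ^ 4 + n * (h1 + h2) * K ^ 2) = ∑ k, M.w k * (n ^ 2 * t * K ^ 4 + n * (h1 + h2) * K ^ 2) := by
      rw [← Finset.sum_mul, M.hw1, one_mul]
    rw [this, ← Finset.sum_add_distrib]
    refine Finset.sum_le_sum fun k _ => ?_
    rw [← mul_add]
    exact mul_le_mul_of_nonneg_left (hin k) (M.hw k)
  -- outer variance
  have hintg : ∀ b : Ch (Fin n) → ℝ, Integrable (fun z => M.ell s (z + b)) (gA (Ch (Fin n))) := by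
    intro b
    have i0 := oL.integrable
    have hcont : Continuous fun z => M.ell s (z + b) := oL.1.comp (by fun_prop)
    refine (i0.abs.add (integrable_const (∑ a, √(s a) * bch K n a * |b a|))).mono' hcont.aestronglyMeasurable ?_
    refine Eventually.of_forall fun z => ?_
    have h1 := hlip (z + b) z
    have h2 := abs_sub_abs_le_abs_sub (M.ell s (z + b)) (M.ell s z)
    simp only [Pi.add_apply, add_sub_cancel_left] at h1 ⊢
    rw [Real.norm_eq_abs]; linarith
  have hGlip : ∀ U V U' V' : Fin n → ℝ, |G U V - G U' V'| ≤ (n * t * K ^ 3 + h1 * K) * ∑ i, |U i - U' i|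
      + (n * t * K ^ 3 + h2 * K) * ∑ i, |V i - V' i| := by
    intro U V U' V'
    simp only [hG]
    rw [← integral_sub (hintg _) (hintg _)]
    have hb : ∀ z : Ch (Fin n) → ℝ, ‖M.ell s (z + fun a => √(s a) * xx (fun i => cl K (U i)) (fun i => cl K (V i)) a)
        - M.ell s (z + fun a => √(s a) * xx (fun i => cl K (U' i)) (fun i => cl K (V' i)) a)‖ ≤ (n * t * K ^ 3 + h1 * K) * ∑ i, |U i - U' i|
      + (n * t * K ^ 3 + h2 * K) * ∑ i, |V i - V' i| := by
      intro z
      rw [Real.norm_eq_abs]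
      refine (hlip _ _).trans ?_
      have e3 : ∀ a, √(s a) * bch K n a * |(z + fun a => √(s a) * xx (fun i => cl K (U i)) (fun i => cl K (V i)) a) a
          - (z + fun a => √(s a) * xx (fun i => cl K (U' i)) (fun i => cl K (V' i)) a) a|
          = s a * bch K n a * |xx (fun i => cl K (U i)) (fun i => cl K (V i)) a - xx (fun i => cl K (U' i)) (fun i => cl K (V' i)) a| := by
        intro a
        simp only [Pi.add_apply, add_sub_add_left_eq_sub, ← mul_sub]
        rw [abs_mul, abs_of_nonneg (sqrt_nonneg _)]
        have := Real.mul_self_sqrt (hs0 a)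
        set r := √(s a)
        rw [← this]; ring
      simp only [e3]
      rw [Fintype.sum_sum_type, Fintype.sum_sum_type, Fintype.sum_prod_type]
      simp only [hs, snr, bch, xx, Sum.elim_inl, Sum.elim_inr]
      have p1 : ∑ i, ∑ j, t * K ^ 2 * |cl K (U i) * cl K (V j) - cl K (U' i) * cl K (V' j)|
          ≤ ∑ i : Fin n, ∑ j : Fin n, (t * K ^ 3 * |U i - U' i| + t * K ^ 3 * |V j - V' j|) := by
        refine Finset.sum_le_sum fun i _ => Finset.sum_le_sum fun j _ => ?_
        have q1 : |cl K (U i) * cl K (V j) - cl K (U' i) * cl K (V' j)| ≤ K * |U i - U' i| + K * |V j - V' j| := by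
          have : cl K (U i) * cl K (V j) - cl K (U' i) * cl K (V' j) = (cl K (U i) - cl K (U' i)) * cl K (V j) + cl K (U' i) * (cl K (V j) - cl K (V' j)) := by ring
          rw [this]
          refine (abs_add_le _ _).trans ?_
          rw [abs_mul, abs_mul, mul_comm (|cl K (U i) - cl K (U' i)|)]
          exact add_le_add (mul_le_mul (cl_bd hK0 _) (cl_lip _ _ _) (abs_nonneg _) hK0)
            (mul_le_mul (cl_bd hK0 _) (cl_lip _ _ _) (abs_nonneg _) hK0)
        calc _ ≤ t * K ^ 2 * (K * |U i - U' i| + K * |V j - V' j|) := mul_le_mul_of_nonneg_left q1 (by positivity)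
          _ = _ := by ring
      have p2 : ∑ i, h1 * K * |cl K (U i) - cl K (U' i)| ≤ ∑ i, h1 * K * |U i - U' i| :=
        Finset.sum_le_sum fun i _ => mul_le_mul_of_nonneg_left (cl_lip _ _ _) (by positivity)
      have p3 : ∑ i, h2 * K * |cl K (V i) - cl K (V' i)| ≤ ∑ i, h2 * K * |V i - V' i| :=
        Finset.sum_le_sum fun i _ => mul_le_mul_of_nonneg_left (cl_lip _ _ _) (by positivity)
      refine (add_le_add p1 (add_le_add p2 p3)).trans (le_of_eq ?_)
      simp only [Finset.sum_add_distrib, ← Finset.mul_sum, Finset.sum_const, Finset.card_univ, Fintype.card_fin, nsmul_eq_mul]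
      ring
    have := norm_integral_le_of_norm_le_const (μ := gA (Ch (Fin n))) (Eventually.of_forall hb)
    simpa using this
  have hout : ∑ k, M.w k * G (fun i => k.1 i) (fun i => k.2 i) ^ 2 - c ^ 2
      ≤ n * ((n * t * K ^ 3 + h1 * K) ^ 2 + (n * t * K ^ 3 + h2 * K) ^ 2) * K ^ 2 := by
    rw [hcG, hM, sum_mdl' n h G, sum_mdl' n h fun u v => G u v ^ 2]
    have : ∀ i, IsProbabilityMeasure ((Sum.elim (fun _ : Fin n => PU) (fun _ : Fin n => PV)) i) := by
      rintro (i | i) <;> simp <;> infer_instance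
    have hes := efron_stein (Sum.elim (fun _ : Fin n => PU) (fun _ : Fin n => PV))
      (by rintro (i | i)
          · exact integrable_fin PU S h.hU _
          · exact integrable_fin PV S h.hV _)
      (Sum.elim (fun _ => n * t * K ^ 3 + h1 * K) (fun _ => n * t * K ^ 3 + h2 * K))
      (fun y => G (fun i => y (Sum.inl i)) (fun i => y (Sum.inr i)))
      (by rintro (i | i) <;> simp <;> positivity)
      (fun y y' => by
        refine (hGlip _ _ _ _).trans (le_of_eq ?_)
        rw [Fintype.sum_sum_type]; simp only [Sum.elim_inl, Sum.elim_inr, Finset.mul_sum])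
    refine hes.trans ?_
    rw [Fintype.sum_sum_type]
    simp only [Sum.elim_inl, Sum.elim_inr, Finset.sum_const, Finset.card_univ, Fintype.card_fin, nsmul_eq_mul]
    have q1 := sq_int_le h.hU h.hS
    have q2 := sq_int_le h.hV h.hS
    have r1 := mul_le_mul_of_nonneg_left q1 (show 0 ≤ (n:ℝ) * (n * t * K ^ 3 + h1 * K) ^ 2 by positivity)
    have r2 := mul_le_mul_of_nonneg_left q2 (show 0 ≤ (n:ℝ) * (n * t * K ^ 3 + h2 * K) ^ 2 by positivity)
    linarith
  linarith

end var

end Part13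

section Part14

/-- Abstract properties of the free energy and its derivatives. -/
structure Sys (K : ℝ) (F T A1 A2 : ℝ → ℝ → ℝ → ℝ) : Prop where
  hK : 1 ≤ K
  cF : Continuous fun p : ℝ × ℝ × ℝ => F p.1 p.2.1 p.2.2
  cT : Continuous fun p : ℝ × ℝ × ℝ => T p.1 p.2.1 p.2.2
  cA1 : Continuous fun p : ℝ × ℝ × ℝ => A1 p.1 p.2.1 p.2.2
  cA2 : Continuous fun p : ℝ × ℝ × ℝ => A2 p.1 p.2.1 p.2.2
  bT : ∀ {t h1 h2 : ℝ}, 0 ≤ t → 0 ≤ h1 → 0 ≤ h2 → 0 ≤ T t h1 h2 ∧ T t h1 h2 ≤ K ^ 4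
  bA1 : ∀ {t h1 h2 : ℝ}, 0 ≤ t → 0 ≤ h1 → 0 ≤ h2 → 0 ≤ A1 t h1 h2 ∧ A1 t h1 h2 ≤ K ^ 2
  bA2 : ∀ {t h1 h2 : ℝ}, 0 ≤ t → 0 ≤ h1 → 0 ≤ h2 → 0 ≤ A2 t h1 h2 ∧ A2 t h1 h2 ≤ K ^ 2
  der : ∀ {t h1 h2 : ℝ}, 0 < t → 0 < h1 → 0 < h2 → ∀ dt d1 d2 : ℝ,
    HasDerivAt (fun τ => F (t + τ * dt) (h1 + τ * d1) (h2 + τ * d2))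
      (1 / 2 * (dt * T t h1 h2 + d1 * A1 t h1 h2 + d2 * A2 t h1 h2)) 0
  tan : ∀ {t h1 h2 t' h1' h2' : ℝ}, 0 ≤ t → 0 ≤ h1 → 0 ≤ h2 → 0 ≤ t' → 0 ≤ h1' → 0 ≤ h2' →
    F t h1 h2 + 1 / 2 * ((t' - t) * T t h1 h2 + (h1' - h1) * A1 t h1 h2 + (h2' - h2) * A2 t h1 h2) ≤ F t' h1' h2'
  mA1 : ∀ {t h1 h1' h2 : ℝ}, 0 ≤ t → 0 ≤ h1 → 0 ≤ h2 → h1 ≤ h1' → A1 t h1 h2 ≤ A1 t h1' h2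
  mA2 : ∀ {t h1 h1' h2 : ℝ}, 0 ≤ t → 0 ≤ h1 → 0 ≤ h2 → h1 ≤ h1' → A2 t h1 h2 ≤ A2 t h1' h2

namespace Sys
variable {K : ℝ} {F T A1 A2 : ℝ → ℝ → ℝ → ℝ}

/-- Chebyshev association. -/
theorem cheb {f g : ℝ → ℝ} {δ : ℝ} (hδ : 0 ≤ δ) (hf : Continuous f) (hg : Continuous g)
    (mf : MonotoneOn f (Set.Icc 0 δ)) (mg : MonotoneOn g (Set.Icc 0 δ)) :
    (∫ x in (0 : ℝ)..δ, f x) * (∫ x in (0 : ℝ)..δ, g x) ≤ δ * ∫ x in (0 : ℝ)..δ, f x * g x := by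
  have h0 : 0 ≤ ∫ x in (0 : ℝ)..δ, ∫ y in (0 : ℝ)..δ, (f x - f y) * (g x - g y) := by
    refine intervalIntegral.integral_nonneg hδ fun x hx => intervalIntegral.integral_nonneg hδ fun y hy => ?_
    rcases le_total x y with h | h
    · exact mul_nonneg_of_nonpos_of_nonpos (sub_nonpos.2 (mf hx hy h)) (sub_nonpos.2 (mg hx hy h))
    · exact mul_nonneg (sub_nonneg.2 (mf hy hx h)) (sub_nonneg.2 (mg hy hx h))
  have h1 : ∀ x, ∫ y in (0 : ℝ)..δ, (f x - f y) * (g x - g y)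
      = δ * (f x * g x) - f x * (∫ y in (0 : ℝ)..δ, g y) - (∫ y in (0 : ℝ)..δ, f y) * g x + ∫ y in (0 : ℝ)..δ, f y * g y := by
    intro x
    have e : ∀ y, (f x - f y) * (g x - g y) = f x * g x - f x * g y - f y * g x + f y * g y := fun y => by ring
    simp only [e]
    have i1 : ∀ {u : ℝ → ℝ}, Continuous u → IntervalIntegrable u volume 0 δ := fun hu => hu.intervalIntegrable _ _
    rw [intervalIntegral.integral_add (i1 (by fun_prop)) (i1 (by fun_prop)), intervalIntegral.integral_sub (i1 (by fun_prop)) (i1 (by fun_prop)), intervalIntegral.integral_sub (i1 (by fun_prop)) (i1 (by fun_prop))]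
    simp
    ring
  simp only [h1] at h0
  have i1 : ∀ {u : ℝ → ℝ}, Continuous u → IntervalIntegrable u volume 0 δ := fun hu => hu.intervalIntegrable _ _
  rw [intervalIntegral.integral_add (i1 (by fun_prop)) (i1 (by fun_prop)), intervalIntegral.integral_sub (i1 (by fun_prop)) (i1 (by fun_prop)), intervalIntegral.integral_sub (i1 (by fun_prop)) (i1 (by fun_prop))] at h0
  simp at h0
  nlinarith

/-- derivative of the smoothed free energy -/
theorem der_avg (s : Sys K F T A1 A2) {t h1 h2 δ : ℝ} (ht : 0 < t) (hh1 : 0 < h1) (hh2 : 0 < h2) (hδ : 0 ≤ δ) (dt d1 d2 : ℝ) :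
    HasDerivAt (fun τ => ∫ x in (0 : ℝ)..δ, F (t + τ * dt) (h1 + x + τ * d1) (h2 + τ * d2))
      (∫ x in (0 : ℝ)..δ, 1 / 2 * (dt * T t (h1 + x) h2 + d1 * A1 t (h1 + x) h2 + d2 * A2 t (h1 + x) h2)) 0 := by
  have hev : ∀ {a d : ℝ}, 0 < a → ∀ᶠ τ in 𝓝 (0 : ℝ), 0 < a + τ * d := by
    intro a d ha
    have : ContinuousAt (fun τ : ℝ => a + τ * d) 0 := by fun_prop
    refine this.eventually_const_lt ?_
    simpa using ha
  have hs : {τ : ℝ | 0 < t + τ * dt ∧ 0 < h1 + τ * d1 ∧ 0 < h2 + τ * d2} ∈ 𝓝 (0 : ℝ) :=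
    (hev ht).and ((hev hh1).and (hev hh2))
  have key := intervalIntegral.hasDerivAt_integral_of_dominated_loc_of_deriv_le (μ := volume) (a := 0) (b := δ)
    (F := fun τ x => F (t + τ * dt) (h1 + x + τ * d1) (h2 + τ * d2))
    (F' := fun τ x => 1 / 2 * (dt * T (t + τ * dt) (h1 + x + τ * d1) (h2 + τ * d2) + d1 * A1 (t + τ * dt) (h1 + x + τ * d1) (h2 + τ * d2) + d2 * A2 (t + τ * dt) (h1 + x + τ * d1) (h2 + τ * d2)))
    (x₀ := 0) (bound := fun _ => |dt| * K ^ 4 + |d1| * K ^ 2 + |d2| * K ^ 2) (s := {τ : ℝ | 0 < t + τ * dt ∧ 0 < h1 + τ * d1 ∧ 0 < h2 + τ * d2})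
    hs ?_ ?_ ?_ ?_ ?_ ?_
  · have k2 := key.2
    simpa using k2
  · refine Eventually.of_forall fun τ => ?_
    have : Continuous fun x => F (t + τ * dt) (h1 + x + τ * d1) (h2 + τ * d2) :=
      s.cF.comp (f := fun x => (t + τ * dt, h1 + x + τ * d1, h2 + τ * d2)) (by fun_prop)
    exact this.aestronglyMeasurable
  · have : Continuous fun x => F (t + 0 * dt) (h1 + x + 0 * d1) (h2 + 0 * d2) :=
      s.cF.comp (f := fun x => (t + 0 * dt, h1 + x + 0 * d1, h2 + 0 * d2)) (by fun_prop)
    exact this.intervalIntegrable _ _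
  · have c1 : Continuous fun x => T (t + 0 * dt) (h1 + x + 0 * d1) (h2 + 0 * d2) :=
      s.cT.comp (f := fun x => (t + 0 * dt, h1 + x + 0 * d1, h2 + 0 * d2)) (by fun_prop)
    have c2 : Continuous fun x => A1 (t + 0 * dt) (h1 + x + 0 * d1) (h2 + 0 * d2) :=
      s.cA1.comp (f := fun x => (t + 0 * dt, h1 + x + 0 * d1, h2 + 0 * d2)) (by fun_prop)
    have c3 : Continuous fun x => A2 (t + 0 * dt) (h1 + x + 0 * d1) (h2 + 0 * d2) :=
      s.cA2.comp (f := fun x => (t + 0 * dt, h1 + x + 0 * d1, h2 + 0 * d2)) (by fun_prop)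
    exact (continuous_const.mul (((continuous_const.mul c1).add (continuous_const.mul c2)).add (continuous_const.mul c3))).aestronglyMeasurable
  · refine Eventually.of_forall fun x hx τ hτ => ?_
    rw [Set.uIoc_of_le hδ] at hx
    obtain ⟨p1, p2, p3⟩ := hτ
    have p2' : 0 ≤ h1 + x + τ * d1 := by linarith [hx.1]
    have b1 := s.bT p1.le p2' p3.le
    have b2 := s.bA1 p1.le p2' p3.le
    have b3 := s.bA2 p1.le p2' p3.le
    have q1 : |dt * T (t + τ * dt) (h1 + x + τ * d1) (h2 + τ * d2)| ≤ |dt| * K ^ 4 := by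
      rw [abs_mul, abs_of_nonneg b1.1]; exact mul_le_mul_of_nonneg_left b1.2 (abs_nonneg _)
    have q2 : |d1 * A1 (t + τ * dt) (h1 + x + τ * d1) (h2 + τ * d2)| ≤ |d1| * K ^ 2 := by
      rw [abs_mul, abs_of_nonneg b2.1]; exact mul_le_mul_of_nonneg_left b2.2 (abs_nonneg _)
    have q3 : |d2 * A2 (t + τ * dt) (h1 + x + τ * d1) (h2 + τ * d2)| ≤ |d2| * K ^ 2 := by
      rw [abs_mul, abs_of_nonneg b3.1]; exact mul_le_mul_of_nonneg_left b3.2 (abs_nonneg _)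
    rw [Real.norm_eq_abs]
    rw [abs_le] at *
    constructor <;> linarith
  · exact intervalIntegrable_const
  · refine Eventually.of_forall fun x hx τ hτ => ?_
    rw [Set.uIoc_of_le hδ] at hx
    obtain ⟨p1, p2, p3⟩ := hτ
    have p2' : 0 < h1 + x + τ * d1 := by linarith [hx.1]
    have hd := s.der p1 p2' p3 dt d1 d2
    have h0 : HasDerivAt (fun y : ℝ => y - τ) 1 τ := (hasDerivAt_id τ).sub_const τ
    have h3 := hd.comp_of_eq τ h0 (by simp)
    simp only [Function.comp_def, mul_one] at h3
    convert! h3 using 1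
    ext y
    congr 1 <;> ring

theorem mono (s : Sys K F T A1 A2) {t h1 h2 t' h1' h2' : ℝ} (ht : 0 ≤ t) (hh1 : 0 ≤ h1) (hh2 : 0 ≤ h2) (a : t ≤ t') (b : h1 ≤ h1') (c : h2 ≤ h2') :
    F t h1 h2 ≤ F t' h1' h2' := by
  have h := s.tan ht hh1 hh2 (ht.trans a) (hh1.trans b) (hh2.trans c)
  have b1 := s.bT ht hh1 hh2
  have b2 := s.bA1 ht hh1 hh2
  have b3 := s.bA2 ht hh1 hh2
  have := mul_nonneg (sub_nonneg.2 a) b1.1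
  have := mul_nonneg (sub_nonneg.2 b) b2.1
  have := mul_nonneg (sub_nonneg.2 c) b3.1
  linarith

theorem lip (s : Sys K F T A1 A2) {t h1 h2 t' h1' h2' : ℝ} (ht : 0 ≤ t) (hh1 : 0 ≤ h1) (hh2 : 0 ≤ h2) (a : t ≤ t') (b : h1 ≤ h1') (c : h2 ≤ h2') :
    F t' h1' h2' ≤ F t h1 h2 + 1 / 2 * ((t' - t) * K ^ 4 + (h1' - h1) * K ^ 2 + (h2' - h2) * K ^ 2) := by
  have h := s.tan (ht.trans a) (hh1.trans b) (hh2.trans c) ht hh1 hh2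
  have b1 := s.bT (ht.trans a) (hh1.trans b) (hh2.trans c)
  have b2 := s.bA1 (ht.trans a) (hh1.trans b) (hh2.trans c)
  have b3 := s.bA2 (ht.trans a) (hh1.trans b) (hh2.trans c)
  have := mul_le_mul_of_nonneg_left b1.2 (sub_nonneg.2 a)
  have := mul_le_mul_of_nonneg_left b2.2 (sub_nonneg.2 b)
  have := mul_le_mul_of_nonneg_left b3.2 (sub_nonneg.2 c)
  linarith

end Sys

end Part14

section Part15

namespace Sys
variable {K : ℝ} {F T A1 A2 : ℝ → ℝ → ℝ → ℝ}

theorem deriv_nonneg_of_min {φ : ℝ → ℝ} {φ' τ0 : ℝ} (h : HasDerivAt φ φ' 0) (hτ : 0 < τ0)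
    (hm : ∀ τ ∈ Set.Ioo 0 τ0, φ 0 ≤ φ τ) : 0 ≤ φ' := by
  have h1 := (hasDerivAt_iff_tendsto_slope.1 h).mono_left (nhdsWithin_mono 0 (fun x (hx : x ∈ Set.Ioi (0:ℝ)) => ne_of_gt hx))
  refine ge_of_tendsto h1 ?_
  filter_upwards [Ioo_mem_nhdsGT hτ] with τ hτ'
  rw [slope_def_field]
  exact div_nonneg (sub_nonneg.2 (hm τ hτ')) (by linarith [hτ'.1])

theorem lower (s : Sys K F T A1 A2) {a1 a2 c0 Λ δ R ε κ : ℝ} (ha1 : 0 ≤ a1) (ha2 : 0 ≤ a2) (hΛ : 0 < Λ) (hδ : 0 < δ) (hR : δ < R)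
    (hε : 0 < ε) (hκ : 0 < κ) (hκR : 1 / 2 * a1 * a2 * Λ ≤ κ * R) (haK : a1 ≤ K ^ 2)
    (h0 : ∀ h1 h2, 0 ≤ h1 → 0 ≤ h2 → c0 + 1 / 2 * a1 * h1 + 1 / 2 * a2 * h2 ≤ F 0 h1 h2)
    (hdec : ∀ t ∈ Set.Icc 0 Λ, ∀ h1 ∈ Set.Icc δ R, ∀ h2 ∈ Set.Icc 0 (δ + a1 * Λ),
      ∫ x in (0:ℝ)..δ, |T t (h1 + x) h2 - A1 t (h1 + x) h2 * A2 t (h1 + x) h2| ≤ ε * δ) :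
    c0 + 1 / 2 * a1 * a2 * Λ - ε * Λ - κ * (δ + K ^ 2 * Λ) - 2 * K ^ 2 * δ ≤ F Λ 0 0 := by
  have hK0 : 0 ≤ K ^ 2 := sq_nonneg K
  -- the barrier function, multiplied by δ
  let W : ℝ × ℝ → ℝ := fun p => (∫ x in (0:ℝ)..δ, F p.1 (p.2 + x) (δ + a1 * (Λ - p.1))) + δ * (- 1 / 2 * a1 * p.2 + ε * p.1 + κ * (p.2 + K ^ 2 * p.1))
  have hcW : Continuous W := by
    refine Continuous.add ?_ (by fun_prop)
    refine intervalIntegral.continuous_parametric_intervalIntegral_of_continuous' (f := fun (p : ℝ × ℝ) x => F p.1 (p.2 + x) (δ + a1 * (Λ - p.1))) ?_ 0 δ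
    exact s.cF.comp (f := fun q : (ℝ × ℝ) × ℝ => (q.1.1, q.1.2 + q.2, δ + a1 * (Λ - q.1.1))) (by fun_prop)
  have hcx : ∀ t h h2, Continuous fun x => F t (h + x) h2 := fun t h h2 =>
    s.cF.comp (f := fun x : ℝ => (t, h + x, h2)) (by fun_prop)
  obtain ⟨⟨t, h⟩, ⟨⟨ht0, hh0⟩, ht1, hh1⟩, hmin⟩ := (isCompact_Icc : IsCompact (Set.Icc ((0:ℝ), δ) (Λ, R))).exists_isMinOn
    ⟨((0:ℝ), δ), ⟨le_rfl, ⟨hΛ.le, hR.le⟩⟩⟩ hcW.continuousOn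
  simp only at ht0 hh0 ht1 hh1
  have hintg : ∀ c : ℝ, ∫ x in (0:ℝ)..δ, c = δ * c := by intro c; simp
  have claim : δ * (c0 + 1 / 2 * a1 * a2 * Λ) ≤ W (t, h) := by
    have hge : ∀ x ∈ Set.Icc 0 δ, c0 + 1 / 2 * a1 * h + 1 / 2 * a2 * (a1 * (Λ - t)) ≤ F t (h + x) (δ + a1 * (Λ - t)) := by
      intro x hx
      have q : 0 ≤ a1 * (Λ - t) := mul_nonneg ha1 (by linarith)
      have p1 := h0 (h + x) (δ + a1 * (Λ - t)) (by linarith [hx.1]) (by linarith)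
      have p2 := s.mono (t' := t) (h1' := h + x) (h2' := δ + a1 * (Λ - t)) le_rfl (by linarith [hx.1] : 0 ≤ h + x) (by linarith : 0 ≤ δ + a1 * (Λ - t)) ht0 le_rfl le_rfl
      have p3 := mul_nonneg ha1 hx.1
      have p4 := mul_nonneg ha2 hδ.le
      linarith
    have hge' : δ * (c0 + 1 / 2 * a1 * h + 1 / 2 * a2 * (a1 * (Λ - t))) ≤ ∫ x in (0:ℝ)..δ, F t (h + x) (δ + a1 * (Λ - t)) := by
      rw [← hintg]
      exact intervalIntegral.integral_mono_on hδ.le intervalIntegrable_const ((hcx _ _ _).intervalIntegrable _ _) hge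
    have n1 : 0 ≤ κ * (K ^ 2 * t) := by positivity
    have n2 : 0 ≤ κ * h := by nlinarith
    have n3 : 0 ≤ ε * t := by positivity
    rcases eq_or_lt_of_le ht0 with ht | ht
    · subst ht
      simp only [W]
      have : 0 ≤ δ * (ε * 0 + κ * (h + K ^ 2 * 0)) := mul_nonneg hδ.le (by linarith)
      nlinarith
    rcases eq_or_lt_of_le hh1 with hh | hh
    · rw [hh] at hge' n2 ⊢
      simp only [W]
      have : 0 ≤ δ * (ε * t + κ * (R + K ^ 2 * t) - 1 / 2 * a1 * a2 * t) := by
        refine mul_nonneg hδ.le ?_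
        have := mul_le_mul_of_nonneg_left ht1 (mul_nonneg ha1 ha2)
        nlinarith
      nlinarith
    exfalso
    set h2 := δ + a1 * (Λ - t) with hh2
    have hh2p : 0 < h2 := by have := mul_nonneg ha1 (by linarith : 0 ≤ Λ - t); linarith
    set ab := (∫ x in (0:ℝ)..δ, A2 t (h + x) h2) / δ with hab
    have cT : Continuous fun x => T t (h + x) h2 := s.cT.comp (f := fun x : ℝ => (t, h + x, h2)) (by fun_prop)
    have c1 : Continuous fun x => A1 t (h + x) h2 := s.cA1.comp (f := fun x : ℝ => (t, h + x, h2)) (by fun_prop)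
    have c2 : Continuous fun x => A2 t (h + x) h2 := s.cA2.comp (f := fun x : ℝ => (t, h + x, h2)) (by fun_prop)
    have iI : ∀ {u : ℝ → ℝ}, Continuous u → IntervalIntegrable u volume 0 δ := fun hu => hu.intervalIntegrable _ _
    have hab0 : 0 ≤ ab := div_nonneg (intervalIntegral.integral_nonneg hδ.le fun x hx => (s.bA2 ht0 (by linarith [hx.1]) hh2p.le).1) hδ.le
    have habK : ab ≤ K ^ 2 := by
      rw [hab, div_le_iff₀ hδ, mul_comm, ← hintg]
      exact intervalIntegral.integral_mono_on hδ.le (iI c2) intervalIntegrable_const fun x hx => (s.bA2 ht0 (by linarith [hx.1]) hh2p.le).2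
    have hd := s.der_avg ht (by linarith : 0 < h) hh2p hδ.le (-1) ab a1
    have hd2 : HasDerivAt (fun τ : ℝ => δ * (- 1 / 2 * a1 * (h + τ * ab) + ε * (t - τ) + κ * ((h + τ * ab) + K ^ 2 * (t - τ)))) (δ * (- 1 / 2 * a1 * ab + ε * (-1) + κ * (ab + K ^ 2 * (-1)))) 0 := by
      have e1 : HasDerivAt (fun τ : ℝ => h + τ * ab) ab 0 := by simpa using ((hasDerivAt_id (0:ℝ)).mul_const ab).const_add h
      have e2 : HasDerivAt (fun τ : ℝ => t - τ) (-1) 0 := by simpa using (hasDerivAt_id (0:ℝ)).const_sub t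
      exact (((e1.const_mul _).add (e2.const_mul _)).add ((e1.add (e2.const_mul _)).const_mul _)).const_mul _
    have hd3 := hd.add hd2
    have hpos := deriv_nonneg_of_min (τ0 := min t ((R - h) / (1 + ab))) hd3 (lt_min ht (div_pos (by linarith) (by linarith))) ?_
    · -- contradiction
      have hdc := hdec t ⟨ht0, ht1⟩ h ⟨hh0, hh1⟩ h2 ⟨hh2p.le, by rw [hh2]; have := mul_nonneg ha1 ht0; nlinarith⟩
      have hc := cheb hδ.le c1 c2 (fun x hx y hy hxy => s.mA1 ht0 (by linarith [hx.1]) hh2p.le (by linarith)) (fun x hx y hy hxy => s.mA2 ht0 (by linarith [hx.1]) hh2p.le (by linarith))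
      have hc' : (∫ x in (0:ℝ)..δ, A1 t (h + x) h2) * ab ≤ ∫ x in (0:ℝ)..δ, A1 t (h + x) h2 * A2 t (h + x) h2 := by
        rw [hab, mul_div_assoc', div_le_iff₀ hδ]; linarith
      have hTT : (∫ x in (0:ℝ)..δ, A1 t (h + x) h2 * A2 t (h + x) h2) - (∫ x in (0:ℝ)..δ, T t (h + x) h2) ≤ ε * δ := by
        have cm : Continuous fun x => A1 t (h + x) h2 * A2 t (h + x) h2 := c1.mul c2
        rw [← intervalIntegral.integral_sub (iI cm) (iI cT)]
        refine le_trans (intervalIntegral.integral_mono_on hδ.le (iI ((c1.mul c2).sub cT)) (iI (cT.sub (c1.mul c2)).abs) fun x hx => ?_) hdc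
        simp only [Pi.sub_apply, Pi.mul_apply]; rw [abs_sub_comm]; exact le_abs_self _
      have e2 : (∫ x in (0:ℝ)..δ, A2 t (h + x) h2) = δ * ab := by rw [hab]; field_simp
      have cT' : Continuous fun x => -1 * T t (h + x) h2 := continuous_const.mul cT
      have c1' : Continuous fun x => ab * A1 t (h + x) h2 := continuous_const.mul c1
      have c2' : Continuous fun x => a1 * A2 t (h + x) h2 := continuous_const.mul c2
      have cs : Continuous fun x => -1 * T t (h + x) h2 + ab * A1 t (h + x) h2 := cT'.add c1'
      rw [intervalIntegral.integral_const_mul, intervalIntegral.integral_add (iI cs) (iI c2'), intervalIntegral.integral_add (iI cT') (iI c1'), intervalIntegral.integral_const_mul, intervalIntegral.integral_const_mul, intervalIntegral.integral_const_mul, e2] at hpos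
      have hh := mul_nonneg (mul_nonneg hδ.le hκ.le) (sub_nonneg.2 habK)
      have hh' := mul_pos hδ hε
      nlinarith
    · intro τ hτ
      have hτ1 : τ < t := lt_of_lt_of_le hτ.2 (min_le_left _ _)
      have hτ2 : τ < (R - h) / (1 + ab) := lt_of_lt_of_le hτ.2 (min_le_right _ _)
      rw [lt_div_iff₀ (by linarith)] at hτ2
      have hτ0 := hτ.1
      have hta := mul_nonneg hτ0.le hab0
      have hm := hmin (show ((t - τ, h + τ * ab) : ℝ × ℝ) ∈ Set.Icc ((0:ℝ), δ) (Λ, R) from ⟨⟨by simp; linarith, by simp; linarith⟩, ⟨by simp; linarith, by simp; nlinarith⟩⟩)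
      simp only [Set.mem_ofPred_eq, W] at hm
      have w1 : (∫ x in (0:ℝ)..δ, F (t + τ * -1) (h + x + τ * ab) (h2 + τ * a1)) = ∫ x in (0:ℝ)..δ, F (t - τ) (h + τ * ab + x) (δ + a1 * (Λ - (t - τ))) := by
        congr 1; ext x; rw [hh2]; congr 1 <;> ring
      simp only [Pi.add_apply, w1]
      simpa using hm
  have hm := hmin (show ((Λ, δ) : ℝ × ℝ) ∈ Set.Icc ((0:ℝ), δ) (Λ, R) from ⟨⟨hΛ.le, le_rfl⟩, ⟨le_rfl, hR.le⟩⟩)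
  simp only [Set.mem_ofPred_eq] at hm
  have hfin : (∫ x in (0:ℝ)..δ, F Λ (δ + x) (δ + a1 * (Λ - Λ))) ≤ δ * (F Λ 0 0 + 1 / 2 * (2 * δ * K ^ 2 + δ * K ^ 2)) := by
    rw [← hintg]
    refine intervalIntegral.integral_mono_on hδ.le ((hcx _ _ _).intervalIntegrable _ _) intervalIntegrable_const fun x hx => ?_
    have := s.lip (t' := Λ) (h1' := δ + x) (h2' := δ + a1 * (Λ - Λ)) hΛ.le le_rfl le_rfl le_rfl (by linarith [hx.1]) (by simp; linarith)
    have h5 := mul_le_mul_of_nonneg_right hx.2 hK0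
    simp only [sub_self, mul_zero, add_zero, zero_mul, zero_add, sub_zero] at this ⊢
    linarith
  have hW := claim.trans hm
  simp only [W] at hW
  have : δ * (c0 + 1 / 2 * a1 * a2 * Λ - ε * Λ - κ * (δ + K ^ 2 * Λ) - 2 * K ^ 2 * δ) ≤ δ * F Λ 0 0 := by
    have q1 : 0 ≤ δ * (δ * (1 / 2 * a1)) := by positivity
    have q2 : 0 ≤ δ * (δ * K ^ 2) := by positivity
    linarith
  exact le_of_mul_le_mul_left this hδ
end Sys

end Part15

section Part16

/-- Properties of the scalar channel. -/
structure Sc (K : ℝ) (ψ f : ℝ → ℝ) : Prop where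
  cψ : Continuous ψ
  cf : Continuous f
  bf : ∀ {x}, 0 ≤ x → 0 ≤ f x ∧ f x ≤ K ^ 2
  mf : ∀ {x y}, 0 ≤ x → x ≤ y → f x ≤ f y
  pf : ∀ {x}, 0 < x → 0 < f x
  tan : ∀ {x y}, 0 ≤ x → 0 ≤ y → ψ x + 1 / 2 * ((y - x) * f x) ≤ ψ y

/-- Sequence of systems with asymptotic decoupling. -/
structure SysSeq (K : ℝ) (ψ1 ψ2 : ℝ → ℝ) (F T A1 A2 : ℕ → ℝ → ℝ → ℝ → ℝ) : Prop where
  sys : ∀ n, 1 ≤ n → Sys K (F n) (T n) (A1 n) (A2 n)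
  F0 : ∀ n, 1 ≤ n → ∀ h1 h2, 0 ≤ h1 → 0 ≤ h2 → F n 0 h1 h2 = ψ1 h1 + ψ2 h2
  dec : ∀ R δ ε : ℝ, 0 < R → 0 < δ → 0 < ε → ∀ᶠ n in atTop, ∀ t ∈ Set.Icc 0 R, ∀ h1 ∈ Set.Icc δ R, ∀ h2 ∈ Set.Icc 0 R,
      ∫ x in (0:ℝ)..δ, |T n t (h1 + x) h2 - A1 n t (h1 + x) h2 * A2 n t (h1 + x) h2| ≤ ε

namespace SysSeq
variable {K : ℝ} {ψ1 ψ2 f1 f2 : ℝ → ℝ} {F T A1 A2 : ℕ → ℝ → ℝ → ℝ → ℝ}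

theorem lower (s : SysSeq K ψ1 ψ2 F T A1 A2) (s1 : Sc K ψ1 f1) (s2 : Sc K ψ2 f2) {x y Λ η : ℝ} (hx : 0 ≤ x) (hy : 0 ≤ y) (hΛ : 0 < Λ) (hη : 0 < η) :
    ∀ᶠ n in atTop, ψ1 x + ψ2 y - 1 / 2 * f1 x * x - 1 / 2 * f2 y * y + 1 / 2 * f1 x * f2 y * Λ - η ≤ F n Λ 0 0 := by
  have ha1 := (s1.bf hx).1
  have ha2 := (s2.bf hy).1
  have hK2 : 0 ≤ K ^ 2 := sq_nonneg K
  set a1 := f1 x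
  set a2 := f2 y
  obtain ⟨κ, hκ, hκ'⟩ : ∃ κ : ℝ, 0 < κ ∧ κ * (1 + K ^ 2 * Λ) ≤ η / 3 := by
    refine ⟨η / 3 / (1 + K ^ 2 * Λ), by positivity, ?_⟩
    rw [div_mul_cancel₀]; positivity
  obtain ⟨δ, hδ, hδ1, hδ'⟩ : ∃ δ : ℝ, 0 < δ ∧ δ ≤ 1 ∧ 2 * K ^ 2 * δ ≤ η / 3 := by
    refine ⟨min 1 (η / 3 / (2 * K ^ 2 + 1)), lt_min one_pos (by positivity), min_le_left _ _, ?_⟩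
    have h1 : min 1 (η / 3 / (2 * K ^ 2 + 1)) ≤ η / 3 / (2 * K ^ 2 + 1) := min_le_right _ _
    rw [le_div_iff₀ (by positivity)] at h1
    have : 0 < min 1 (η / 3 / (2 * K ^ 2 + 1)) := lt_min one_pos (by positivity)
    linarith
  obtain ⟨ε, hε, hε'⟩ : ∃ ε : ℝ, 0 < ε ∧ ε * Λ ≤ η / 3 := ⟨η / 3 / Λ, by positivity, by rw [div_mul_cancel₀]; exact hΛ.ne'⟩
  set R := 1 / 2 * a1 * a2 * Λ / κ + δ + 1 with hR
  have hR0 : 0 ≤ 1 / 2 * a1 * a2 * Λ / κ := by positivity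
  have hq : 0 ≤ a1 * Λ := by positivity
  have hd := s.dec (R + Λ + δ + a1 * Λ) δ (ε * δ) (by linarith) hδ (by positivity)
  filter_upwards [hd, eventually_ge_atTop 1] with n hn hn1
  have := (s.sys n hn1).lower (a1 := a1) (a2 := a2) (c0 := ψ1 x + ψ2 y - 1 / 2 * a1 * x - 1 / 2 * a2 * y) (Λ := Λ) (δ := δ) (R := R) (ε := ε) (κ := κ)
    ha1 ha2 hΛ hδ (by linarith) hε hκ ?_ (s1.bf hx).2 ?_ ?_
  · have : κ * (δ + K ^ 2 * Λ) ≤ κ * (1 + K ^ 2 * Λ) := by gcongr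
    linarith
  · have : κ * (1 / 2 * a1 * a2 * Λ / κ) = 1 / 2 * a1 * a2 * Λ := by field_simp
    rw [hR]; nlinarith
  · intro h1 h2 hh1 hh2
    rw [s.F0 n hn1 h1 h2 hh1 hh2]
    have := s1.tan hx hh1
    have := s2.tan hy hh2
    linarith
  · intro t ht h1 hh1 h2 hh2
    exact hn t ⟨ht.1, by linarith [ht.2]⟩ h1 ⟨hh1.1, by linarith [hh1.2]⟩ h2 ⟨hh2.1, by linarith [hh2.2]⟩

theorem upper (s : SysSeq K ψ1 ψ2 F T A1 A2) {Λ η : ℝ} (hΛ : 0 < Λ) (hη : 0 < η) :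
    ∀ᶠ n in atTop, ∃ a1 a2 : ℝ, 0 ≤ a1 ∧ a1 ≤ K ^ 2 ∧ 0 ≤ a2 ∧ a2 ≤ K ^ 2 ∧ ∀ h1 h2, 0 ≤ h1 → 0 ≤ h2 →
      F n Λ 0 0 ≤ ψ1 h1 + ψ2 h2 - 1 / 2 * a1 * h1 - 1 / 2 * a2 * h2 + 1 / 2 * Λ * (a1 * a2) + η := by
  have hK2 : 0 ≤ K ^ 2 := sq_nonneg K
  obtain ⟨δ, hδ, hδ'⟩ : ∃ δ : ℝ, 0 < δ ∧ 2 * K ^ 2 * δ ≤ η / 2 := by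
    refine ⟨(η / 2 / (2 * K ^ 2 + 1)), (by positivity), ?_⟩
    have h1 : (η / 2 / (2 * K ^ 2 + 1)) ≤ η / 2 / (2 * K ^ 2 + 1) := le_rfl
    rw [le_div_iff₀ (by positivity)] at h1
    have : 0 < (η / 2 / (2 * K ^ 2 + 1)) := (by positivity)
    linarith
  obtain ⟨ε, hε, hε'⟩ : ∃ ε : ℝ, 0 < ε ∧ ε * Λ ≤ η / 2 := ⟨η / 2 / Λ, by positivity, by rw [div_mul_cancel₀]; exact hΛ.ne'⟩
  have hd := s.dec (Λ + δ) δ (ε * δ) (by linarith) hδ (by positivity)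
  filter_upwards [hd, eventually_ge_atTop 1] with n hn hn1
  have sn := s.sys n hn1
  have h := hn Λ ⟨hΛ.le, by linarith⟩ δ ⟨le_rfl, by linarith⟩ δ ⟨hδ.le, by linarith⟩
  have cc : Continuous fun x => |T n Λ (δ + x) δ - A1 n Λ (δ + x) δ * A2 n Λ (δ + x) δ| := by
    have cT : Continuous fun x => T n Λ (δ + x) δ := sn.cT.comp (f := fun x : ℝ => (Λ, δ + x, δ)) (by fun_prop)
    have c1 : Continuous fun x => A1 n Λ (δ + x) δ := sn.cA1.comp (f := fun x : ℝ => (Λ, δ + x, δ)) (by fun_prop)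
    have c2 : Continuous fun x => A2 n Λ (δ + x) δ := sn.cA2.comp (f := fun x : ℝ => (Λ, δ + x, δ)) (by fun_prop)
    exact (cT.sub (c1.mul c2)).abs
  obtain ⟨x, hx, hxe⟩ : ∃ x ∈ Set.Icc 0 δ, |T n Λ (δ + x) δ - A1 n Λ (δ + x) δ * A2 n Λ (δ + x) δ| < 2 * ε := by
    by_contra hcon
    push Not at hcon
    have := intervalIntegral.integral_mono_on hδ.le intervalIntegrable_const (cc.intervalIntegrable (μ := volume) 0 δ) hcon
    simp at this
    nlinarith [mul_pos hε hδ]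
  have hp : 0 ≤ δ + x := by linarith [hx.1]
  have b1 := sn.bA1 hΛ.le hp hδ.le
  have b2 := sn.bA2 hΛ.le hp hδ.le
  refine ⟨A1 n Λ (δ + x) δ, A2 n Λ (δ + x) δ, b1.1, b1.2, b2.1, b2.2, fun h1 h2 hh1 hh2 => ?_⟩
  have ht := sn.tan hΛ.le hp hδ.le le_rfl hh1 hh2
  rw [s.F0 n hn1 h1 h2 hh1 hh2] at ht
  have hm := sn.mono (t' := Λ) (h1' := δ + x) (h2' := δ) hΛ.le le_rfl le_rfl le_rfl hp hδ.le
  have q1 : (δ + x) * A1 n Λ (δ + x) δ ≤ 2 * δ * K ^ 2 := mul_le_mul (by linarith [hx.2]) b1.2 b1.1 (by linarith)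
  have q2 : δ * A2 n Λ (δ + x) δ ≤ δ * K ^ 2 := mul_le_mul_of_nonneg_left b2.2 hδ.le
  have q3 := (abs_lt.1 hxe).2
  have q4 : Λ * (T n Λ (δ + x) δ - A1 n Λ (δ + x) δ * A2 n Λ (δ + x) δ) ≤ Λ * (2 * ε) := mul_le_mul_of_nonneg_left q3.le hΛ.le
  nlinarith [mul_nonneg hδ.le hK2]

/-- upper bound is dominated by a fixed point -/
theorem fixpt (s1 : Sc K ψ1 f1) (s2 : Sc K ψ2 f2) {Λ a1 : ℝ} (hΛ : 0 < Λ) (ha1 : 0 ≤ a1) :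
    ∃ h, 0 ≤ h ∧ ∃ q1 q2 : ℝ, 0 ≤ q1 ∧ 0 ≤ q2 ∧ q2 = f1 (Λ * q1) ∧ q1 = f2 (Λ * q2) ∧
      ψ1 h + ψ2 (Λ * a1) - 1 / 2 * a1 * h ≤ ψ1 (Λ * q1) + ψ2 (Λ * q2) - Λ / 2 * q1 * q2 := by
  set w : ℝ → ℝ := fun h => ψ1 h - 1 / 2 * f1 h * h + ψ2 (Λ * f1 h) with hw
  have hcw : Continuous w := by
    have c1 := s1.cψ; have c2 := s1.cf; have c3 := s2.cψ
    fun_prop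
  have step : ∀ a, 0 ≤ a → ∀ h, h = Λ * f2 (Λ * a) → ψ1 h + ψ2 (Λ * a) - 1 / 2 * a * h ≤ w h := by
    intro a ha h hh
    have hp : 0 ≤ Λ * a := by positivity
    have h0 : 0 ≤ h := by rw [hh]; exact mul_nonneg hΛ.le (s2.bf hp).1
    have := s2.tan hp (mul_nonneg hΛ.le (s1.bf h0).1)
    have e : (Λ * f1 h - Λ * a) * f2 (Λ * a) = (f1 h - a) * h := by rw [hh]; ring
    rw [e] at this
    simp only [hw]
    linarith
  set g : ℝ → ℝ := fun h => Λ * f2 (Λ * f1 (max h 0)) with hg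
  have hcg : Continuous g := by
    have c1 := s1.cf; have c2 := s2.cf
    fun_prop
  have hg0 : ∀ h, 0 ≤ g h := fun h => mul_nonneg hΛ.le (s2.bf (mul_nonneg hΛ.le (s1.bf (le_max_right _ _)).1)).1
  have hgK : ∀ h, g h ≤ Λ * K ^ 2 := fun h => mul_le_mul_of_nonneg_left (s2.bf (mul_nonneg hΛ.le (s1.bf (le_max_right _ _)).1)).2 hΛ.le
  have hgm : Monotone g := by
    intro a b hab
    refine mul_le_mul_of_nonneg_left (s2.mf (mul_nonneg hΛ.le (s1.bf (le_max_right _ _)).1) ?_) hΛ.le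
    exact mul_le_mul_of_nonneg_left (s1.mf (le_max_right _ _) (max_le_max hab le_rfl)) hΛ.le
  have wg : ∀ h, 0 ≤ h → w h ≤ w (g h) := by
    intro h hh
    have e : g h = Λ * f2 (Λ * f1 h) := by simp only [hg, max_eq_left hh]
    have h1 := step (f1 h) (s1.bf hh).1 (g h) e
    have h2 := s1.tan hh (hg0 h)
    simp only [hw] at h1 ⊢
    linarith
  set h0 := Λ * f2 (Λ * a1) with hh0
  have h0n : 0 ≤ h0 := mul_nonneg hΛ.le (s2.bf (mul_nonneg hΛ.le ha1)).1
  have hit : ∀ k, 0 ≤ g^[k] h0 := by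
    intro k; cases k with
    | zero => simpa using h0n
    | succ k => rw [Function.iterate_succ_apply']; exact hg0 _
  have hitb : ∀ k, g^[k] h0 ≤ max h0 (Λ * K ^ 2) := by
    intro k; cases k with
    | zero => simp
    | succ k => rw [Function.iterate_succ_apply']; exact (hgK _).trans (le_max_right _ _)
  have hwit : ∀ k, w h0 ≤ w (g^[k] h0) := by
    intro k; induction k with
    | zero => simp
    | succ k ih => rw [Function.iterate_succ_apply']; exact ih.trans (wg _ (hit k))
  obtain ⟨l, hl⟩ : ∃ l, Tendsto (fun k => g^[k] h0) atTop (𝓝 l) := by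
    rcases le_total h0 (g h0) with h | h
    · exact ⟨_, tendsto_atTop_ciSup (hgm.monotone_iterate_of_le_map h) ⟨max h0 (Λ * K ^ 2), by rintro _ ⟨k, rfl⟩; exact hitb k⟩⟩
    · exact ⟨_, tendsto_atTop_ciInf (hgm.antitone_iterate_of_map_le h) ⟨0, by rintro _ ⟨k, rfl⟩; exact hit k⟩⟩
  have hl0 : 0 ≤ l := ge_of_tendsto' hl hit
  have hfix : g l = l := isFixedPt_of_tendsto_iterate hl hcg.continuousAt
  have hwl : w h0 ≤ w l := ge_of_tendsto' ((hcw.tendsto l).comp hl) hwit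
  have hfix' : Λ * f2 (Λ * f1 l) = l := by simpa only [hg, max_eq_left hl0] using hfix
  have el : Λ * (l / Λ) = l := by field_simp
  refine ⟨h0, h0n, l / Λ, f1 l, by positivity, (s1.bf hl0).1, by rw [el], ?_, ?_⟩
  · rw [div_eq_iff hΛ.ne']; linarith
  · rw [el]
    have := step a1 ha1 h0 hh0
    have e : Λ / 2 * (l / Λ) * f1 l = 1 / 2 * f1 l * l := by field_simp
    rw [e]
    simp only [hw] at this hwl
    linarith
end SysSeq

end Part16

section Part17

/-- Abstract fixed point set. -/
def GG (f1 f2 : ℝ → ℝ) (l : ℝ) : Set (ℝ × ℝ) :=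
  {q | 0 ≤ q.1 ∧ 0 ≤ q.2 ∧ q.2 = f1 (l * q.1) ∧ q.1 = f2 (l * q.2)}
/-- Abstract potential. -/
def rr (ψ1 ψ2 : ℝ → ℝ) (l : ℝ) (q : ℝ × ℝ) : ℝ := ψ1 (l * q.1) + ψ2 (l * q.2) - l / 2 * q.1 * q.2
/-- Abstract maximizers. -/
def IsM (ψ1 ψ2 f1 f2 : ℝ → ℝ) (l : ℝ) (q : ℝ × ℝ) : Prop :=
  q ∈ GG f1 f2 l ∧ ∀ q' ∈ GG f1 f2 l, rr ψ1 ψ2 l q' ≤ rr ψ1 ψ2 l q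

namespace SysSeq
variable {K : ℝ} {ψ1 ψ2 f1 f2 : ℝ → ℝ} {F T A1 A2 : ℕ → ℝ → ℝ → ℝ → ℝ}

theorem GG_sub (s1 : Sc K ψ1 f1) (s2 : Sc K ψ2 f2) {l : ℝ} (hl : 0 < l) : GG f1 f2 l ⊆ Set.Icc ((0:ℝ), (0:ℝ)) (K ^ 2, K ^ 2) := by
  rintro q ⟨h1, h2, h3, h4⟩
  refine ⟨⟨h1, h2⟩, ?_, ?_⟩
  · show q.1 ≤ K ^ 2
    rw [h4]; exact (s2.bf (mul_nonneg hl.le h2)).2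
  · show q.2 ≤ K ^ 2
    rw [h3]; exact (s1.bf (mul_nonneg hl.le h1)).2

theorem exists_max (s1 : Sc K ψ1 f1) (s2 : Sc K ψ2 f2) {l : ℝ} (hl : 0 < l) : ∃ q, IsM ψ1 ψ2 f1 f2 l q := by
  have c1 := s1.cψ; have c2 := s1.cf; have c3 := s2.cψ; have c4 := s2.cf
  have hc : IsClosed (GG f1 f2 l) := by
    have h1 : IsClosed {q : ℝ × ℝ | 0 ≤ q.1} := isClosed_le continuous_const continuous_fst
    have h2 : IsClosed {q : ℝ × ℝ | 0 ≤ q.2} := isClosed_le continuous_const continuous_snd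
    have h3 : IsClosed {q : ℝ × ℝ | q.2 = f1 (l * q.1)} := isClosed_eq (by fun_prop) (by fun_prop)
    have h4 : IsClosed {q : ℝ × ℝ | q.1 = f2 (l * q.2)} := isClosed_eq (by fun_prop) (by fun_prop)
    exact h1.inter (h2.inter (h3.inter h4))
  have hk : IsCompact (GG f1 f2 l) := isCompact_Icc.of_isClosed_subset hc (GG_sub s1 s2 hl)
  have hne : (GG f1 f2 l).Nonempty := by
    obtain ⟨h, hh, q1, q2, a, b, c, d, e⟩ := fixpt s1 s2 hl le_rfl
    exact ⟨(q1, q2), a, b, c, d⟩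
  have hcr : Continuous (rr ψ1 ψ2 l) := by unfold rr; fun_prop
  obtain ⟨q, hq, hm⟩ := hk.exists_isMaxOn hne hcr.continuousOn
  exact ⟨q, hq, fun q' hq' => hm hq'⟩

theorem tend (s : SysSeq K ψ1 ψ2 F T A1 A2) (s1 : Sc K ψ1 f1) (s2 : Sc K ψ2 f2) {l : ℝ} (hl : 0 < l) {q} (hq : IsM ψ1 ψ2 f1 f2 l q) :
    Tendsto (fun n => F n l 0 0) atTop (𝓝 (rr ψ1 ψ2 l q)) := by
  rw [Metric.tendsto_atTop']
  intro ε hε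
  obtain ⟨⟨p1, p2, p3, p4⟩, hm⟩ := hq
  have hlo := s.lower s1 s2 (mul_nonneg hl.le p1) (mul_nonneg hl.le p2) hl (half_pos hε)
  have hup := s.upper hl (half_pos hε)
  rw [← p3, ← p4] at hlo
  obtain ⟨N, hN⟩ := eventually_atTop.1 (hlo.and hup)
  refine ⟨N, fun n hn => ?_⟩
  obtain ⟨h1, a1, a2, b1, b2, b3, b4, h2⟩ := hN n hn.le
  obtain ⟨h, hh, q1, q2, a, b, c, d, e⟩ := fixpt s1 s2 hl b1
  have h3 := h2 h (l * a1) hh (mul_nonneg hl.le b1)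
  have h4 := hm (q1, q2) ⟨a, b, c, d⟩
  rw [Real.dist_eq, abs_lt]
  unfold rr at h4 ⊢
  simp only at h4
  constructor <;> linarith

theorem subgrad (s : SysSeq K ψ1 ψ2 F T A1 A2) (s1 : Sc K ψ1 f1) (s2 : Sc K ψ2 f2) {l m : ℝ} (hl : 0 < l) (hm : 0 < m) {q p} (hq : q ∈ GG f1 f2 l)
    (hp : IsM ψ1 ψ2 f1 f2 m p) : rr ψ1 ψ2 l q + (m - l) / 2 * (q.1 * q.2) ≤ rr ψ1 ψ2 m p := by
  refine le_of_forall_pos_sub_le fun η hη => ?_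
  obtain ⟨p1, p2, p3, p4⟩ := hq
  have hlo := s.lower s1 s2 (mul_nonneg hl.le p1) (mul_nonneg hl.le p2) hm hη
  rw [← p3, ← p4] at hlo
  refine ge_of_tendsto (s.tend s1 s2 hm hp) ?_
  filter_upwards [hlo] with n hn
  unfold rr
  linarith

theorem prod_inj (s1 : Sc K ψ1 f1) (s2 : Sc K ψ2 f2) {l : ℝ} (hl : 0 < l) {q p} (hq : q ∈ GG f1 f2 l) (hp : p ∈ GG f1 f2 l)
    (h : q.1 * q.2 = p.1 * p.2) : q = p := by
  have aux : ∀ {q p : ℝ × ℝ}, q ∈ GG f1 f2 l → p ∈ GG f1 f2 l → q.1 * q.2 = p.1 * p.2 → ¬ q.1 < p.1 := by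
    rintro q p ⟨a1, a2, a3, a4⟩ ⟨b1, b2, b3, b4⟩ h hlt
    have hp0 : 0 < p.1 := lt_of_le_of_lt a1 hlt
    have h1 : 0 < p.2 := by rw [b3]; exact s1.pf (mul_pos hl hp0)
    have h2 : q.2 ≤ p.2 := by rw [a3, b3]; exact s1.mf (mul_nonneg hl.le a1) (mul_le_mul_of_nonneg_left hlt.le hl.le)
    have : q.1 * q.2 ≤ q.1 * p.2 := mul_le_mul_of_nonneg_left h2 a1
    have : q.1 * p.2 < p.1 * p.2 := mul_lt_mul_of_pos_right hlt h1
    linarith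
  have e : q.1 = p.1 := le_antisymm (not_lt.1 (aux hp hq h.symm)) (not_lt.1 (aux hq hp h))
  have e2 : q.2 = p.2 := by rw [hq.2.2.1, hp.2.2.1, e]
  exact Prod.ext e e2

theorem countable_bad (s : SysSeq K ψ1 ψ2 F T A1 A2) (s1 : Sc K ψ1 f1) (s2 : Sc K ψ2 f2) :
    (Set.Ioi (0:ℝ) \ {l | 0 < l ∧ ∃! q, IsM ψ1 ψ2 f1 f2 l q}).Countable := by
  set B := Set.Ioi (0:ℝ) \ {l | 0 < l ∧ ∃! q, IsM ψ1 ψ2 f1 f2 l q}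
  have hex : ∀ l ∈ B, ∃ q p, IsM ψ1 ψ2 f1 f2 l q ∧ IsM ψ1 ψ2 f1 f2 l p ∧ q.1 * q.2 < p.1 * p.2 := by
    rintro l ⟨hl, hn⟩
    have hl : 0 < l := hl
    obtain ⟨q, hq⟩ := exists_max s1 s2 hl
    have : ∃ p, IsM ψ1 ψ2 f1 f2 l p ∧ p ≠ q := by
      by_contra hc
      push Not at hc
      exact hn ⟨hl, q, hq, hc⟩
    obtain ⟨p, hp, hpq⟩ := this
    have hne : p.1 * p.2 ≠ q.1 * q.2 := fun h => hpq (prod_inj s1 s2 hl hp.1 hq.1 h)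
    rcases lt_or_gt_of_ne hne with h | h
    · exact ⟨p, q, hp, hq, h⟩
    · exact ⟨q, p, hq, hp, h⟩
  choose! q p hq hp hlt using hex
  have key : ∀ l ∈ B, ∀ m ∈ B, l < m → (p l).1 * (p l).2 ≤ (q m).1 * (q m).2 := by
    intro l hl m hm hlm
    have hl0 : 0 < l := hl.1
    have hm0 : 0 < m := hm.1
    have e1 := s.subgrad s1 s2 hl0 hm0 (hp l hl).1 (hq m hm)
    have e2 := s.subgrad s1 s2 hm0 hl0 (hq m hm).1 (hp l hl)
    by_contra hc
    push Not at hc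
    nlinarith
  refine Set.PairwiseDisjoint.countable_of_isOpen (s := fun l => Set.Ioo ((q l).1 * (q l).2) ((p l).1 * (p l).2)) ?_ (fun l hl => isOpen_Ioo) (fun l hl => Set.nonempty_Ioo.2 (hlt l hl))
  intro l hl m hm hne
  show Disjoint _ _
  rw [Set.disjoint_left]
  intro x hx hx'
  rcases lt_or_gt_of_ne hne with h | h
  · have := key l hl m hm h; have := hx.2; have := hx'.1; linarith
  · have := key m hm l hl h; have := hx.1; have := hx'.2; linarith

theorem closedgraph (s : SysSeq K ψ1 ψ2 F T A1 A2) (s1 : Sc K ψ1 f1) (s2 : Sc K ψ2 f2) {l : ℝ} (hl : 0 < l) {q}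
    (hq : IsM ψ1 ψ2 f1 f2 l q) (hu : ∀ p, IsM ψ1 ψ2 f1 f2 l p → p = q) (μ : ℕ → ℝ) (hμ : ∀ k, 0 < μ k) (hμl : Tendsto μ atTop (𝓝 l))
    {η : ℝ} (hη : 0 < η) : ∃ k p, IsM ψ1 ψ2 f1 f2 (μ k) p ∧ |p.1 * p.2 - q.1 * q.2| < η := by
  choose p hp using fun k => exists_max s1 s2 (hμ k)
  have c1 := s1.cψ; have c2 := s1.cf; have c3 := s2.cψ; have c4 := s2.cf
  obtain ⟨r, hr, σ, hσ, hlim⟩ := (isCompact_Icc : IsCompact (Set.Icc ((0:ℝ), (0:ℝ)) (K ^ 2, K ^ 2))).tendsto_subseq (x := p) fun k => GG_sub s1 s2 (hμ k) (hp k).1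
  have hμσ : Tendsto (fun k => μ (σ k)) atTop (𝓝 l) := hμl.comp hσ.tendsto_atTop
  have hlim' : Tendsto (fun k => p (σ k)) atTop (𝓝 r) := hlim
  have l1 : Tendsto (fun k => (p (σ k)).1) atTop (𝓝 r.1) := (continuous_fst.tendsto r).comp hlim'
  have l2 : Tendsto (fun k => (p (σ k)).2) atTop (𝓝 r.2) := (continuous_snd.tendsto r).comp hlim'
  have hrG : r ∈ GG f1 f2 l := by
    refine ⟨hr.1.1, hr.1.2, ?_, ?_⟩
    · refine tendsto_nhds_unique l2 ?_
      have := (c2.tendsto _).comp (hμσ.mul l1)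
      refine this.congr fun k => ?_
      exact ((hp (σ k)).1.2.2.1).symm
    · refine tendsto_nhds_unique l1 ?_
      have := (c4.tendsto _).comp (hμσ.mul l2)
      refine this.congr fun k => ?_
      exact ((hp (σ k)).1.2.2.2).symm
  have hrr : Tendsto (fun k => rr ψ1 ψ2 (μ (σ k)) (p (σ k))) atTop (𝓝 (rr ψ1 ψ2 l r)) := by
    unfold rr
    exact (((c1.tendsto _).comp (hμσ.mul l1)).add ((c3.tendsto _).comp (hμσ.mul l2))).sub (((hμσ.div_const 2).mul l1).mul l2)
  have hge : rr ψ1 ψ2 l q ≤ rr ψ1 ψ2 l r := by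
    have h1 : Tendsto (fun k => rr ψ1 ψ2 l q + (μ (σ k) - l) / 2 * (q.1 * q.2)) atTop (𝓝 (rr ψ1 ψ2 l q + (l - l) / 2 * (q.1 * q.2))) :=
      (((hμσ.sub_const l).div_const 2).mul_const _).const_add _
    simp only [sub_self, zero_div, zero_mul, add_zero] at h1
    exact le_of_tendsto_of_tendsto' h1 hrr fun k => s.subgrad s1 s2 hl (hμ _) hq.1 (hp _)
  have hrq : r = q := hu r ⟨hrG, fun q' hq' => (hq.2 q' hq').trans hge⟩
  have hprod := l1.mul l2
  rw [hrq] at hprod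
  obtain ⟨k, hk⟩ := ((Metric.tendsto_nhds.1 hprod) η hη).exists
  exact ⟨σ k, p (σ k), hp _, by rwa [Real.dist_eq] at hk⟩

theorem T_tend (s : SysSeq K ψ1 ψ2 F T A1 A2) (s1 : Sc K ψ1 f1) (s2 : Sc K ψ2 f2) {l : ℝ} (hl : 0 < l) {q}
    (hq : IsM ψ1 ψ2 f1 f2 l q) (hu : ∀ p, IsM ψ1 ψ2 f1 f2 l p → p = q) :
    Tendsto (fun n => T n l 0 0) atTop (𝓝 (q.1 * q.2)) := by
  have hz : Tendsto (fun k : ℕ => 1 / ((k : ℝ) + 1)) atTop (𝓝 0) := tendsto_one_div_add_atTop_nhds_zero_nat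
  have ev : ∀ m p η, 0 < m → m ≠ l → 0 < η → IsM ψ1 ψ2 f1 f2 m p → ∀ᶠ n in atTop, (m - l) * T n l 0 0 ≤ (m - l) * (p.1 * p.2) + |m - l| * η := by
    intro m p η hm hne hη hp
    have hab : 0 < |m - l| := abs_pos.2 (sub_ne_zero.2 hne)
    have t1 := (s.tend s1 s2 hm hp).sub (s.tend s1 s2 hl hq)
    have h1 := s.subgrad s1 s2 hm hl hp.1 hq
    have hlt : rr ψ1 ψ2 m p - rr ψ1 ψ2 l q < (m - l) / 2 * (p.1 * p.2) + |m - l| * η / 2 := by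
      have := mul_pos hab hη
      linarith
    filter_upwards [t1.eventually_lt_const hlt, eventually_ge_atTop 1] with n hn hn1
    have ht := (s.sys n hn1).tan hl.le le_rfl le_rfl hm.le (le_refl (0:ℝ)) (le_refl (0:ℝ))
    simp only [sub_self, zero_mul, add_zero] at ht
    linarith
  rw [Metric.tendsto_nhds]
  intro η hη
  -- from above
  obtain ⟨k, p, hp, hpe⟩ := s.closedgraph s1 s2 hl hq hu (fun k => l + 1 / ((k : ℝ) + 1)) (fun k => by positivity)
    (by simpa using hz.const_add l) (half_pos hη)
  obtain ⟨k', p', hp', hpe'⟩ := s.closedgraph s1 s2 hl hq hu (fun k => l - l / 2 * (1 / ((k : ℝ) + 1)))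
    (fun k => by
      have : 1 / ((k : ℝ) + 1) ≤ 1 := by rw [div_le_one (by positivity)]; linarith [(Nat.cast_nonneg k : (0:ℝ) ≤ k)]
      nlinarith)
    (by simpa using (hz.const_mul (l / 2)).const_sub l) (half_pos hη)
  have hd : 0 < 1 / ((k : ℝ) + 1) := by positivity
  have hd' : 0 < l / 2 * (1 / ((k' : ℝ) + 1)) := by positivity
  have hd1 : l / 2 * (1 / ((k' : ℝ) + 1)) ≤ l / 2 := by
    have : 1 / ((k' : ℝ) + 1) ≤ 1 := by rw [div_le_one (by positivity)]; linarith [(Nat.cast_nonneg k' : (0:ℝ) ≤ k')]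
    nlinarith
  have e1 := ev _ p (η / 2) (by positivity) (by linarith) (half_pos hη) hp
  have e2 := ev _ p' (η / 2) (by linarith) (by linarith) (half_pos hη) hp'
  filter_upwards [e1, e2] with n h1 h2
  have s1' : l + 1 / ((k : ℝ) + 1) - l = 1 / ((k : ℝ) + 1) := by ring
  have s2' : l - l / 2 * (1 / ((k' : ℝ) + 1)) - l = - (l / 2 * (1 / ((k' : ℝ) + 1))) := by ring
  rw [s1', abs_of_pos hd, ← mul_add] at h1
  rw [s2', abs_neg, abs_of_pos hd'] at h2
  have h1' := le_of_mul_le_mul_left h1 hd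
  have h2' : p'.1 * p'.2 ≤ T n l 0 0 + η / 2 := by
    refine le_of_mul_le_mul_left ?_ hd'
    linarith
  rw [abs_lt] at hpe hpe'
  rw [Real.dist_eq, abs_lt]
  constructor <;> linarith
end SysSeq

end Part17

section Part18

section inst
variable {n : ℕ} {K : ℝ} {S : Finset ℝ} {PU PV : Measure ℝ} [IsProbabilityMeasure PU] [IsProbabilityMeasure PV]

theorem errc_small {b C δ ε : ℝ} (hb : 0 < b) (hδ : 0 < δ) (hε : 0 < ε) :
    ∃ α β, 0 < α ∧ 0 < β ∧ ∀ᶠ n : ℕ in atTop, errc b C δ α β n ≤ ε := by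
  obtain ⟨β, hβ, hβ'⟩ : ∃ β : ℝ, 0 < β ∧ b / 2 * (β * δ) = ε / 2 := ⟨ε / (b * δ), by positivity, by field_simp⟩
  obtain ⟨α, hα, hα'⟩ : ∃ α : ℝ, 0 < α ∧ b / 2 * (1 / β * (6 * α * b + δ * (3 * α * b ^ 2))) = ε / 4 :=
    ⟨(ε / 4) / (b / 2 * (1 / β * (6 * b + δ * (3 * b ^ 2)))), by positivity, by field_simp⟩
  refine ⟨α, β, hα, hβ, ?_⟩
  have hz : Tendsto (fun n : ℕ => 1 / (n : ℝ)) atTop (𝓝 0) := tendsto_one_div_atTop_nhds_zero_nat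
  have hlim : Tendsto (fun n : ℕ => b / 2 * (β * δ + 1 / β * (6 * α * b + (1 + 3 / α) * b * (1 / (n:ℝ))
    + δ * (3 * α * b ^ 2 + b ^ 2 * C / (2 * α ^ 2) * (1 / (n:ℝ)) + b ^ 2 / α * (1 / (n:ℝ)))))) atTop
    (𝓝 (b / 2 * (β * δ + 1 / β * (6 * α * b + (1 + 3 / α) * b * 0
    + δ * (3 * α * b ^ 2 + b ^ 2 * C / (2 * α ^ 2) * 0 + b ^ 2 / α * 0))))) := by
    have h1 : ∀ c : ℝ, Tendsto (fun n : ℕ => c * (1 / (n : ℝ))) atTop (𝓝 (c * 0)) := fun c => hz.const_mul c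
    exact ((((((h1 _).const_add _).add ((((h1 _).const_add _).add (h1 _)).const_mul _))).const_mul _).const_add _).const_mul _
  have hlt : b / 2 * (β * δ + 1 / β * (6 * α * b + (1 + 3 / α) * b * 0
    + δ * (3 * α * b ^ 2 + b ^ 2 * C / (2 * α ^ 2) * 0 + b ^ 2 / α * 0))) < ε := by
    have : b / 2 * (β * δ + 1 / β * (6 * α * b + (1 + 3 / α) * b * 0
    + δ * (3 * α * b ^ 2 + b ^ 2 * C / (2 * α ^ 2) * 0 + b ^ 2 / α * 0))) = ε / 2 + ε / 4 := by
      rw [← hβ', ← hα']; ring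
    rw [this]; linarith
  filter_upwards [hlim.eventually_lt_const hlt, eventually_ge_atTop 1] with n hn hn1
  have hn0 : (0:ℝ) < n := by exact_mod_cast hn1
  refine le_of_eq_of_le ?_ hn.le
  unfold errc
  congr 3
  congr 2
  · field_simp
  · congr 2
    · field_simp
    · field_simp

/-- the functions of the system -/
def sF (h : Std K S PU PV) (n : ℕ) (t h1 h2 : ℝ) : ℝ := (mdl n h).nF (t / n) h1 h2
def sT (h : Std K S PU PV) (n : ℕ) (t h1 h2 : ℝ) : ℝ := (mdl n h).nT (t / n) h1 h2
def sA1 (h : Std K S PU PV) (n : ℕ) (t h1 h2 : ℝ) : ℝ := (mdl n h).nA1 (t / n) h1 h2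
def sA2 (h : Std K S PU PV) (n : ℕ) (t h1 h2 : ℝ) : ℝ := (mdl n h).nA2 (t / n) h1 h2

theorem sum_ch (h : Std K S PU PV) (hn : 1 ≤ n) (t h1 h2 dt d1 d2 : ℝ) :
    ∑ a, snr (Fin n) (dt / n) d1 d2 a * ((mdl n h).Q (fun k => (mdl n h).x k a) (snr (Fin n) (t / n) h1 h2) / 2)
      = (n : ℝ) * (1 / 2 * (dt * sT h n t h1 h2 + d1 * sA1 h n t h1 h2 + d2 * sA2 h n t h1 h2)) := by
  have hn0 : (0:ℝ) < n := by exact_mod_cast hn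
  unfold sT sA1 sA2 FinModel.nT FinModel.nA1 FinModel.nA2
  rw [FinModel.EE_Tt, FinModel.EE_Nn, FinModel.EE_Nv, Fintype.sum_sum_type, Fintype.sum_sum_type, Fintype.sum_prod_type]
  simp only [snr, Sum.elim_inl, Sum.elim_inr, FinModel.uc, FinModel.vc]
  simp only [← Finset.mul_sum, ← Finset.sum_div, Fintype.card_fin]
  have e : ∀ i j : Fin n, (fun k => (mdl n h).x k (Sum.inl (i, j))) = fun k => (mdl n h).x k (Sum.inr (Sum.inl i)) * (mdl n h).x k (Sum.inr (Sum.inr j)) := fun i j => rfl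
  simp only [e]
  field_simp
  ring

theorem sysn (h : Std K S PU PV) (hn : 1 ≤ n) : Sys K (sF h n) (sT h n) (sA1 h n) (sA2 h n) := by
  have hn0 : (0:ℝ) < n := by exact_mod_cast hn
  have hu : ∀ k i, |(mdl n h).x k (FinModel.uc i)| ≤ K := fun k i => mdl_bd h k (FinModel.uc i)
  have hv : ∀ k i, |(mdl n h).x k (FinModel.vc i)| ≤ K := fun k i => mdl_bd h k (FinModel.vc i)
  have cdiv : Continuous fun p : ℝ × ℝ × ℝ => ((p.1 / n, p.2.1, p.2.2) : ℝ × ℝ × ℝ) := by fun_prop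
  have hK0 : 0 ≤ K := by linarith [h.hK]
  have nn : ∀ {t h1 h2 : ℝ}, 0 ≤ t → 0 ≤ h1 → 0 ≤ h2 → ∀ a, 0 ≤ snr (Fin n) (t / n) h1 h2 a := fun ht h1 h2 a => FinModel.snr_nonneg (by positivity) h1 h2 a
  refine ⟨h.hK, ?_, ?_, ?_, ?_, ?_, ?_, ?_, ?_, ?_, ?_, ?_⟩
  · have h3 := (mdl n h).continuous_nF.comp cdiv; simp only [Function.comp_def] at h3; exact h3
  · have h3 := (mdl n h).continuous_nT.comp cdiv; simp only [Function.comp_def] at h3; exact h3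
  · have h3 := (mdl n h).continuous_nA1.comp cdiv; simp only [Function.comp_def] at h3; exact h3
  · have h3 := (mdl n h).continuous_nA2.comp cdiv; simp only [Function.comp_def] at h3; exact h3
  · intro t h1 h2 ht hh1 hh2
    unfold sT FinModel.nT
    rw [FinModel.EE_Tt]
    refine ⟨div_nonneg (Finset.sum_nonneg fun i _ => Finset.sum_nonneg fun j _ => FinModel.Q_nonneg _ _ _) (by positivity), ?_⟩
    rw [Fintype.card_fin, div_le_iff₀ (by positivity)]
    calc _ ≤ ∑ i : Fin n, ∑ j : Fin n, (K * K) ^ 2 := Finset.sum_le_sum fun i _ => Finset.sum_le_sum fun j _ =>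
            (mdl n h).Q_le (fun k => by rw [abs_mul]; exact mul_le_mul (hu k i) (hv k j) (abs_nonneg _) hK0) _ (nn ht hh1 hh2)
      _ = _ := by simp; ring
  · intro t h1 h2 ht hh1 hh2
    unfold sA1 FinModel.nA1
    rw [FinModel.EE_Nn]
    refine ⟨div_nonneg (Finset.sum_nonneg fun i _ => FinModel.Q_nonneg _ _ _) (by positivity), ?_⟩
    rw [Fintype.card_fin, div_le_iff₀ (by positivity)]
    calc _ ≤ ∑ i : Fin n, K ^ 2 := Finset.sum_le_sum fun i _ => (mdl n h).Q_le (fun k => hu k i) _ (nn ht hh1 hh2)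
      _ = _ := by simp; ring
  · intro t h1 h2 ht hh1 hh2
    unfold sA2 FinModel.nA2
    rw [FinModel.EE_Nv]
    refine ⟨div_nonneg (Finset.sum_nonneg fun i _ => FinModel.Q_nonneg _ _ _) (by positivity), ?_⟩
    rw [Fintype.card_fin, div_le_iff₀ (by positivity)]
    calc _ ≤ ∑ i : Fin n, K ^ 2 := Finset.sum_le_sum fun i _ => (mdl n h).Q_le (fun k => hv k i) _ (nn ht hh1 hh2)
      _ = _ := by simp; ring
  · intro t h1 h2 ht hh1 hh2 dt d1 d2
    have hl : ∀ τ : ℝ, (fun a => snr (Fin n) (t / n) h1 h2 a + τ * snr (Fin n) (dt / n) d1 d2 a) = snr (Fin n) ((t + τ * dt) / n) (h1 + τ * d1) (h2 + τ * d2) := by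
      intro τ
      ext a; rcases a with a | a | a <;> simp [snr]; ring
    have key := (mdl n h).hasDerivAt_Fr (snr (Fin n) (t / n) h1 h2) (snr (Fin n) (dt / n) d1 d2) 0 (by
      intro a; right
      rcases a with a | a | a <;> simp [snr, hh1, hh2]; positivity)
    have e0 : (fun a => snr (Fin n) (t / n) h1 h2 a + 0 * snr (Fin n) (dt / n) d1 d2 a) = snr (Fin n) (t / n) h1 h2 := by ext a; simp
    rw [e0, sum_ch h hn] at key
    simp only [hl] at key
    have k2 := key.div_const (n : ℝ)
    rw [mul_div_cancel_left₀ _ hn0.ne'] at k2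
    simp only [sF, FinModel.nF, Fintype.card_fin]
    exact k2
  · intro t h1 h2 t' h1' h2' ht hh1 hh2 ht' hh1' hh2'
    have key := (mdl n h).Fr_tangent (nn ht hh1 hh2) (nn ht' hh1' hh2')
    have e : ∀ a, snr (Fin n) (t' / n) h1' h2' a - snr (Fin n) (t / n) h1 h2 a = snr (Fin n) ((t' - t) / n) (h1' - h1) (h2' - h2) a := by
      intro a; rcases a with a | a | a <;> simp [snr]; ring
    simp only [e] at key
    rw [sum_ch h hn] at key
    simp only [sF, FinModel.nF, Fintype.card_fin]
    rw [div_add' _ _ _ hn0.ne', div_le_div_iff_of_pos_right hn0, mul_comm _ (n : ℝ)]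
    exact key
  · intro t h1 h1' h2 ht hh1 hh2 hle
    unfold sA1 FinModel.nA1
    rw [FinModel.EE_Nn, FinModel.EE_Nn]
    refine div_le_div_of_nonneg_right (Finset.sum_le_sum fun i _ => (mdl n h).Q_mono _ (nn ht hh1 hh2) ?_) (by positivity)
    intro a; rcases a with a | a | a <;> simp [snr, hle]
  · intro t h1 h1' h2 ht hh1 hh2 hle
    unfold sA2 FinModel.nA2
    rw [FinModel.EE_Nv, FinModel.EE_Nv]
    refine div_le_div_of_nonneg_right (Finset.sum_le_sum fun i _ => (mdl n h).Q_mono _ (nn ht hh1 hh2) ?_) (by positivity)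
    intro a; rcases a with a | a | a <;> simp [snr, hle]

theorem sdec (h : Std K S PU PV) (R δ ε : ℝ) (hR : 0 < R) (hδ : 0 < δ) (hε : 0 < ε) :
    ∀ᶠ n in atTop, ∀ t ∈ Set.Icc 0 R, ∀ h1 ∈ Set.Icc δ R, ∀ h2 ∈ Set.Icc 0 R,
      ∫ x in (0:ℝ)..δ, |sT h n t (h1 + x) h2 - sA1 h n t (h1 + x) h2 * sA2 h n t (h1 + x) h2| ≤ ε := by
  have hK0 : 0 < K := by linarith [h.hK]
  set R' := R + δ with hR'
  set C := R' * K ^ 4 + (2 * R') * K ^ 2 + ((R' * K ^ 3 + R' * K) ^ 2 + (R' * K ^ 3 + R' * K) ^ 2) * K ^ 2 with hC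
  obtain ⟨α, β, hα, hβ, hev⟩ := errc_small (b := K ^ 2) (C := C) (by positivity) hδ hε
  filter_upwards [hev, eventually_ge_atTop 1] with n hn hn1 t ht h1 hh1 h2 hh2
  have hn0 : (0:ℝ) < n := by exact_mod_cast hn1
  have hu : ∀ k i, |(mdl n h).x k (FinModel.uc i)| ≤ K := fun k i => mdl_bd h k (FinModel.uc i)
  have hv : ∀ k i, |(mdl n h).x k (FinModel.vc i)| ≤ K := fun k i => mdl_bd h k (FinModel.vc i)
  have ht0 := ht.1
  have ht1 := ht.2
  have p1 := hh1.1
  have p2 := hh1.2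
  have p3 := hh2.1
  have p4 := hh2.2
  have key := (mdl n h).decouple hu hv (n := n) (by simp) hn0 (t := t / n) (h2 := h2) (h := h1) (h' := h1 + δ) (C := C) (by positivity) p3 (by linarith) (by linarith) hα hβ ?_
  · rw [add_sub_cancel_left] at key
    have e := intervalIntegral.integral_comp_add_left (a := 0) (b := δ) (fun x => |sT h n t x h2 - sA1 h n t x h2 * sA2 h n t x h2|) h1
    rw [add_zero] at e
    rw [e]
    exact key.trans hn
  · intro τ hτ
    have q0 : 0 ≤ τ := by linarith [hτ.1]
    have q1 : τ ≤ R' := by linarith [hτ.2]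
    refine (var_bound h (by positivity) q0 p3).trans ?_
    have e1 : (n:ℝ) * (t / n) = t := by field_simp
    have e2 : (n:ℝ) ^ 2 * (t / n) = n * t := by field_simp
    rw [e1, e2]
    calc _ = ((t * K ^ 4 + (τ + h2) * K ^ 2) + ((t * K ^ 3 + τ * K) ^ 2 + (t * K ^ 3 + h2 * K) ^ 2) * K ^ 2) * n := by ring
      _ ≤ ((R' * K ^ 4 + (2 * R') * K ^ 2) + ((R' * K ^ 3 + R' * K) ^ 2 + (R' * K ^ 3 + R' * K) ^ 2) * K ^ 2) * n := by
        gcongr <;> linarith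
      _ = _ := by rw [hC]
end inst

end Part18

section Part19

theorem integrable_prod_fin {X Y : Type*} [MeasurableSpace X] [MeasurableSpace Y] [MeasurableSingletonClass X] (μ : Measure X) [IsProbabilityMeasure μ]
    (ν : Measure Y) [IsProbabilityMeasure ν]
    (T : Finset X) (hT : μ ((↑T : Set X)ᶜ) = 0) (g : X × Y → ℝ) (hg : ∀ x ∈ T, Integrable (fun y => g (x, y)) ν) :
    Integrable g (μ.prod ν) := by
  have hr : μ.restrict (↑T : Set X) = μ := Measure.restrict_eq_self_of_ae_mem (by
    rw [ae_iff]; exact hT)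
  have h1 : IntegrableOn g ((⋃ x ∈ T, {x}) ×ˢ (Set.univ : Set Y)) (μ.prod ν) := by
    rw [Set.iUnion₂_prod_const]
    refine (integrableOn_finset_iUnion (t := fun x => ({x} : Set X) ×ˢ (Set.univ : Set Y))).2 fun x hx => ?_
    rw [IntegrableOn, ← Measure.prod_restrict, Measure.restrict_univ, Measure.restrict_singleton, Measure.prod_smul_left, Measure.dirac_prod]
    refine Integrable.smul_measure ?_ (measure_ne_top _ _)
    exact ((MeasurableEmbedding.id (α := Y)).prodMk_left x).integrable_map_iff.2 (hg x hx)
  have h2 : (⋃ x ∈ T, ({x} : Set X)) = ↑T := by ext; simp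
  rw [h2, IntegrableOn, ← Measure.prod_restrict, hr, Measure.restrict_univ] at h1
  exact h1

namespace FinModel
section gen
variable {κ A : Type*} [Fintype κ] (M : FinModel κ A) [Fintype A]

theorem Ok.shift {X : (A → ℝ) → ℝ} (hX : Ok X) (b : A → ℝ) : Ok fun z => X (z + b) := by
  refine ⟨hX.1.comp (by fun_prop), ?_⟩
  obtain ⟨C, hC, h⟩ := hX.2
  have hb : 0 ≤ ∑ a, |b a| := Finset.sum_nonneg fun _ _ => abs_nonneg _
  refine ⟨C * (1 + ∑ a, |b a|), by positivity, fun p hp z => (h p hp _).trans (exp_le_exp.2 ?_)⟩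
  rw [mul_assoc]
  refine mul_le_mul_of_nonneg_left ?_ hC
  have h1 : ∑ a, |(z + b) a| ≤ ∑ a, |z a| + ∑ a, |b a| := by
    rw [← Finset.sum_add_distrib]; exact Finset.sum_le_sum fun a _ => abs_add_le _ _
  have hz : 0 ≤ ∑ a, |z a| := Finset.sum_nonneg fun _ _ => abs_nonneg _
  nlinarith [mul_nonneg hb hz]

theorem EE_av (s : A → ℝ) (hs : ∀ a, 0 ≤ s a) (f : κ → ℝ) : M.EE s (M.av f s) = ∑ k, M.w k * f k := by
  have := M.nishimori s hs (Ok.const 1) f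
  have hp := gA_prob (A := A)
  simp only [mul_one] at this
  refine Eq.trans ?_ (this.symm.trans ?_)
  · rfl
  · simp

theorem EE_sq (s : A → ℝ) (hs : ∀ a, 0 ≤ s a) {X : (A → ℝ) → ℝ} (hX : Ok X) : (M.EE s X) ^ 2 ≤ M.EE s (fun z => X z ^ 2) := by
  set c := M.EE s X with hc
  have h1 : 0 ≤ M.EE s (fun z => (X z - c) ^ 2) := M.EE_nonneg s (fun z => sq_nonneg _)
  have h2 : (fun z => (X z - c) ^ 2) = fun z => (X z ^ 2 - (2 * c) * X z) + c ^ 2 := by funext z; ring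
  rw [h2] at h1
  have h3 : M.EE s (fun z => (X z ^ 2 - (2 * c) * X z) + c ^ 2) = M.EE s (fun z => X z ^ 2) - 2 * c * c + c ^ 2 := by
    have o2 : Ok (fun z => X z ^ 2) := hX.pow 2
    have o3 : Ok (fun z => 2 * c * X z) := (Ok.const (2 * c)).mul hX
    rw [M.EE_add s (o2.sub o3) (Ok.const (c ^ 2)), M.EE_sub s o2 o3, M.EE_const_mul, ← hc, M.EE_const s hs]
  rw [h3] at h1; nlinarith
end gen
end FinModel

section scalar
variable {K : ℝ} {S : Finset ℝ} {P : Measure ℝ} [IsProbabilityMeasure P]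

/-- scalar channel -/
def sm (hK : 1 ≤ K) (hS : ∀ x ∈ S, |x| ≤ K) (hP : P ((↑S : Set ℝ)ᶜ) = 0) : FinModel ↥S Unit where
  w k := P.real {(k : ℝ)}
  x k _ := k
  B := K
  hw k := measureReal_nonneg
  hw1 := by
    have := integral_fin' P S hP (fun _ => 1)
    simpa using this.symm
  hB := by linarith
  hx k a := hS _ k.2

variable (hK : 1 ≤ K) (hS : ∀ x ∈ S, |x| ≤ K) (hP : P ((↑S : Set ℝ)ᶜ) = 0)

def spsi (γ : ℝ) : ℝ := (sm hK hS hP).Fr (fun _ => γ)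
def sf (γ : ℝ) : ℝ := (sm hK hS hP).Q (fun k => (k : ℝ)) (fun _ => γ)

theorem sf_pos (hv : 0 < (∫ x, x ^ 2 ∂P) - (∫ x, x ∂P) ^ 2) {γ : ℝ} (hγ : 0 < γ) : 0 < sf hK hS hP γ := by
  set M := sm hK hS hP with hM
  by_contra hc
  have h0 : ∀ x, 0 ≤ x → x ≤ γ → sf hK hS hP x = 0 := fun x hx hxγ => by
    refine le_antisymm (le_trans ?_ (not_lt.1 hc)) (M.Q_nonneg _ _)
    exact M.Q_mono _ (fun _ => hx) (fun _ => hxγ)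
  have hd := M.hasDerivAt_Q (fun _ => 0) (fun _ => 1) (γ / 2) (fun a => Or.inr (by simp; linarith)) (fun k => (k:ℝ))
  simp only [zero_add, mul_one, one_mul, Finset.univ_unique, Finset.sum_singleton] at hd
  have hd0 : HasDerivAt (fun τ : ℝ => M.Q (fun k => (k:ℝ)) fun _ => τ) 0 (γ / 2) := by
    refine (hasDerivAt_const (γ / 2) (0:ℝ)).congr_of_eventuallyEq ?_
    filter_upwards [Icc_mem_nhds (show 0 < γ / 2 by linarith) (show γ / 2 < γ by linarith)] with x hx
    exact h0 x hx.1 hx.2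
  have he := hd.unique hd0
  have hs : ∀ a : Unit, 0 ≤ (fun _ : Unit => γ / 2) a := fun _ => by simp; linarith
  have h1 := M.EE_sq (fun _ => γ / 2) hs (M.Ok_cov (fun k => (k:ℝ)) default (fun _ => γ / 2))
  rw [he] at h1
  have h2 : M.EE (fun _ => γ / 2) (M.cov (fun k => (k:ℝ)) default (fun _ => γ / 2)) = 0 := by nlinarith
  have h3 : M.EE (fun _ => γ / 2) (M.cov (fun k => (k:ℝ)) default (fun _ => γ / 2)) =
      ∑ k, M.w k * (k * k) - sf hK hS hP (γ / 2) := by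
    have : M.cov (fun k => (k:ℝ)) default (fun _ => γ / 2) = fun z => M.av (fun k => (k:ℝ) * k) (fun _ => γ / 2) z - (M.av (fun k => (k:ℝ)) (fun _ => γ / 2) z)^2 := by
      funext z; simp only [FinModel.cov, FinModel.mx, sq]; rfl
    rw [this, M.EE_sub _ (M.Ok_av _ _) ((M.Ok_av _ _).pow 2)]
    congr 1
    exact M.EE_av _ hs _
  rw [h2, h0 _ (by linarith) (by linarith)] at h3
  have h4 := integral_fin' P S hP (fun x => x ^ 2)
  have : (∫ x, x ^ 2 ∂P) = 0 := by
    rw [h4]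
    refine Eq.trans ?_ h3.symm
    rw [sub_zero]; refine Finset.sum_congr rfl fun k _ => ?_; rw [sq]; rfl
  nlinarith [sq_nonneg (∫ x, x ∂P)]

theorem sc (hv : 0 < (∫ x, x ^ 2 ∂P) - (∫ x, x ∂P) ^ 2) : Sc K (spsi hK hS hP) (sf hK hS hP) where
  cψ := (sm hK hS hP).continuous_Fr.comp (by fun_prop)
  cf := ((sm hK hS hP).continuous_Q _).comp (by fun_prop)
  bf h := ⟨(sm hK hS hP).Q_nonneg _ _, (sm hK hS hP).Q_le (fun k => hS _ k.2) _ (fun _ => h)⟩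
  mf h h' := (sm hK hS hP).Q_mono _ (fun _ => h) (fun _ => h')
  pf h := sf_pos hK hS hP hv h
  tan := by
    intro x y h h'
    have := (sm hK hS hP).Fr_tangent (s := fun _ => x) (s' := fun _ => y) (fun _ => h) (fun _ => h')
    simp only [Finset.univ_unique, Finset.sum_singleton] at this
    refine le_trans (le_of_eq ?_) this
    unfold spsi sf
    have : (fun k => (sm hK hS hP).x k default) = fun k : ↥S => (k:ℝ) := rfl
    rw [this]; ring

theorem gAU (X : (Unit → ℝ) → ℝ) : ∫ z, X z ∂(gA Unit) = ∫ y, X (fun _ => y) ∂stdG := by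
  have := (measurePreserving_funUnique stdG Unit).symm
  exact (this.integral_comp (MeasurableEquiv.measurableEmbedding _) X).symm

theorem gAU_int {X : (Unit → ℝ) → ℝ} (h : Integrable X (gA Unit)) : Integrable (fun y => X (fun _ => y)) stdG := by
  have := (measurePreserving_funUnique stdG Unit).symm
  exact (this.integrable_comp_emb (MeasurableEquiv.measurableEmbedding _)).2 h


theorem sw_int (g : ℝ → ℝ) {γ : ℝ} (hγ : 0 ≤ γ) (x : ↥S) (z : ℝ) :
    ∫ y, g y * scalarWeight γ x z y ∂P = ∑ k, (sm hK hS hP).w k * g k *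
      exp ((sm hK hS hP).e (fun _ => γ) ((fun _ => z) + (sm hK hS hP).sh (fun _ => γ) x) k) := by
  rw [integral_fin' P S hP]
  refine Finset.sum_congr rfl fun k _ => ?_
  rw [← mul_assoc]
  congr 1
  unfold scalarWeight
  congr 1
  simp only [FinModel.e, FinModel.sh, sm, Finset.univ_unique, Finset.sum_singleton, Pi.add_apply]
  have := Real.mul_self_sqrt hγ
  linear_combination (-(k:ℝ) * x) * this

theorem psiF_eq {γ : ℝ} (hγ : 0 ≤ γ) : psiF P γ = spsi hK hS hP γ := by
  set M := sm hK hS hP with hM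
  have key : ∀ (x : ↥S) (z : ℝ), log (∫ y, scalarWeight γ x z y ∂P) = M.ell (fun _ => γ) ((fun _ => z) + M.sh (fun _ => γ) x) := by
    intro x z
    have := sw_int hK hS hP (fun _ => 1) hγ x z
    simp only [one_mul, mul_one] at this
    rw [this]; rfl
  unfold psiF spsi FinModel.Fr
  rw [integral_prod, integral_fin' P S hP, M.EE_eq_planted _ (fun _ => hγ) (M.Ok_ell _)]
  · refine Finset.sum_congr rfl fun x _ => ?_
    rw [gAU]
    simp only [key]; rfl
  · refine integrable_prod_fin P stdG S hP _ fun x hx => ?_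
    simp only [key ⟨x, hx⟩]
    refine gAU_int (X := fun z => M.ell (fun _ => γ) (z + M.sh (fun _ => γ) ⟨x, hx⟩)) ?_
    exact (FinModel.Ok.shift (M.Ok_ell _) _).integrable

theorem Fov_eq {γ : ℝ} (hγ : 0 ≤ γ) : Fov P γ = sf hK hS hP γ := by
  set M := sm hK hS hP with hM
  have key : ∀ (x : ↥S) (z : ℝ), postMean P γ x z = M.av (fun k => (k:ℝ)) (fun _ => γ) ((fun _ => z) + M.sh (fun _ => γ) x) := by
    intro x z
    have h1 := sw_int hK hS hP (fun _ => 1) hγ x z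
    have h2 := sw_int hK hS hP (fun y => y) hγ x z
    simp only [one_mul, mul_one] at h1
    unfold postMean
    rw [h1, h2]; rfl
  unfold Fov sf FinModel.Q
  have := M.nishimori _ (fun _ => hγ) (M.Ok_av (fun k => (k:ℝ)) (fun _ => γ)) (fun k => (k:ℝ))
  rw [integral_prod, integral_fin' P S hP]
  · simp only [sq]
    rw [← this]
    refine Finset.sum_congr rfl fun x _ => ?_
    rw [gAU]
    simp only [key]; rfl
  · refine integrable_prod_fin P stdG S hP _ fun x hx => ?_
    simp only [key ⟨x, hx⟩]
    refine gAU_int (X := fun z => x * M.av (fun k => (k:ℝ)) (fun _ => γ) (z + M.sh (fun _ => γ) ⟨x, hx⟩)) ?_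
    refine Integrable.const_mul ?_ _
    exact (FinModel.Ok.shift (M.Ok_av _ _) _).integrable

end scalar

end Part19

section Part20

section marg
variable {A : Type*} [Fintype A]

theorem FinModel.Ok.proj {X : (Unit → ℝ) → ℝ} (hX : FinModel.Ok X) (a : A) : FinModel.Ok fun z : A → ℝ => X (fun _ => z a) := by
  refine ⟨hX.1.comp (by fun_prop), ?_⟩
  obtain ⟨C, hC, h⟩ := hX.2
  refine ⟨C, hC, fun p hp z => (h p hp _).trans (exp_le_exp.2 ?_)⟩
  refine mul_le_mul_of_nonneg_left ?_ hC
  have : |z a| ≤ ∑ a, |z a| := Finset.single_le_sum (f := fun a => |z a|) (fun _ _ => abs_nonneg _) (Finset.mem_univ a)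
  simpa using this

theorem gA_eval (a : A) {g : ℝ → ℝ} (hg : Continuous g) : ∫ z, g (z a) ∂(gA A) = ∫ y, g y ∂stdG := by
  have h := measurePreserving_eval (fun _ : A => stdG) a
  have := integral_map (μ := gA A) (φ := fun z => z a) (f := g) (measurable_pi_apply a).aemeasurable hg.aestronglyMeasurable
  rw [← this]
  exact congrArg (fun μ => ∫ y, g y ∂μ) h.map_eq
end marg

section F0
variable {n : ℕ} {K : ℝ} {S : Finset ℝ} {PU PV : Measure ℝ} [IsProbabilityMeasure PU] [IsProbabilityMeasure PV]

theorem pi_eval_int {P : Measure ℝ} [IsProbabilityMeasure P] (hP : P ((↑S : Set ℝ)ᶜ) = 0) (i : Fin n) (g : ℝ → ℝ) :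
    ∫ u, g (u i) ∂(Measure.pi fun _ : Fin n => P) = ∫ x, g x ∂P := by
  have h := measurePreserving_eval (fun _ : Fin n => P) i
  have := integral_map (μ := Measure.pi fun _ : Fin n => P) (φ := fun z => z i) (f := g) (measurable_pi_apply i).aemeasurable
    (by rw [h.map_eq]; exact (integrable_fin P S hP g).aestronglyMeasurable)
  rw [← this]
  exact congrArg (fun μ => ∫ y, g y ∂μ) h.map_eq

theorem EE_mU (h : Std K S PU PV) (i : Fin n) {t h1 h2 : ℝ} (ht : 0 ≤ t) (hh1 : 0 ≤ h1) (hh2 : 0 ≤ h2) {X : (Unit → ℝ) → ℝ} (hX : FinModel.Ok X) :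
    (mdl n h).EE (snr (Fin n) t h1 h2) (fun z => X (fun _ => z (FinModel.uc i))) = (sm h.hK h.hS h.hU).EE (fun _ => h1) X := by
  rw [FinModel.EE_eq_planted _ _ (FinModel.snr_nonneg ht hh1 hh2) (hX.proj _), FinModel.EE_eq_planted _ _ (fun _ => hh1) hX]
  have key : ∀ c : ℝ, ∫ z, X (fun _ => z (FinModel.uc i) + c) ∂(gA (Ch (Fin n))) = ∫ y, X (fun _ => y + c) ∂stdG := fun c =>
    gA_eval (FinModel.uc i) (g := fun y => X (fun _ => y + c)) (hX.1.comp (by fun_prop))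
  have := sum_mdl n h (fun u _ => ∫ y, X (fun _ => y + √h1 * u i) ∂stdG)
  simp only [integral_const, probReal_univ, smul_eq_mul, one_mul] at this
  rw [pi_eval_int h.hU i (fun x => ∫ y, X (fun _ => y + √h1 * x) ∂stdG), integral_fin' PU S h.hU] at this
  refine Eq.trans ?_ (this.trans ?_)
  · refine Finset.sum_congr rfl fun k _ => ?_
    congr 1
    exact key _
  · refine Finset.sum_congr rfl fun k _ => ?_
    rw [gAU]; rfl

theorem EE_mV (h : Std K S PU PV) (i : Fin n) {t h1 h2 : ℝ} (ht : 0 ≤ t) (hh1 : 0 ≤ h1) (hh2 : 0 ≤ h2) {X : (Unit → ℝ) → ℝ} (hX : FinModel.Ok X) :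
    (mdl n h).EE (snr (Fin n) t h1 h2) (fun z => X (fun _ => z (FinModel.vc i))) = (sm h.hK h.hS h.hV).EE (fun _ => h2) X := by
  rw [FinModel.EE_eq_planted _ _ (FinModel.snr_nonneg ht hh1 hh2) (hX.proj _), FinModel.EE_eq_planted _ _ (fun _ => hh2) hX]
  have key : ∀ c : ℝ, ∫ z, X (fun _ => z (FinModel.vc i) + c) ∂(gA (Ch (Fin n))) = ∫ y, X (fun _ => y + c) ∂stdG := fun c =>
    gA_eval (FinModel.vc i) (g := fun y => X (fun _ => y + c)) (hX.1.comp (by fun_prop))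
  have := sum_mdl n h (fun _ v => ∫ y, X (fun _ => y + √h2 * v i) ∂stdG)
  simp only [integral_const, probReal_univ, smul_eq_mul, one_mul] at this
  rw [pi_eval_int h.hV i (fun x => ∫ y, X (fun _ => y + √h2 * x) ∂stdG), integral_fin' PV S h.hV] at this
  refine Eq.trans ?_ (this.trans ?_)
  · refine Finset.sum_congr rfl fun k _ => ?_
    congr 1
    exact key _
  · refine Finset.sum_congr rfl fun k _ => ?_
    rw [gAU]; rfl

theorem Z_fac (h : Std K S PU PV) (h1 h2 : ℝ) (z : Ch (Fin n) → ℝ) :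
    (mdl n h).Z (snr (Fin n) 0 h1 h2) z = (∏ i, (sm h.hK h.hS h.hU).Z (fun _ => h1) (fun _ => z (FinModel.uc i))) *
      ∏ i, (sm h.hK h.hS h.hV).Z (fun _ => h2) (fun _ => z (FinModel.vc i)) := by
  unfold FinModel.Z FinModel.gz
  rw [Finset.prod_univ_sum, Finset.prod_univ_sum, Finset.sum_mul_sum]
  simp only [Fintype.piFinset_univ]
  rw [Fintype.sum_prod_type]
  refine Finset.sum_congr rfl fun u _ => Finset.sum_congr rfl fun v _ => ?_
  rw [Finset.prod_mul_distrib, Finset.prod_mul_distrib, ← exp_sum, ← exp_sum, mul_mul_mul_comm, ← exp_add]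
  congr 2
  unfold FinModel.e
  rw [Fintype.sum_sum_type, Fintype.sum_sum_type]
  simp [snr, mdl, sm, xx, FinModel.uc, FinModel.vc]

theorem F0 (h : Std K S PU PV) (hn : 1 ≤ n) {h1 h2 : ℝ} (hh1 : 0 ≤ h1) (hh2 : 0 ≤ h2) :
    sF h n 0 h1 h2 = spsi h.hK h.hS h.hU h1 + spsi h.hK h.hS h.hV h2 := by
  have hn0 : (0:ℝ) < n := by exact_mod_cast hn
  set MU := sm h.hK h.hS h.hU
  set MV := sm h.hK h.hS h.hV
  have hl : (mdl n h).ell (snr (Fin n) 0 h1 h2) = fun z => (∑ i, MU.ell (fun _ => h1) (fun _ => z (FinModel.uc i))) +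
      ∑ i, MV.ell (fun _ => h2) (fun _ => z (FinModel.vc i)) := by
    funext z
    unfold FinModel.ell
    rw [Z_fac, Real.log_mul, Real.log_prod, Real.log_prod]
    · exact fun i _ => (FinModel.Z_pos _ _ _).ne'
    · exact fun i _ => (FinModel.Z_pos _ _ _).ne'
    · exact Finset.prod_ne_zero_iff.2 fun i _ => (FinModel.Z_pos _ _ _).ne'
    · exact Finset.prod_ne_zero_iff.2 fun i _ => (FinModel.Z_pos _ _ _).ne'
  unfold sF FinModel.nF FinModel.Fr
  rw [zero_div, hl, FinModel.EE_add, FinModel.EE_sum, FinModel.EE_sum]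
  · simp only [EE_mU h _ le_rfl hh1 hh2 (MU.Ok_ell _), EE_mV h _ le_rfl hh1 hh2 (MV.Ok_ell _)]
    simp only [Finset.sum_const, Finset.card_univ, Fintype.card_fin, nsmul_eq_mul]
    rw [← mul_add, mul_div_cancel_left₀ _ hn0.ne']; rfl
  · exact fun i _ => (MV.Ok_ell _).proj _
  · exact fun i _ => (MU.Ok_ell _).proj _
  · exact FinModel.Ok.sum _ fun i _ => (MU.Ok_ell _).proj _
  · exact FinModel.Ok.sum _ fun i _ => (MV.Ok_ell _).proj _

theorem sysSeq (h : Std K S PU PV) : SysSeq K (spsi h.hK h.hS h.hU) (spsi h.hK h.hS h.hV) (sF h) (sT h) (sA1 h) (sA2 h) where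
  sys n hn := sysn h hn
  F0 n hn h1 h2 hh1 hh2 := F0 h hn hh1 hh2
  dec := sdec h
end F0

end Part20

section Part21

section conv
variable {n : ℕ} {K : ℝ} {S : Finset ℝ} {PU PV : Measure ℝ} [IsProbabilityMeasure PU] [IsProbabilityMeasure PV]

/-- noise matrix from all noise variables -/
def nz (n : ℕ) (z : Ch (Fin n) → ℝ) : Fin n → Fin n → ℝ := fun i j => z (Sum.inl (i, j))
def emb (n : ℕ) (Z : Fin n → Fin n → ℝ) : Ch (Fin n) → ℝ := Sum.elim (fun p => Z p.1 p.2) (fun _ => 0)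

theorem nz_emb (Z : Fin n → Fin n → ℝ) : nz n (emb n Z) = Z := rfl

theorem continuous_emb : Continuous (emb n) := by
  refine continuous_pi fun a => ?_
  rcases a with a | a
  · simp only [emb, Sum.elim_inl]; fun_prop
  · simp only [emb, Sum.elim_inr]; fun_prop

theorem map_inl : (gA (Ch (Fin n))).map (fun z p => z (Sum.inl p)) = gA (Fin n × Fin n) := by
  unfold gA
  refine (Measure.pi_eq fun s hs => ?_).symm
  rw [Measure.map_apply (by fun_prop) (MeasurableSet.univ_pi hs)]
  have : (fun (z : Ch (Fin n) → ℝ) p => z (Sum.inl p)) ⁻¹' (Set.univ.pi s) = Set.univ.pi (Sum.elim s (fun _ => Set.univ) : Ch (Fin n) → Set ℝ) := by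
    ext z
    simp only [Set.mem_preimage, Set.mem_univ_pi, Sum.forall, Sum.elim_inl, Sum.elim_inr]
    simp
  rw [this, Measure.pi_pi, Fintype.prod_sum_type]
  simp

theorem map_nz : (gA (Ch (Fin n))).map (nz n) = noiseM n := by
  have h1 : nz n = (MeasurableEquiv.curry (Fin n) (Fin n) ℝ) ∘ (fun z p => z (Sum.inl p)) := rfl
  have h2 := Measure.infinitePi_map_curry (fun (_ : Fin n) (_ : Fin n) => stdG)
  rw [h1, ← Measure.map_map (MeasurableEquiv.measurable _) (by fun_prop), map_inl]
  simp only [Measure.infinitePi_eq_pi] at h2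
  exact h2

theorem measurable_nz : Measurable (nz n) := by unfold nz; fun_prop

instance noiseM_prob : IsProbabilityMeasure (noiseM n) := by unfold noiseM; infer_instance
instance prior_prob : IsProbabilityMeasure (prior PU PV n) := by unfold prior; infer_instance

theorem prior_null (h : Std K S PU PV) : prior PU PV n ((↑((Fintype.piFinset fun _ : Fin n => S) ×ˢ (Fintype.piFinset fun _ : Fin n => S)) : Set ((Fin n → ℝ) × (Fin n → ℝ)))ᶜ) = 0 := by
  rw [prob_compl_eq_zero_iff (Finset.measurableSet _), Finset.coe_product, prior, Measure.prod_prod,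
    (prob_compl_eq_zero_iff (Finset.measurableSet _)).1 (pi_null (fun _ : Fin n => PU) S fun _ => h.hU),
    (prob_compl_eq_zero_iff (Finset.measurableSet _)).1 (pi_null (fun _ : Fin n => PV) S fun _ => h.hV), one_mul]

theorem prior_int (h : Std K S PU PV) (f : (Fin n → ℝ) × (Fin n → ℝ) → ℝ) :
    ∫ uv, f uv ∂(prior PU PV n) = ∑ k, (mdl n h).w k * f (fun i => k.1 i, fun i => k.2 i) := by
  have hi := integrable_fin _ _ (prior_null (n := n) h) f
  rw [sum_mdl n h (fun u v => f (u, v))]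
  exact integral_prod _ hi

theorem sample_int (h : Std K S PU PV) (g : ((Fin n → ℝ) × (Fin n → ℝ)) × (Fin n → Fin n → ℝ) → ℝ)
    (X : (Fin n → ↥S) × (Fin n → ↥S) → (Ch (Fin n) → ℝ) → ℝ) (hX : ∀ k, FinModel.Ok (X k))
    (hg : ∀ k z, g ((fun i => k.1 i, fun i => k.2 i), nz n z) = X k z) :
    ∫ ω, g ω ∂(sampleM PU PV n) = ∑ k, (mdl n h).w k * ∫ z, X k z ∂(gA (Ch (Fin n))) := by
  have hc : ∀ k : (Fin n → ↥S) × (Fin n → ↥S), Continuous fun Z => g ((fun i => k.1 i, fun i => k.2 i), Z) := by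
    intro k
    have : (fun Z => g ((fun i => (k.1 i : ℝ), fun i => (k.2 i : ℝ)), Z)) = fun Z => X k (emb n Z) := by
      funext Z; rw [← hg, nz_emb]
    rw [this]; exact (hX k).1.comp continuous_emb
  have hi : Integrable g (sampleM PU PV n) := by
    refine integrable_prod_fin _ _ _ (prior_null (n := n) h) g fun x hx => ?_
    rw [Finset.mem_product, Fintype.mem_piFinset, Fintype.mem_piFinset] at hx
    have hc' := hc (fun i => ⟨x.1 i, hx.1 i⟩, fun i => ⟨x.2 i, hx.2 i⟩)
    have hg' := hg (fun i => ⟨x.1 i, hx.1 i⟩, fun i => ⟨x.2 i, hx.2 i⟩)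
    simp only at hc' hg'
    rw [← map_nz, integrable_map_measure hc'.aestronglyMeasurable measurable_nz.aemeasurable]
    refine (hX (fun i => ⟨x.1 i, hx.1 i⟩, fun i => ⟨x.2 i, hx.2 i⟩)).integrable.congr (Eventually.of_forall fun z => ?_)
    exact (hg' z).symm
  unfold sampleM at hi ⊢
  rw [integral_prod _ hi, prior_int h]
  refine Finset.sum_congr rfl fun k _ => ?_
  congr 1
  rw [← map_nz, integral_map measurable_nz.aemeasurable (hc k).aestronglyMeasurable]
  simp only [hg]

theorem Ham_eq (h : Std K S PU PV) {lam : ℝ} (hl : 0 ≤ lam) (k k0 : (Fin n → ↥S) × (Fin n → ↥S)) (z : Ch (Fin n) → ℝ) :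
    Ham lam n (fun i => k0.1 i) (fun i => k0.2 i) (nz n z) (fun i => k.1 i) (fun i => k.2 i)
      = (mdl n h).e (snr (Fin n) (lam / n) 0 0) (z + (mdl n h).sh (snr (Fin n) (lam / n) 0 0) k0) k := by
  unfold FinModel.e Ham
  rw [Fintype.sum_sum_type, Fintype.sum_sum_type, Fintype.sum_prod_type]
  simp only [FinModel.sh, snr, Sum.elim_inl, Sum.elim_inr, mdl, xx, Pi.add_apply, nz, Real.sqrt_zero, zero_mul, zero_div, sub_zero, Finset.sum_const_zero, add_zero]
  refine Finset.sum_congr rfl fun i _ => Finset.sum_congr rfl fun j _ => ?_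
  have := Real.mul_self_sqrt (show 0 ≤ lam / n by positivity)
  have e2 : lam / (2 * n) = lam / n / 2 := by ring
  rw [e2]
  linear_combination (-(k.1 i : ℝ) * k.2 j * (k0.1 i * k0.2 j)) * this

theorem gibbs_eq (h : Std K S PU PV) {lam : ℝ} (hl : 0 ≤ lam) (k0 : (Fin n → ↥S) × (Fin n → ↥S)) (z : Ch (Fin n) → ℝ)
    (f : (Fin n → ℝ) × (Fin n → ℝ) → ℝ) :
    gibbs PU PV lam n ((fun i => k0.1 i, fun i => k0.2 i), nz n z) f
      = (mdl n h).av (fun k => f (fun i => k.1 i, fun i => k.2 i)) (snr (Fin n) (lam / n) 0 0) (z + (mdl n h).sh (snr (Fin n) (lam / n) 0 0) k0) := by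
  unfold gibbs partFun
  rw [prior_int h, prior_int h]
  simp only [Ham_eq h hl]
  unfold FinModel.av FinModel.ga FinModel.gz
  simp only [mul_assoc]

theorem overlap_eq (h : Std K S PU PV) {lam : ℝ} (hl : 0 ≤ lam) : overlapExp PU PV n lam = sT h n lam 0 0 := by
  set M := mdl n h with hM
  set s := snr (Fin n) (lam / n) 0 0 with hs
  have hs0 : ∀ a, 0 ≤ s a := FinModel.snr_nonneg (by positivity) le_rfl le_rfl
  set f : Fin n → Fin n → (Fin n → ↥S) × (Fin n → ↥S) → ℝ := fun i j k => k.1 i * k.2 j with hf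
  unfold overlapExp
  rw [sample_int h _ (fun k0 z => ∑ i, ∑ j, (1 / (n:ℝ)) ^ 2 * (f i j k0 * M.av (f i j) s (z + M.sh s k0)))]
  · have : ∀ k0, ∫ z, ∑ i, ∑ j, (1 / (n:ℝ)) ^ 2 * (f i j k0 * M.av (f i j) s (z + M.sh s k0)) ∂(gA (Ch (Fin n)))
        = ∑ i, ∑ j, (1 / (n:ℝ)) ^ 2 * ∫ z, (f i j k0 * M.av (f i j) s (z + M.sh s k0)) ∂(gA (Ch (Fin n))) := by
      intro k0
      rw [integral_finsetSum]
      · refine Finset.sum_congr rfl fun i _ => ?_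
        rw [integral_finsetSum]
        · refine Finset.sum_congr rfl fun j _ => ?_
          rw [integral_const_mul]
        · exact fun j _ => (((M.Ok_av (f i j) s).shift _).integrable.const_mul _).const_mul _
      · exact fun i _ => integrable_finsetSum _ fun j _ => (((M.Ok_av (f i j) s).shift _).integrable.const_mul _).const_mul _
    simp only [this]
    have e : ∑ k, (mdl n h).w k * ∑ i, ∑ j, (1 / (n:ℝ)) ^ 2 * ∫ z, (f i j k * M.av (f i j) s (z + M.sh s k)) ∂(gA (Ch (Fin n)))
        = ∑ i, ∑ j, (1 / (n:ℝ)) ^ 2 * ∑ k, M.w k * ∫ z, (f i j k * M.av (f i j) s (z + M.sh s k)) ∂(gA (Ch (Fin n))) := by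
      simp only [Finset.mul_sum]
      rw [Finset.sum_comm]
      refine Finset.sum_congr rfl fun i _ => ?_
      rw [Finset.sum_comm]
      refine Finset.sum_congr rfl fun j _ => Finset.sum_congr rfl fun k _ => ?_
      ring
    rw [e]
    unfold sT FinModel.nT
    rw [FinModel.EE_Tt, Finset.sum_div]
    refine Finset.sum_congr rfl fun i _ => ?_
    rw [Finset.sum_div]
    refine Finset.sum_congr rfl fun j _ => ?_
    rw [M.nishimori s hs0 (M.Ok_av _ _), Fintype.card_fin, one_div, inv_pow, mul_comm, ← div_eq_mul_inv]
    unfold FinModel.Q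
    simp only [sq]; rfl
  · intro k
    exact FinModel.Ok.sum _ fun i _ => FinModel.Ok.sum _ fun j _ => (FinModel.Ok.const _).mul ((FinModel.Ok.const _).mul ((M.Ok_av (f i j) s).shift _))
  · intro k0 z
    rw [gibbs_eq h hl]
    have : (fun k : (Fin n → ↥S) × (Fin n → ↥S) => ovDot n (fun i => (k.1 i:ℝ)) (fun i => (k0.1 i:ℝ)) * ovDot n (fun i => (k.2 i:ℝ)) (fun i => (k0.2 i:ℝ)))
      = fun k => ∑ i, ∑ j, ((1 / (n:ℝ)) ^ 2 * f i j k0) * f i j k := by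
      funext k
      unfold ovDot
      rw [mul_mul_mul_comm, Finset.sum_mul_sum, Finset.mul_sum]
      refine Finset.sum_congr rfl fun i _ => ?_
      rw [Finset.mul_sum]
      refine Finset.sum_congr rfl fun j _ => ?_
      simp only [hf]; ring
    simp only
    rw [this]
    unfold FinModel.av
    rw [M.ga_sum]
    refine Finset.sum_congr rfl fun i _ => ?_
    rw [M.ga_sum]
    refine Finset.sum_congr rfl fun j _ => ?_
    rw [M.ga_const_mul, mul_assoc]

theorem mmse_eq (h : Std K S PU PV) (hn : 1 ≤ n) {lam : ℝ} (hl : 0 ≤ lam) :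
    MMSEn PU PV n lam = (∫ x, x ^ 2 ∂PU) * (∫ x, x ^ 2 ∂PV) - sT h n lam 0 0 := by
  set M := mdl n h with hM
  set s := snr (Fin n) (lam / n) 0 0 with hs
  have hn0 : (0:ℝ) < n := by exact_mod_cast hn
  have hs0 : ∀ a, 0 ≤ s a := FinModel.snr_nonneg (by positivity) le_rfl le_rfl
  set f : Fin n → Fin n → (Fin n → ↥S) × (Fin n → ↥S) → ℝ := fun i j k => k.1 i * k.2 j with hf
  have key : ∀ i j, ∫ ω, (ω.1.1 i * ω.1.2 j - gibbs PU PV lam n ω fun uv => uv.1 i * uv.2 j) ^ 2 ∂(sampleM PU PV n)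
      = (∫ x, x ^ 2 ∂PU) * (∫ x, x ^ 2 ∂PV) - M.Q (f i j) s := by
    intro i j
    have o := M.Ok_av (f i j) s
    rw [sample_int h _ (fun k0 z => (f i j k0 - M.av (f i j) s (z + M.sh s k0)) ^ 2)]
    · have h1 : ∀ k, ∫ z, (f i j k - M.av (f i j) s (z + M.sh s k)) ^ 2 ∂(gA (Ch (Fin n)))
          = f i j k ^ 2 - 2 * ∫ z, f i j k * M.av (f i j) s (z + M.sh s k) ∂(gA (Ch (Fin n)))
            + ∫ z, (M.av (f i j) s (z + M.sh s k)) ^ 2 ∂(gA (Ch (Fin n))) := by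
        intro k
        have hp := gA_prob (A := Ch (Fin n))
        have i2 := ((o.shift (M.sh s k)).pow 2).integrable
        have i1 := ((o.shift (M.sh s k)).integrable.const_mul (f i j k)).const_mul 2
        have : (fun z => (f i j k - M.av (f i j) s (z + M.sh s k)) ^ 2) = fun z =>
          (f i j k ^ 2 - 2 * (f i j k * M.av (f i j) s (z + M.sh s k))) + (M.av (f i j) s (z + M.sh s k)) ^ 2 := by
          funext z; ring
        have i3 : Integrable (fun z => f i j k ^ 2 - 2 * (f i j k * M.av (f i j) s (z + M.sh s k))) (gA (Ch (Fin n))) := (integrable_const _).sub i1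
        rw [this, integral_add i3 i2, integral_sub (integrable_const _) i1, integral_const_mul]
        simp
      simp only [h1, mul_add, mul_sub, Finset.sum_add_distrib, Finset.sum_sub_distrib]
      have h2 := M.nishimori s hs0 o (f i j)
      have h3 := M.EE_eq_planted s hs0 (o.pow 2)
      rw [← h3]
      have h4 : ∑ x, (mdl n h).w x * (2 * ∫ z, f i j x * M.av (f i j) s (z + M.sh s x) ∂(gA (Ch (Fin n)))) = 2 * M.Q (f i j) s := by
        unfold FinModel.Q
        simp only [sq]
        rw [← h2, Finset.mul_sum]
        refine Finset.sum_congr rfl fun k _ => ?_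
        ring
      rw [h4]
      have h5 : ∑ x, (mdl n h).w x * f i j x ^ 2 = (∫ x, x ^ 2 ∂PU) * (∫ x, x ^ 2 ∂PV) := by
        have := sum_mdl n h (fun u v => u i ^ 2 * v j ^ 2)
        simp only [integral_const_mul, integral_mul_const] at this
        rw [pi_eval_int h.hU i (fun x => x ^ 2), pi_eval_int h.hV j (fun x => x ^ 2)] at this
        rw [← this]
        simp only [hf, mul_pow]
      rw [h5]
      unfold FinModel.Q
      ring
    · intro k
      exact ((FinModel.Ok.const _).sub (o.shift _)).pow 2
    · intro k z
      rw [gibbs_eq h hl]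
  unfold MMSEn
  simp only [key, Finset.sum_sub_distrib, Finset.sum_const, Finset.card_univ, Fintype.card_fin, nsmul_eq_mul]
  unfold sT FinModel.nT
  rw [FinModel.EE_Tt, Fintype.card_fin]
  have : ∀ i j, M.Q (f i j) s = (mdl n h).Q (fun k => (mdl n h).x k (FinModel.uc i) * (mdl n h).x k (FinModel.vc j)) (snr (Fin n) (lam / n) 0 0) := fun i j => rfl
  simp only [this]
  field_simp
end conv

theorem mmse_final
    (K₀ : ℝ) (S : Finset ℝ) (hSK : ∀ x ∈ S, |x| ≤ K₀)
    (PU PV : Measure ℝ) [IsProbabilityMeasure PU] [IsProbabilityMeasure PV]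
    (hUS : PU ((↑S : Set ℝ)ᶜ) = 0) (hVS : PV ((↑S : Set ℝ)ᶜ) = 0)
    (hUvar : 0 < (∫ x, x ^ 2 ∂PU) - (∫ x, x ∂PU) ^ 2)
    (hVvar : 0 < (∫ x, x ^ 2 ∂PV) - (∫ x, x ∂PV) ^ 2) :
    (Set.Ioi (0 : ℝ) \ Dset PU PV).Countable
    ∧ ∀ lam ∈ Dset PU PV, ∀ q : ℝ × ℝ, isMaximizer PU PV lam q →
        Tendsto (fun n => MMSEn PU PV n lam) atTop
          (𝓝 ((∫ x, x ^ 2 ∂PU) * (∫ x, x ^ 2 ∂PV) - q.1 * q.2))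
        ∧ Tendsto (fun n => overlapExp PU PV n lam) atTop (𝓝 (q.1 * q.2)) := by
  have h : Std (max K₀ 1) S PU PV := ⟨le_max_right _ _, fun x hx => (hSK x hx).trans (le_max_left _ _), hUS, hVS⟩
  have s := sysSeq h
  have s1 := sc h.hK h.hS h.hU hUvar
  have s2 := sc h.hK h.hS h.hV hVvar
  set ψ1 := spsi h.hK h.hS h.hU
  set ψ2 := spsi h.hK h.hS h.hV
  set f1 := sf h.hK h.hS h.hU
  set f2 := sf h.hK h.hS h.hV
  have hG : ∀ l, 0 < l → Gam PU PV l = GG f1 f2 l := by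
    intro l hl
    ext q
    constructor
    · rintro ⟨a, b, c, d⟩
      exact ⟨a, b, by rw [c, Fov_eq h.hK h.hS h.hU (by positivity)], by rw [d, Fov_eq h.hK h.hS h.hV (by positivity)]⟩
    · rintro ⟨a, b, c, d⟩
      exact ⟨a, b, c.trans (Fov_eq h.hK h.hS h.hU (by positivity)).symm, d.trans (Fov_eq h.hK h.hS h.hV (by positivity)).symm⟩
  have hr : ∀ l, 0 < l → ∀ q ∈ GG f1 f2 l, rsF PU PV l q.1 q.2 = rr ψ1 ψ2 l q := by
    intro l hl q hq
    have a := hq.1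
    have b := hq.2.1
    unfold rsF rr
    rw [psiF_eq h.hK h.hS h.hU (by positivity), psiF_eq h.hK h.hS h.hV (by positivity)]
  have hM : ∀ l, 0 < l → ∀ q, isMaximizer PU PV l q ↔ IsM ψ1 ψ2 f1 f2 l q := by
    intro l hl q
    unfold isMaximizer IsM
    rw [hG l hl]
    constructor
    · rintro ⟨a, b⟩
      exact ⟨a, fun q' hq' => by rw [← hr l hl q' hq', ← hr l hl q a]; exact b q' hq'⟩
    · rintro ⟨a, b⟩
      exact ⟨a, fun q' hq' => by rw [hr l hl q' hq', hr l hl q a]; exact b q' hq'⟩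
  have hD : Dset PU PV = {l | 0 < l ∧ ∃! q, IsM ψ1 ψ2 f1 f2 l q} := by
    ext l
    constructor
    · rintro ⟨a, b⟩
      exact ⟨a, by simpa only [hM l a] using b⟩
    · rintro ⟨a, b⟩
      exact ⟨a, by simpa only [hM l a] using b⟩
  refine ⟨by rw [hD]; exact s.countable_bad s1 s2, ?_⟩
  intro lam hlam q hq
  obtain ⟨hl, hu⟩ := hlam
  have hT := s.T_tend s1 s2 hl ((hM lam hl q).1 hq) (fun p hp => hu.unique ((hM lam hl p).2 hp) hq)
  refine ⟨?_, ?_⟩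
  · refine (hT.const_sub _).congr' ?_
    filter_upwards [eventually_ge_atTop 1] with n hn
    exact (mmse_eq h hn hl.le).symm
  · exact hT.congr fun n => (overlap_eq h hl.le).symm

end Part21

/-- **Limit of the MMSE.**  `(0,∞) ∖ D` is countable and, for `λ ∈ D` with (unique)
maximizer `(q₁*,q₂*)`, `MMSE_n(λ) → E[U²]E[V²] − q₁*q₂*` and `E⟨(u·U)(v·V)⟩ → q₁*q₂*`. -/
theorem mmse_limit
    (K₀ : ℝ) (S : Finset ℝ) (hSK : ∀ x ∈ S, |x| ≤ K₀)
    (PU PV : Measure ℝ) [IsProbabilityMeasure PU] [IsProbabilityMeasure PV]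
    (hUS : PU ((↑S : Set ℝ)ᶜ) = 0) (hVS : PV ((↑S : Set ℝ)ᶜ) = 0)
    (hUvar : 0 < (∫ x, x ^ 2 ∂PU) - (∫ x, x ∂PU) ^ 2)
    (hVvar : 0 < (∫ x, x ^ 2 ∂PV) - (∫ x, x ∂PV) ^ 2) :
    (Set.Ioi (0 : ℝ) \ Dset PU PV).Countable
    ∧ ∀ lam ∈ Dset PU PV, ∀ q : ℝ × ℝ, isMaximizer PU PV lam q →
        Tendsto (fun n => MMSEn PU PV n lam) atTop
          (𝓝 ((∫ x, x ^ 2 ∂PU) * (∫ x, x ^ 2 ∂PV) - q.1 * q.2))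
        ∧ Tendsto (fun n => overlapExp PU PV n lam) atTop (𝓝 (q.1 * q.2)) := by
  exact mmse_final K₀ S hSK PU PV hUS hVS hUvar hVvar
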